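/- arXiv:math/0407292 — 2 statements merged into one kernel-verified Lean document; each statement's English description precedes it below -/
import Mathlib

section
/- For every n in the set I = {22, 23, 30, 31, 38, 39, 40, 41, 42, 43, 46, 47, 48, 49, 50, 51}, the minimum number of edges of a maximal nontraceable graph of order n equals ⌈(3n − 2)/2⌉; that is, every maximal nontraceable graph of order n has at least ⌈(3n − 2)/2⌉ edges, and there exists a maximal nontraceable graph of order n with exactly ⌈(3n − 2)/2⌉ edges. -/
open SimpleGraph

/-- A graph is traceable if it has a Hamiltonian path, i.e. a path containing
all the vertices of the graph. -/
def Traceable {V : Type*} (G : SimpleGraph V) : Prop :=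
  ∃ (u v : V) (p : G.Walk u v), p.IsPath ∧ ∀ w, w ∈ p.support

/-- A graph is maximal nontraceable if it is not traceable, but adding any edge
of the complement produces a traceable graph. -/
def MaxNontraceable {V : Type*} (G : SimpleGraph V) : Prop :=
  ¬ Traceable G ∧ ∀ u v : V, u ≠ v → ¬ G.Adj u v → Traceable (G ⊔ SimpleGraph.edge u v)

section Paths

variable {V : Type*} {G : SimpleGraph V}

/-- The list `l` is the vertex sequence of a Hamiltonian path of `G`. -/
def HamList (G : SimpleGraph V) (l : List V) : Prop :=
  l.IsChain G.Adj ∧ l.Nodup ∧ ∀ w, w ∈ l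

/-- The lists `X` and `Y` are the vertex sequences of two disjoint paths that together cover
all vertices of `G`. -/
def Cover (G : SimpleGraph V) (X Y : List V) : Prop :=
  X.IsChain G.Adj ∧ Y.IsChain G.Adj ∧ (X ++ Y).Nodup ∧ ∀ w, w ∈ X ++ Y

theorem traceable_of_hamList [Nonempty V] {l : List V} (h : HamList G l) : Traceable G := by
  obtain ⟨hc, hn, hm⟩ := h
  have hne : l ≠ [] := List.ne_nil_of_mem (hm (Classical.arbitrary V))
  refine ⟨_, _, Walk.ofSupport l hne hc, ?_, ?_⟩
  · rw [Walk.isPath_def, Walk.support_ofSupport]; exact hn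
  · rw [Walk.support_ofSupport]; exact hm

theorem Traceable.exists_hamList (h : Traceable G) : ∃ l, HamList G l := by
  obtain ⟨u, v, p, hp, hm⟩ := h
  exact ⟨p.support, p.isChain_adj_support, (Walk.isPath_def p).1 hp, hm⟩

theorem chain_reverse {l : List V} : l.reverse.IsChain G.Adj ↔ l.IsChain G.Adj := by
  rw [List.isChain_reverse]
  constructor <;> exact fun h => h.imp fun _ _ h => h.symm

theorem HamList.reverse {l : List V} (h : HamList G l) : HamList G l.reverse :=
  ⟨chain_reverse.2 h.1, List.nodup_reverse.2 h.2.1, by simpa using h.2.2⟩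

theorem Cover.symm {X Y : List V} (h : Cover G X Y) : Cover G Y X :=
  ⟨h.2.1, h.1, by have := h.2.2.1; rw [List.nodup_append_comm]; exact this,
    by have := h.2.2.2; intro w; have := this w; simp at this ⊢; tauto⟩

theorem Cover.hamList {a b : V} {A B : List V} (h : Cover G (a :: A) (b :: B))
    (hab : G.Adj a b) : HamList G ((a :: A).reverse ++ b :: B) := by
  obtain ⟨h1, h2, h3, h4⟩ := h
  refine ⟨?_, ?_, ?_⟩
  · rw [List.isChain_append]
    refine ⟨chain_reverse.2 h1, h2, ?_⟩
    simp_all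
  · rw [List.nodup_append] at h3 ⊢
    simp only [List.nodup_reverse, List.mem_reverse]
    exact h3
  · intro w; have := h4 w; simp at this ⊢; tauto

theorem sup_edge_adj_iff {a b u v : V} (hab : a ≠ b) :
    (G ⊔ edge a b).Adj u v ↔ G.Adj u v ∨ (u = a ∧ v = b) ∨ (u = b ∧ v = a) := by
  simp only [sup_adj, edge_adj]
  constructor
  · tauto
  · rintro (h | ⟨rfl, rfl⟩ | ⟨rfl, rfl⟩) <;> simp_all [Ne.symm]

theorem traceable_sup_edge_of_cover {a b : V} {A B : List V} (hab : a ≠ b)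
    (h : Cover G (a :: A) (b :: B)) : Traceable (G ⊔ edge a b) := by
  have : Nonempty V := ⟨a⟩
  refine traceable_of_hamList (l := (a :: A).reverse ++ b :: B) (Cover.hamList ⟨?_, ?_, h.2.2⟩ ?_)
  · exact h.1.imp fun _ _ h => Or.inl h
  · exact h.2.1.imp fun _ _ h => Or.inl h
  · rw [sup_edge_adj_iff hab]; simp

theorem chain_of_sup_edge {a b : V} (hab : a ≠ b) {l : List V}
    (hc : l.IsChain (G ⊔ edge a b).Adj) (h : a ∉ l ∨ b ∉ l) : l.IsChain G.Adj := by
  rw [List.isChain_iff_forall_rel_of_append_cons_cons] at hc ⊢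
  intro u w A B hl
  have := (sup_edge_adj_iff hab).1 (hc hl)
  subst hl
  simp at h
  grind

theorem HamList.exists_cover {a b : V} (hab : a ≠ b) {l : List V}
    (h : HamList (G ⊔ edge a b) l) (hG : ¬ HamList G l) :
    ∃ A B, Cover G (a :: A) (b :: B) ∧
      (l = (a :: A).reverse ++ b :: B ∨ l = (b :: B).reverse ++ a :: A) := by
  obtain ⟨hc, hn, hm⟩ := h
  have hG' : ¬ l.IsChain G.Adj := fun h => hG ⟨h, hn, hm⟩
  rw [List.isChain_iff_forall_rel_of_append_cons_cons] at hG'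
  push Not at hG'
  obtain ⟨c, d, A, B, rfl, hcd⟩ := hG'
  have hK : (G ⊔ edge a b).Adj c d :=
    (List.isChain_iff_forall_rel_of_append_cons_cons.1 hc) rfl
  have hcd' := ((sup_edge_adj_iff hab).1 hK).resolve_left hcd
  have h1 : (A ++ [c]).IsChain (G ⊔ edge a b).Adj :=
    List.IsChain.left_of_append (l₂ := d :: B) (by simpa using hc)
  have h2 : (d :: B).IsChain (G ⊔ edge a b).Adj :=
    List.IsChain.right_of_append (l₁ := A ++ [c]) (by simpa using hc)
  have hn' : (A ++ [c] ++ d :: B).Nodup := by simpa using hn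
  rw [List.nodup_append] at hn'
  have hd : d ∉ A ++ [c] := fun h => hn'.2.2 d h d (by simp) rfl
  have hc' : c ∉ d :: B := fun h => hn'.2.2 c (by simp) c h rfl
  have hcov : Cover G (c :: A.reverse) (d :: B) := by
    refine ⟨?_, chain_of_sup_edge hab h2 (by grind), ?_, ?_⟩
    · have := chain_reverse.2 (chain_of_sup_edge hab h1 (by grind))
      simpa using this
    · have : (c :: A.reverse).reverse.Nodup := by simpa using hn'.1
      rw [List.nodup_append]
      exact ⟨List.nodup_reverse.1 this, hn'.2.1, fun x hx y hy => hn'.2.2 x (by simp at hx ⊢; tauto) y hy⟩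
    · intro w
      have := hm w
      simp at this ⊢
      tauto
  rcases hcd' with ⟨rfl, rfl⟩ | ⟨rfl, rfl⟩
  · exact ⟨_, _, hcov, Or.inl (by simp)⟩
  · exact ⟨_, _, hcov.symm, Or.inr (by simp)⟩

theorem MaxNontraceable.exists_cover (hG : MaxNontraceable G) {a b : V} (hab : a ≠ b)
    (h : ¬ G.Adj a b) : ∃ A B, Cover G (a :: A) (b :: B) := by
  have : Nonempty V := ⟨a⟩
  obtain ⟨l, hl⟩ := (hG.2 a b hab h).exists_hamList
  obtain ⟨A, B, hAB, -⟩ := hl.exists_cover hab fun h' => hG.1 (traceable_of_hamList h')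
  exact ⟨A, B, hAB⟩

theorem adj_of_degree_two (hG : MaxNontraceable G) {v x y : V} (hxy : x ≠ y)
    (hv : ∀ u, G.Adj v u ↔ u = x ∨ u = y) : G.Adj x y := by
  by_contra hn
  have : Nonempty V := ⟨x⟩
  have key : ∀ x y, x ≠ y → (∀ u, G.Adj v u ↔ u = x ∨ u = y) → ∀ A B, v ∈ A →
      Cover G (x :: A) (y :: B) → False := by
    intro x y hxy hv A B hvA h
    obtain ⟨A1, A2, rfl⟩ := List.append_of_mem hvA
    have hA1 : A1 = [] := by
      rcases List.eq_nil_or_concat A1 with h1 | ⟨L, p, rfl⟩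
      · exact h1
      · have := (hv p)
        have := G.adj_comm p v
        simp [Cover, List.isChain_append, List.isChain_cons] at h
        grind
    have hA2 : A2 = [] := by
      rcases A2 with _ | ⟨p, L⟩
      · rfl
      · have := (hv p)
        simp [Cover, List.isChain_append, List.isChain_cons] at h
        grind
    subst hA1 hA2
    refine hG.1 (traceable_of_hamList (l := x :: v :: y :: B) ?_)
    have hvx := (G.adj_comm x v).trans (hv x)
    have hvy := hv y
    simp [Cover, HamList, List.isChain_cons] at h ⊢
    grind
  obtain ⟨A, B, h⟩ := hG.exists_cover hxy hn
  have hv' := h.2.2.2 v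
  have := G.loopless.irrefl v
  have hvx := hv x
  have hvy := hv y
  have : v ∈ A ∨ v ∈ B := by
    simp at hv'; grind
  rcases this with h' | h'
  · exact key x y hxy hv A B h' h
  · exact key y x hxy.symm (by intro u; rw [hv]; tauto) B A h' h.symm

end Paths

section Surgery

variable {V : Type*} {G : SimpleGraph V}

theorem chain_reverse_append {q : V} {A C : List V} (hA : (q :: A).IsChain G.Adj)
    (hC : (q :: C).IsChain G.Adj) : (A.reverse ++ q :: C).IsChain G.Adj := by
  rw [List.isChain_append]
  refine ⟨chain_reverse.2 hA.tail, hC, ?_⟩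
  simp [List.isChain_cons] at hA ⊢
  exact fun x hx => (hA.1 x hx).symm

theorem eq_nil_of_forall_not_adj {P : List V} {v : V} {Q : List V}
    (hc : (P ++ v :: Q).IsChain G.Adj) (h : ∀ p ∈ P, ¬ G.Adj v p) : P = [] := by
  rcases List.eq_nil_or_concat P with h1 | ⟨L, p, rfl⟩
  · exact h1
  · have := G.adj_comm p v
    simp [List.isChain_append, List.isChain_cons] at hc
    grind

theorem eq_nil_of_forall_not_adj' {P : List V} {v : V} {Q : List V}
    (hc : (P ++ v :: Q).IsChain G.Adj) (h : ∀ p ∈ Q, ¬ G.Adj v p) : Q = [] := by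
  have := chain_reverse.2 hc
  simp only [List.reverse_append, List.reverse_cons, List.append_assoc, List.singleton_append] at this
  simpa using eq_nil_of_forall_not_adj this (by simpa using h)

theorem Cover.hamList_of_perm {X Y l : List V} (h : Cover G X Y) (hl : l.IsChain G.Adj)
    (hp : ∀ [DecidableEq V] u, l.count u = (X ++ Y).count u) : HamList G l := by
  classical
  have hp' : l.Perm (X ++ Y) := List.perm_iff_count.2 hp
  exact ⟨hl, hp'.nodup_iff.2 h.2.2.1, fun w => hp'.mem_iff.2 (h.2.2.2 w)⟩

/-- A vertex of degree two is not adjacent to a vertex of degree one. -/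
theorem not_degree_two_of_adj_pendant [Fintype V] (hV : 4 ≤ Fintype.card V)
    (hG : MaxNontraceable G) {w z t : V} (hwt : w ≠ t)
    (hw : ∀ u, G.Adj w u ↔ u = z) (hz : ∀ u, G.Adj z u ↔ u = w ∨ u = t) : False := by
  have hzt : z ≠ t := fun h => G.loopless.irrefl z (h ▸ (hz t).2 (Or.inr rfl))
  have hzw : z ≠ w := fun h => G.loopless.irrefl z ((hz z).2 (Or.inl h))
  have : Nonempty V := ⟨w⟩
  obtain ⟨A, B, h⟩ := hG.exists_cover hwt (by rw [hw]; exact hzt.symm)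
  have hm := h.2.2.2 z
  have hn := h.2.2.1
  have hz' : z ∈ A ∨ z ∈ B := by simp at hm; grind
  rcases hz' with hz' | hz'
  · obtain ⟨A1, A2, rfl⟩ := List.append_of_mem hz'
    have hA1 : A1 = [] := eq_nil_of_forall_not_adj (h.1.tail : (A1 ++ z :: A2).IsChain G.Adj)
      (by simp only [hz]; grind)
    have hA2 : A2 = [] := eq_nil_of_forall_not_adj' (h.1.tail : (A1 ++ z :: A2).IsChain G.Adj)
      (by simp only [hz]; grind)
    subst hA1 hA2
    refine hG.1 (traceable_of_hamList (l := w :: z :: t :: B) ?_)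
    simp [Cover, HamList, List.isChain_cons] at h ⊢
    grind
  · obtain ⟨B1, B2, rfl⟩ := List.append_of_mem hz'
    have hB1 : B1 = [] := eq_nil_of_forall_not_adj (h.2.1.tail : (B1 ++ z :: B2).IsChain G.Adj)
      (by simp only [hz]; grind)
    have hB2 : B2 = [] := eq_nil_of_forall_not_adj' (h.2.1.tail : (B1 ++ z :: B2).IsChain G.Adj)
      (by simp only [hz]; grind)
    subst hB1 hB2
    have hA : A = [] := by
      rcases A with _ | ⟨p, A⟩
      · rfl
      · have := hw p
        simp [Cover, List.isChain_cons] at h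
        grind
    subst hA
    have h4 : Fintype.card V ≤ 3 := by
      classical
      rw [← Finset.card_univ]
      refine (Finset.card_le_card (t := ([w, t, z] : List V).toFinset) ?_).trans
        (List.toFinset_card_le _)
      intro u _
      have := h.2.2.2 u
      simpa using this
    omega

set_option maxHeartbeats 1000000 in
/-- No neighbour of a vertex of degree two has degree three. -/
theorem not_degree_three_of_adj (hG : MaxNontraceable G) {v x y t : V} (hxy : x ≠ y) (hvt : v ≠ t) (hyt : y ≠ t)
    (hv : ∀ u, G.Adj v u ↔ u = x ∨ u = y) (hx : ∀ u, G.Adj x u ↔ u = v ∨ u = y ∨ u = t) :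
    False := by
  have hvy : v ≠ y := fun h => G.loopless.irrefl v ((hv v).2 (Or.inr h))
  have hvx : v ≠ x := fun h => G.loopless.irrefl v ((hv v).2 (Or.inl h))
  have hxt : x ≠ t := fun h => G.loopless.irrefl x ((hx x).2 (by tauto))
  have avx := G.adj_comm v x
  have avy := G.adj_comm v y
  have axy := G.adj_comm x y
  have axt := G.adj_comm x t
  have : Nonempty V := ⟨v⟩
  obtain ⟨A, B, h⟩ := hG.exists_cover hvt (by rw [hv]; grind)
  have hn := h.2.2.1
  have hmx : x ∈ A ∨ x ∈ B := by have := h.2.2.2 x; simp at this; grind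
  have hmy : y ∈ A ∨ y ∈ B := by have := h.2.2.2 y; simp at this; grind
  have fin : ∀ l : List V, l.IsChain G.Adj → (∀ [DecidableEq V] u,
      l.count u = ((v :: A) ++ (t :: B)).count u) → False :=
    fun l hl hp => hG.1 (traceable_of_hamList (h.hamList_of_perm hl hp))
  have h1 := h.1
  have h2 := h.2.1
  clear h
  rcases A with _ | ⟨p, A⟩
  · have hx' : x ∈ B := by simpa using hmx
    obtain ⟨B1, B2, rfl⟩ := List.append_of_mem hx'
    have hc : (B1 ++ x :: B2).IsChain G.Adj := h2.tail
    rcases List.eq_nil_or_concat B1 with rfl | ⟨L, p, rfl⟩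
    · rcases B2 with _ | ⟨q, B2⟩
      · simp at hmy; grind
      · have hq : q = y := by
          have := hx q
          simp [List.isChain_cons] at hc
          simp at hn; grind
        subst hq
        refine fin (t :: x :: v :: q :: B2) ?_ ?_
        · simp [List.isChain_cons] at h1 h2 ⊢
          clear fin
          grind
        · intro _ u
          simp [List.count_cons]
          try omega
    · have hp : p = y := by
        have := hx p
        have := G.adj_comm p x
        simp [List.isChain_append, List.isChain_cons] at hc
        simp at hn; grind
      subst hp
      have hB2 : B2 = [] := eq_nil_of_forall_not_adj' hc (by
        simp only [hx]; simp at hn; grind)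
      subst hB2
      refine fin (t :: L ++ [p, v, x]) ?_ ?_
      · simp [List.isChain_cons, List.isChain_append] at h1 h2 ⊢
        grind
      · intro _ u
        simp [List.count_cons]
        try omega
  · have hp : p = x ∨ p = y := by
      rw [← hv]; have := h1; simp [List.isChain_cons] at this; tauto
    rcases hp with rfl | rfl
    · rcases A with _ | ⟨q, A⟩
      · refine fin (v :: p :: t :: B) ?_ ?_
        · simp [List.isChain_cons] at h1 h2 ⊢
          clear fin
          grind
        · intro _ u
          simp [List.count_cons]
      · have hq : q = y := by
          have := hx q
          have := h1
          simp [List.isChain_cons] at this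
          simp at hn; grind
        subst hq
        refine fin (A.reverse ++ q :: v :: p :: t :: B) ?_ ?_
        · refine chain_reverse_append h1.tail.tail ?_
          simp [List.isChain_cons] at h2 ⊢
          clear fin
          grind
        · intro _ u
          simp [List.count_cons]
          try omega
    · rcases hmx with hx' | hx'
      · have hx'' : x ∈ A := by grind
        obtain ⟨A1, A2, rfl⟩ := List.append_of_mem hx''
        have hc : (A1 ++ x :: A2).IsChain G.Adj := h1.tail.tail
        have hA1 : A1 = [] := eq_nil_of_forall_not_adj hc (by
          simp only [hx]; simp at hn; grind)
        have hA2 : A2 = [] := eq_nil_of_forall_not_adj' hc (by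
          simp only [hx]; simp at hn; grind)
        subst hA1 hA2
        refine fin (p :: v :: x :: t :: B) ?_ ?_
        · simp [List.isChain_cons] at h1 h2 ⊢
          clear fin
          grind
        · intro _ u
          simp [List.count_cons]
          try omega
      · obtain ⟨B1, B2, rfl⟩ := List.append_of_mem hx'
        have hc : (B1 ++ x :: B2).IsChain G.Adj := h2.tail
        have hB1 : B1 = [] := eq_nil_of_forall_not_adj hc (by
          simp only [hx]; simp at hn; grind)
        have hB2 : B2 = [] := eq_nil_of_forall_not_adj' hc (by
          simp only [hx]; simp at hn; grind)
        subst hB1 hB2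
        refine fin (A.reverse ++ [p, v, x, t]) ?_ ?_
        · refine chain_reverse_append h1.tail ?_
          simp [List.isChain_cons] at h2 ⊢
          clear fin
          grind
        · intro _ u
          simp [List.count_cons]
          try omega

end Surgery

section Order

variable {V : Type*} {G : SimpleGraph V}

/-- `pos` lists the vertices of `G` in the order of a Hamiltonian path with `n` vertices. -/
structure PathOrder (G : SimpleGraph V) (n : ℕ) (pos : V → ℕ) : Prop where
  inj : Function.Injective pos
  lt : ∀ v, pos v < n
  surj : ∀ i < n, ∃ v, pos v = i
  adj : ∀ u v, pos v = pos u + 1 → G.Adj u v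

theorem HamList.exists_pathOrder {l : List V} (h : HamList G l) :
    ∃ pos, PathOrder G l.length pos := by
  classical
  refine ⟨fun v => l.idxOf v, ?_, ?_, ?_, ?_⟩
  · intro u v huv
    exact (List.idxOf_inj (h.2.2 u)).1 huv
  · intro v
    exact List.idxOf_lt_length_of_mem (h.2.2 v)
  · intro i hi
    exact ⟨l[i], h.2.1.idxOf_getElem i hi⟩
  · intro u v huv
    have hv := List.idxOf_lt_length_of_mem (h.2.2 v)
    have hu := List.idxOf_lt_length_of_mem (h.2.2 u)
    have := List.isChain_iff_getElem.1 h.1 (l.idxOf u) (by omega)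
    simpa [← huv] using this

theorem PathOrder.traceable [Nonempty V] {n : ℕ} {pos : V → ℕ} (h : PathOrder G n pos) :
    Traceable G := by
  choose p hp using fun i : Fin n => h.surj i i.2
  refine traceable_of_hamList (l := List.ofFn p) ⟨?_, ?_, ?_⟩
  · rw [List.isChain_iff_getElem]
    intro i hi
    simp only [List.getElem_ofFn]
    exact h.adj _ _ (by simp [hp])
  · rw [List.nodup_ofFn]
    intro i j hij
    have := congrArg pos hij
    rw [hp, hp] at this
    exact Fin.ext this
  · intro w
    rw [List.mem_ofFn]
    exact ⟨⟨pos w, h.lt w⟩, h.inj (hp _)⟩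

theorem PathOrder.reverse {n : ℕ} {pos : V → ℕ} (h : PathOrder G n pos) :
    PathOrder G n (fun v => n - 1 - pos v) := by
  refine ⟨?_, ?_, ?_, ?_⟩
  · intro u v huv
    have := h.lt u
    have := h.lt v
    simp only at huv
    exact h.inj (by omega)
  · intro v
    have := h.lt v
    omega
  · intro i hi
    obtain ⟨v, hv⟩ := h.surj (n - 1 - i) (by omega)
    exact ⟨v, by omega⟩
  · intro u v huv
    have := h.lt u
    have := h.lt v
    exact (h.adj v u (by omega)).symm

theorem PathOrder.prev {n : ℕ} {pos : V → ℕ} (h : PathOrder G n pos) (v : V) (hv : pos v ≠ 0) :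
    ∃ u, pos u + 1 = pos v ∧ G.Adj v u := by
  have := h.lt v
  obtain ⟨u, hu⟩ := h.surj (pos v - 1) (by omega)
  exact ⟨u, by omega, (h.adj u v (by omega)).symm⟩

theorem PathOrder.next {n : ℕ} {pos : V → ℕ} (h : PathOrder G n pos) (v : V) (hv : pos v + 1 ≠ n) :
    ∃ u, pos u = pos v + 1 ∧ G.Adj v u := by
  have := h.lt v
  obtain ⟨u, hu⟩ := h.surj (pos v + 1) (by omega)
  exact ⟨u, hu, h.adj v u hu⟩

theorem PathOrder.of_not_consecutive {n : ℕ} {pos : V → ℕ} {a b : V} (hab : a ≠ b)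
    (h : PathOrder (G ⊔ SimpleGraph.edge a b) n pos) (h1 : pos b ≠ pos a + 1)
    (h2 : pos a ≠ pos b + 1) : PathOrder G n pos := by
  refine ⟨h.inj, h.lt, h.surj, fun u v huv => ?_⟩
  rcases (sup_edge_adj_iff hab).1 (h.adj u v huv) with h3 | ⟨rfl, rfl⟩ | ⟨rfl, rfl⟩
  · exact h3
  · exact absurd huv h1
  · exact absurd huv h2

theorem PathOrder.step_one {n : ℕ} {pos : V → ℕ} (h : PathOrder G n pos) {v x : V}
    (hv : ∀ u, G.Adj v u → u = x) :
    (pos v = 0 ∨ pos x + 1 = pos v) ∧ (pos v + 1 = n ∨ pos x = pos v + 1) := by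
  constructor
  · by_contra! hc
    obtain ⟨u, hu, hvu⟩ := h.prev v hc.1
    grind
  · by_contra! hc
    obtain ⟨u, hu, hvu⟩ := h.next v hc.1
    grind

theorem PathOrder.step_two {n : ℕ} {pos : V → ℕ} (h : PathOrder G n pos) {v x y : V}
    (hv : ∀ u, G.Adj v u → u = x ∨ u = y) :
    (pos v = 0 ∨ pos x + 1 = pos v ∨ pos y + 1 = pos v) ∧
      (pos v + 1 = n ∨ pos x = pos v + 1 ∨ pos y = pos v + 1) := by
  constructor
  · by_contra! hc
    obtain ⟨u, hu, hvu⟩ := h.prev v hc.1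
    grind
  · by_contra! hc
    obtain ⟨u, hu, hvu⟩ := h.next v hc.1
    grind

theorem MaxNontraceable.exists_pathOrder [Fintype V] (hG : MaxNontraceable G) {a b : V}
    (hab : a ≠ b) (h : ¬ G.Adj a b) :
    ∃ pos, PathOrder (G ⊔ SimpleGraph.edge a b) (Fintype.card V) pos := by
  classical
  obtain ⟨l, hl⟩ := (hG.2 a b hab h).exists_hamList
  obtain ⟨pos, hpos⟩ := hl.exists_pathOrder
  have : l.length = Fintype.card V := by
    rw [← List.toFinset_card_of_nodup hl.2.1, ← Finset.card_univ]
    congr 1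
    ext w
    simpa using hl.2.2 w
  exact ⟨pos, this ▸ hpos⟩

/-- Every set of at most six vertices is avoided by some nonadjacent pair. -/
def Spread (G : SimpleGraph V) : Prop :=
  ∀ T : Finset V, T.card ≤ 6 → ∃ a b, a ∉ T ∧ b ∉ T ∧ a ≠ b ∧ ¬ G.Adj a b

theorem MaxNontraceable.exists_pathOrder_of_spread [Fintype V] (hG : MaxNontraceable G)
    (hS : Spread G) (T : Finset V) (hT : T.card ≤ 6) :
    ∃ K pos, PathOrder K (Fintype.card V) pos ∧ ∀ v ∈ T, ∀ u, K.Adj v u ↔ G.Adj v u := by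
  obtain ⟨a, b, ha, hb, hab, h⟩ := hS T hT
  obtain ⟨pos, hpos⟩ := hG.exists_pathOrder hab h
  refine ⟨_, pos, hpos, fun v hv u => ?_⟩
  rw [sup_edge_adj_iff hab]
  grind

end Order

section Blob

variable {V : Type*} [DecidableEq V] {G K : SimpleGraph V} {n : ℕ} {pos : V → ℕ}

/-- `B` is either a vertex of degree one with neighbour `z`, or a pair of adjacent vertices of
degree two with common neighbour `z`. -/
def IsBlob (G : SimpleGraph V) (B : Finset V) (z : V) : Prop :=
  (∃ w, B = {w} ∧ ∀ u, G.Adj w u ↔ u = z) ∨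
    ∃ v v', v ≠ v' ∧ B = {v, v'} ∧ (∀ u, G.Adj v u ↔ u = v' ∨ u = z) ∧
      ∀ u, G.Adj v' u ↔ u = v ∨ u = z

/-- The set `B` occupies the beginning of the order `pos` and is followed by `z`. -/
def AtStart (pos : V → ℕ) (B : Finset V) (z : V) : Prop :=
  (∃ w ∈ B, pos w = 0) ∧ (∀ w, w ∈ B ↔ pos w < B.card) ∧ pos z = B.card

theorem IsBlob.congr {B : Finset V} {z : V} (h : IsBlob G B z)
    (hK : ∀ v ∈ B, ∀ u, K.Adj v u ↔ G.Adj v u) : IsBlob K B z := by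
  rcases h with ⟨w, rfl, h⟩ | ⟨v, v', hv, rfl, h, h'⟩
  · exact Or.inl ⟨w, rfl, fun u => by rw [hK w (by simp), h]⟩
  · exact Or.inr ⟨v, v', hv, rfl, fun u => by rw [hK v (by simp), h],
      fun u => by rw [hK v' (by simp), h']⟩

theorem IsBlob.card_le {B : Finset V} {z : V} (h : IsBlob G B z) : B.card ≤ 2 := by
  rcases h with ⟨w, rfl, h⟩ | ⟨v, v', hv, rfl, h, h'⟩
  · simp
  · exact Finset.card_le_two

theorem IsBlob.card_pos {B : Finset V} {z : V} (h : IsBlob G B z) : 1 ≤ B.card := by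
  rcases h with ⟨w, rfl, h⟩ | ⟨v, v', hv, rfl, h, h'⟩
  · simp
  · exact Finset.card_pos.2 ⟨v, by simp⟩

theorem IsBlob.adj {B : Finset V} {z : V} (h : IsBlob G B z) {w : V} (hw : w ∈ B) :
    G.Adj w z := by
  rcases h with ⟨w, rfl, h⟩ | ⟨v, v', hv, rfl, h, h'⟩
  · simp at hw
    subst hw
    simp [h]
  · simp at hw
    rcases hw with rfl | rfl
    · simp [h]
    · simp [h']

theorem IsBlob.notMem {B : Finset V} {z : V} (h : IsBlob G B z) : z ∉ B :=
  fun hz => G.loopless.irrefl z (h.adj hz)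

theorem IsBlob.atStart_or {B : Finset V} {z : V} (h : IsBlob G B z) (hp : PathOrder G n pos)
    (hn : 6 ≤ n) : AtStart pos B z ∨ AtStart (fun v => n - 1 - pos v) B z := by
  have hz := h.notMem
  have l1 := hp.lt z
  rcases h with ⟨w, rfl, h⟩ | ⟨v, v', hv, rfl, h, h'⟩
  · have h1 := hp.step_one (fun u => (h u).1)
    have l2 := hp.lt w
    have h2 : ∀ u, u = w ↔ pos u = pos w := fun u => hp.inj.eq_iff.symm
    simp only [AtStart, Finset.mem_singleton, exists_eq_left, Finset.card_singleton]
    rcases h1 with ⟨h1 | h1, h3 | h3⟩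
    · omega
    · exact Or.inl ⟨h1, fun u => by rw [h2]; omega, by omega⟩
    · exact Or.inr ⟨by omega, fun u => by rw [h2]; have := hp.lt u; omega, by omega⟩
    · omega
  · have h1 := hp.step_two (fun u => (h u).1)
    have h2 := hp.step_two (fun u => (h' u).1)
    have l2 := hp.lt v
    have l3 := hp.lt v'
    simp only [Finset.mem_insert, Finset.mem_singleton, not_or] at hz
    have n1 := hp.inj.ne hv
    have n2 := hp.inj.ne hz.1
    have n3 := hp.inj.ne hz.2
    have h3 : ∀ u, (u = v ∨ u = v') ↔ (pos u = pos v ∨ pos u = pos v') := fun u => by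
      rw [hp.inj.eq_iff, hp.inj.eq_iff]
    simp only [AtStart, Finset.mem_insert, Finset.mem_singleton, exists_eq_or_imp, exists_eq_left,
      Finset.card_pair hv]
    have h4 : pos z = 2 ∨ pos z = n - 3 := by omega
    rcases h4 with h4 | h4
    · exact Or.inl ⟨by omega, fun u => by rw [h3]; omega, by omega⟩
    · exact Or.inr ⟨by omega, fun u => by rw [h3]; have := hp.lt u; omega, by omega⟩

omit [DecidableEq V] in
theorem AtStart.not_disjoint (hp : PathOrder G n pos) {B C : Finset V} {z y : V}
    (h1 : AtStart pos B z) (h2 : AtStart pos C y) : ¬ Disjoint B C := by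
  obtain ⟨w, hw, h⟩ := h1.1
  obtain ⟨w', hw', h'⟩ := h2.1
  have : w = w' := hp.inj (by omega)
  subst this
  exact fun hd => Finset.disjoint_left.1 hd hw hw'

variable [Fintype V]

theorem IsBlob.not_three (hn : 22 ≤ Fintype.card V) (hG : MaxNontraceable G) (hS : Spread G)
    {A B C : Finset V} {x y z : V} (hA : IsBlob G A x) (hB : IsBlob G B y) (hC : IsBlob G C z)
    (hAB : Disjoint A B) (hAC : Disjoint A C) (hBC : Disjoint B C) : False := by
  have c1 := hA.card_le
  have c2 := hB.card_le
  have c3 := hC.card_le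
  obtain ⟨K, pos, hp, hK⟩ := hG.exists_pathOrder_of_spread hS (A ∪ B ∪ C) (by
    have := Finset.card_union_le (A ∪ B) C
    have := Finset.card_union_le A B
    omega)
  have kA := (hA.congr fun v hv => hK v (by simp [hv])).atStart_or hp (by omega)
  have kB := (hB.congr fun v hv => hK v (by simp [hv])).atStart_or hp (by omega)
  have kC := (hC.congr fun v hv => hK v (by simp [hv])).atStart_or hp (by omega)
  have := hp.reverse
  rcases kA with kA | kA <;> rcases kB with kB | kB <;> rcases kC with kC | kC <;>
    first
    | exact kA.not_disjoint hp kB hAB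
    | exact kA.not_disjoint hp kC hAC
    | exact kB.not_disjoint hp kC hBC
    | exact kA.not_disjoint hp.reverse kB hAB
    | exact kA.not_disjoint hp.reverse kC hAC
    | exact kB.not_disjoint hp.reverse kC hBC

omit [DecidableEq V] in
theorem not_isolated (hn : 22 ≤ Fintype.card V) (hG : MaxNontraceable G) (hS : Spread G)
    {v : V} (hv : ∀ u, ¬ G.Adj v u) : False := by
  obtain ⟨K, pos, hp, hK⟩ := hG.exists_pathOrder_of_spread hS {v} (by simp)
  have := hp.step_one (v := v) (x := v) (fun u hu => absurd ((hK v (by simp) u).1 hu) (hv u))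
  omega

theorem not_isolated_edge (hn : 22 ≤ Fintype.card V) (hG : MaxNontraceable G) (hS : Spread G)
    {v w : V} (hv : ∀ u, G.Adj v u → u = w) (hw : ∀ u, G.Adj w u → u = v) : False := by
  obtain ⟨K, pos, hp, hK⟩ := hG.exists_pathOrder_of_spread hS {v, w} (by
    have := Finset.card_le_two (a := v) (b := w)
    omega)
  have := hp.step_one (v := v) (x := w) (fun u hu => hv u ((hK v (by simp) u).1 hu))
  have := hp.step_one (v := w) (x := v) (fun u hu => hw u ((hK w (by simp) u).1 hu))
  omega

theorem not_isolated_triangle (hn : 22 ≤ Fintype.card V) (hG : MaxNontraceable G)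
    (hS : Spread G) {u v w : V} (hu : ∀ x, G.Adj u x → x = v ∨ x = w)
    (hv : ∀ x, G.Adj v x → x = u ∨ x = w) (hw : ∀ x, G.Adj w x → x = u ∨ x = v) : False := by
  obtain ⟨K, pos, hp, hK⟩ := hG.exists_pathOrder_of_spread hS {u, v, w} (by
    have := Finset.card_le_three (a := u) (b := v) (c := w)
    omega)
  have := hp.step_two (v := u) (fun x h => hu x ((hK u (by simp) x).1 h))
  have := hp.step_two (v := v) (fun x h => hv x ((hK v (by simp) x).1 h))
  have := hp.step_two (v := w) (fun x h => hw x ((hK w (by simp) x).1 h))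
  omega

theorem not_three_twins (hn : 22 ≤ Fintype.card V) (hG : MaxNontraceable G)
    (hS : Spread G) {u v w x y : V} (huv : u ≠ v) (huw : u ≠ w) (hvw : v ≠ w)
    (hu : ∀ s, G.Adj u s ↔ s = x ∨ s = y)
    (hv : ∀ s, G.Adj v s ↔ s = x ∨ s = y) (hw : ∀ s, G.Adj w s ↔ s = x ∨ s = y) : False := by
  obtain ⟨K, pos, hp, hK⟩ := hG.exists_pathOrder_of_spread hS {u, v, w} (by
    have := Finset.card_le_three (a := u) (b := v) (c := w)
    omega)
  have := hp.step_two (v := u) (fun x h => (hu x).1 ((hK u (by simp) x).1 h))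
  have := hp.step_two (v := v) (fun x h => (hv x).1 ((hK v (by simp) x).1 h))
  have := hp.step_two (v := w) (fun x h => (hw x).1 ((hK w (by simp) x).1 h))
  have := hp.inj.ne huv
  have := hp.inj.ne huw
  have := hp.inj.ne hvw
  have := hp.lt u
  have := hp.lt v
  have := hp.lt w
  have := hp.lt x
  have := hp.lt y
  have : pos x ≠ pos u := fun h => G.loopless.irrefl u ((hu u).2 (Or.inl (hp.inj h).symm))
  have : pos x ≠ pos v := fun h => G.loopless.irrefl v ((hv v).2 (Or.inl (hp.inj h).symm))
  have : pos x ≠ pos w := fun h => G.loopless.irrefl w ((hw w).2 (Or.inl (hp.inj h).symm))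
  omega

end Blob

section TwoBlobs

variable {V : Type*} [DecidableEq V] {G K : SimpleGraph V} {n : ℕ} {pos : V → ℕ}

/-- The order `pos` starts with `A` followed by `x` and ends with `y` followed by `B`. -/
structure Ends (n : ℕ) (pos : V → ℕ) (A B : Finset V) (x y : V) : Prop where
  left : ∀ w, w ∈ A ↔ pos w < A.card
  right : ∀ w, w ∈ B ↔ n - 1 - B.card < pos w
  pos_left : pos x = A.card
  pos_right : pos y = n - 1 - B.card

theorem IsBlob.exists_ends {A B : Finset V} {x y : V} (hA : IsBlob K A x) (hB : IsBlob K B y)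
    (hAB : Disjoint A B) (hp : PathOrder K n pos) (hn : 6 ≤ n) :
    ∃ pos, PathOrder K n pos ∧ Ends n pos A B x y := by
  have cA := hA.card_le
  have cB := hB.card_le
  have cB' := hB.card_pos
  rcases hA.atStart_or hp hn with kA | kA <;> rcases hB.atStart_or hp hn with kB | kB
  · exact absurd hAB (kA.not_disjoint hp kB)
  · have hy := kB.2.2
    have := hp.lt y
    simp only at hy
    refine ⟨pos, hp, kA.2.1, fun w => ?_, kA.2.2, by omega⟩
    have := hp.lt w
    have hw := kB.2.1 w
    simp only at hw
    rw [hw]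
    omega
  · have := kB.2.2
    refine ⟨_, hp.reverse, kA.2.1, fun w => ?_, kA.2.2, by omega⟩
    have := hp.lt w
    rw [kB.2.1]
    omega
  · exact absurd hAB (kA.not_disjoint hp.reverse kB)

variable [Fintype V] {A B : Finset V} {x y : V}

theorem exists_ends_of_spread (hn : 22 ≤ Fintype.card V) (hG : MaxNontraceable G)
    (hS : Spread G) (hA : IsBlob G A x) (hB : IsBlob G B y) (hAB : Disjoint A B)
    (T : Finset V) (hT : T.card ≤ 2) :
    ∃ K pos, PathOrder K (Fintype.card V) pos ∧ Ends (Fintype.card V) pos A B x y ∧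
      ∀ v ∈ T, ∀ u, K.Adj v u ↔ G.Adj v u := by
  have cA := hA.card_le
  have cB := hB.card_le
  obtain ⟨K, pos, hp, hK⟩ := hG.exists_pathOrder_of_spread hS (A ∪ B ∪ T) (by
    have := Finset.card_union_le (A ∪ B) T
    have := Finset.card_union_le A B
    omega)
  obtain ⟨pos, hp, hE⟩ := (hA.congr fun v hv => hK v (by simp [hv])).exists_ends
    (hB.congr fun v hv => hK v (by simp [hv])) hAB hp (by omega)
  exact ⟨K, pos, hp, hE, fun v hv => hK v (by simp [hv])⟩

theorem exists_ends_sup_edge (hn : 22 ≤ Fintype.card V) (hG : MaxNontraceable G)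
    (hA : IsBlob G A x) (hB : IsBlob G B y) (hAB : Disjoint A B) {a b : V} (hab : a ≠ b)
    (h : ¬ G.Adj a b) (ha : a ∉ A) (ha' : a ∉ B) (hb : b ∉ A) (hb' : b ∉ B) :
    ∃ pos, PathOrder (G ⊔ SimpleGraph.edge a b) (Fintype.card V) pos ∧
      Ends (Fintype.card V) pos A B x y ∧ (pos b = pos a + 1 ∨ pos a = pos b + 1) := by
  have : Nonempty V := ⟨a⟩
  obtain ⟨pos, hp⟩ := hG.exists_pathOrder hab h
  have hK : ∀ v ∈ A ∪ B, ∀ u, (G ⊔ SimpleGraph.edge a b).Adj v u ↔ G.Adj v u := by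
    intro v hv u
    rw [sup_edge_adj_iff hab]
    grind
  obtain ⟨pos, hp, hE⟩ := (hA.congr fun v hv => hK v (by simp [hv])).exists_ends
    (hB.congr fun v hv => hK v (by simp [hv])) hAB hp (by omega)
  refine ⟨pos, hp, hE, ?_⟩
  by_contra! hc
  exact hG.1 (hp.of_not_consecutive hab hc.1 hc.2).traceable

theorem ends_ne_and_notMem (hn : 22 ≤ Fintype.card V) (hG : MaxNontraceable G)
    (hS : Spread G) (hA : IsBlob G A x) (hB : IsBlob G B y) (hAB : Disjoint A B) :
    x ≠ y ∧ x ∉ B ∧ y ∉ A := by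
  have cA := hA.card_le
  have cB := hB.card_le
  obtain ⟨K, pos, hp, hE, -⟩ := exists_ends_of_spread hn hG hS hA hB hAB ∅ (by simp)
  have h1 := hE.pos_left
  have h2 := hE.pos_right
  refine ⟨?_, ?_, ?_⟩
  · rintro rfl
    omega
  · rw [hE.right]
    omega
  · rw [hE.left]
    omega

theorem ends_adj (hn : 22 ≤ Fintype.card V) (hG : MaxNontraceable G)
    (hS : Spread G) (hA : IsBlob G A x) (hB : IsBlob G B y) (hAB : Disjoint A B) :
    G.Adj x y := by
  have cA := hA.card_le
  have cB := hB.card_le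
  obtain ⟨h1, h2, h3⟩ := ends_ne_and_notMem hn hG hS hA hB hAB
  by_contra hc
  obtain ⟨pos, hp, hE, h⟩ := exists_ends_sup_edge hn hG hA hB hAB h1 hc hA.notMem h2 h3 hB.notMem
  have h1 := hE.pos_left
  have h2 := hE.pos_right
  omega

/-- If the end vertex `x` is adjacent to a vertex of degree two inside, then it is adjacent to
everything inside. -/
theorem adj_of_adj_degree_two (hn : 22 ≤ Fintype.card V) (hG : MaxNontraceable G)
    (hS : Spread G) (hA : IsBlob G A x) (hB : IsBlob G B y) (hAB : Disjoint A B)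
    {v t : V} (hv : ∀ u, G.Adj v u ↔ u = x ∨ u = t) (hvA : v ∉ A) (hvB : v ∉ B) (hvy : v ≠ y)
    {u : V} (huA : u ∉ A) (huB : u ∉ B) (hux : u ≠ x) : G.Adj x u := by
  have cA := hA.card_le
  have cB := hB.card_le
  have hvx : v ≠ x := fun h => G.loopless.irrefl v ((hv v).2 (Or.inl h))
  obtain ⟨h1, h2, h3⟩ := ends_ne_and_notMem hn hG hS hA hB hAB
  by_contra hc
  have huv : u ≠ v := by
    rintro rfl
    exact hc ((hv x).2 (Or.inl rfl)).symm
  obtain ⟨pos, hp, hE, h⟩ := exists_ends_sup_edge hn hG hA hB hAB hux.symm hc hA.notMem h2 huA huB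
  have h4 := hE.pos_left
  have h5 := hE.pos_right
  have h6 := hp.step_two (v := v) (x := x) (y := t) (fun s hs => by
    rw [sup_edge_adj_iff hux.symm] at hs
    rw [← hv]
    grind)
  have h7 := hp.inj.ne huv
  have h8 := hp.inj.ne hvx
  have h9 := hp.inj.ne hvy
  rw [hE.left] at hvA huA
  rw [hE.right] at hvB huB
  omega

theorem exists_inner_adj (hn : 22 ≤ Fintype.card V) (hG : MaxNontraceable G)
    (hS : Spread G) (hA : IsBlob G A x) (hB : IsBlob G B y) (hAB : Disjoint A B) :
    ∃ s, s ∉ A ∧ s ∉ B ∧ s ≠ x ∧ s ≠ y ∧ G.Adj x s := by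
  have cA := hA.card_le
  have cB := hB.card_le
  obtain ⟨K, pos, hp, hE, hK⟩ := exists_ends_of_spread hn hG hS hA hB hAB {x} (by simp)
  have h4 := hE.pos_left
  have h5 := hE.pos_right
  obtain ⟨s, hs, hxs⟩ := hp.next x (by omega)
  rw [hK x (by simp)] at hxs
  refine ⟨s, ?_, ?_, hxs.ne', ?_, hxs⟩
  · rw [hE.left]
    omega
  · rw [hE.right]
    omega
  · rintro rfl
    omega

omit [DecidableEq V] [Fintype V] in
theorem PathOrder.reverse_segment {x r s y : V} (hxr : x ≠ r) {i j : ℕ}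
    (hp : PathOrder (G ⊔ SimpleGraph.edge x r) n pos) (hx : pos x = i) (hr : pos r = i + 1)
    (hs : pos s = j) (hy : pos y = j + 1) (hij : i < j) (hxs : G.Adj x s) (hry : G.Adj r y) :
    PathOrder G n (fun v => if i < pos v ∧ pos v ≤ j then i + 1 + j - pos v else pos v) := by
  have hy' := hp.lt y
  have key : ∀ u v, pos v = pos u + 1 → pos u ≠ i → G.Adj u v := by
    intro u v huv hu
    rcases (sup_edge_adj_iff hxr).1 (hp.adj u v huv) with h3 | ⟨rfl, rfl⟩ | ⟨rfl, rfl⟩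
    · exact h3
    · omega
    · omega
  refine ⟨?_, ?_, ?_, ?_⟩
  · intro u v huv
    apply hp.inj
    simp only at huv
    split_ifs at huv <;> omega
  · intro v
    have := hp.lt v
    split_ifs <;> omega
  · intro k hk
    by_cases h : i < k ∧ k ≤ j
    · obtain ⟨v, hv⟩ := hp.surj (i + 1 + j - k) (by omega)
      refine ⟨v, ?_⟩
      split_ifs <;> omega
    · obtain ⟨v, hv⟩ := hp.surj k hk
      refine ⟨v, ?_⟩
      split_ifs <;> omega
  · intro u v huv
    split_ifs at huv with h1 h2 h2
    · exact (key v u (by omega) (by omega)).symm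
    · have hu : u = x := hp.inj (by omega)
      have hv : v = s := hp.inj (by omega)
      rwa [hu, hv]
    · have hu : u = r := hp.inj (by omega)
      have hv : v = y := hp.inj (by omega)
      rwa [hu, hv]
    · exact key u v huv (by omega)

/-- If `x` has a single neighbour inside, apart from `y`, then `y` has at least three
neighbours inside, apart from `x`. -/
theorem not_few_inner_adj (hn : 22 ≤ Fintype.card V) (hG : MaxNontraceable G)
    (hS : Spread G) (hA : IsBlob G A x) (hB : IsBlob G B y) (hAB : Disjoint A B) {s p r : V}
    (hx : ∀ u, G.Adj x u → u ∈ A ∨ u = y ∨ u = s)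
    (hy : ∀ u, G.Adj y u → u ∈ B ∨ u = x ∨ u = p ∨ u = r) : False := by
  have cA := hA.card_le
  have cB := hB.card_le
  obtain ⟨hxy, hxB, hyA⟩ := ends_ne_and_notMem hn hG hS hA hB hAB
  obtain ⟨s', hsA, hsB, hsx, hsy, hxs⟩ := exists_inner_adj hn hG hS hA hB hAB
  have hss : s' = s := by
    rcases hx s' hxs with h | h | h
    · exact absurd h hsA
    · exact absurd h hsy
    · exact h
  subst hss
  have hsy' : G.Adj s' y := by
    by_contra hc
    obtain ⟨pos, hp, hE, h⟩ := exists_ends_sup_edge hn hG hA hB hAB hsy hc hsA hsB hyA hB.notMem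
    have h4 := hE.pos_left
    have h5 := hE.pos_right
    obtain ⟨u, hu, hxu⟩ := hp.next x (by omega)
    have h6 : G.Adj x u := by
      rw [sup_edge_adj_iff hsy] at hxu
      grind
    rcases hx u h6 with h | rfl | rfl
    · rw [hE.left] at h
      omega
    · omega
    · omega
  wlog hp : s' = p generalizing p r
  · refine this (p := r) (r := p) (fun u hu => (hy u hu).imp_right (Or.imp_right Or.symm)) ?_
    rcases hy s' hsy'.symm with h | h | h | h <;> first | contradiction | exact h
  subst hp
  by_cases hr : r ∉ A ∧ r ∉ B ∧ r ≠ x ∧ r ≠ y ∧ r ≠ s' ∧ G.Adj y r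
  · obtain ⟨hrA, hrB, hrx, hry, hrs, hyr⟩ := hr
    have hxr : ¬ G.Adj x r := fun h => by
      rcases hx r h with h | h | h <;> contradiction
    obtain ⟨pos, hp, hE, h⟩ := exists_ends_sup_edge hn hG hA hB hAB hrx.symm hxr hA.notMem hxB
      hrA hrB
    have h4 := hE.pos_left
    have h5 := hE.pos_right
    have h6 := hE.left r
    obtain ⟨u, hu, hyu⟩ := hp.prev y (by omega)
    have h7 : G.Adj y u := by
      rw [sup_edge_adj_iff hrx.symm] at hyu
      grind
    have h8 := hE.right u
    have hr' : pos r = pos x + 1 := by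
      rcases h with h | h
      · exact h
      · exact absurd (h6.2 (by omega)) hrA
    have hu' : u = s' := by
      rcases hy u h7 with h | rfl | rfl | rfl
      · rw [h8] at h
        omega
      · omega
      · rfl
      · omega
    subst hu'
    have : Nonempty V := ⟨x⟩
    exact hG.1 (hp.reverse_segment hrx.symm rfl hr' rfl hu.symm (by omega) hxs hyr.symm).traceable
  · obtain ⟨K, pos, hp, hE, hK⟩ := exists_ends_of_spread hn hG hS hA hB hAB {x, y}
      Finset.card_le_two
    have h4 := hE.pos_left
    have h5 := hE.pos_right
    obtain ⟨u, hu, hxu⟩ := hp.next x (by omega)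
    rw [hK x (by simp)] at hxu
    obtain ⟨t, ht, hyt⟩ := hp.prev y (by omega)
    rw [hK y (by simp)] at hyt
    have hs : pos s' = pos x + 1 := by
      rcases hx u hxu with h | rfl | rfl
      · rw [hE.left] at h
        omega
      · omega
      · exact hu
    have htA := hE.left t
    have htB := hE.right t
    rcases hy t hyt with h | rfl | rfl | rfl
    · rw [hE.right] at h
      omega
    · omega
    · omega
    · refine hr ⟨?_, ?_, ?_, hyt.ne', ?_, hyt⟩
      · rw [htA]
        omega
      · rw [htB]
        omega
      · rintro rfl
        omega
      · rintro rfl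
        omega

end TwoBlobs

section Degrees

variable {V : Type*} [DecidableEq V] {G : SimpleGraph V} [Fintype V] [DecidableRel G.Adj]

omit [DecidableEq V] in
theorem adj_iff_of_degree_eq_one {v : V} (h : G.degree v = 1) :
    ∃ x, ∀ u, G.Adj v u ↔ u = x := by
  obtain ⟨x, hx⟩ := Finset.card_eq_one.1 h
  exact ⟨x, fun u => by rw [← mem_neighborFinset, hx, Finset.mem_singleton]⟩

theorem adj_iff_of_degree_eq_two {v : V} (h : G.degree v = 2) :
    ∃ x y, x ≠ y ∧ ∀ u, G.Adj v u ↔ u = x ∨ u = y := by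
  obtain ⟨x, y, hxy, hx⟩ := Finset.card_eq_two.1 h
  exact ⟨x, y, hxy, fun u => by
    rw [← mem_neighborFinset, hx, Finset.mem_insert, Finset.mem_singleton]⟩

omit [DecidableEq V] in
theorem degree_eq_one_of_adj_iff {v x : V} (h : ∀ u, G.Adj v u ↔ u = x) : G.degree v = 1 := by
  rw [← card_neighborFinset_eq_degree, Finset.card_eq_one]
  exact ⟨x, by ext u; simp [h]⟩

theorem degree_eq_two_of_adj_iff {v x y : V} (hxy : x ≠ y) (h : ∀ u, G.Adj v u ↔ u = x ∨ u = y) :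
    G.degree v = 2 := by
  rw [← card_neighborFinset_eq_degree, Finset.card_eq_two]
  exact ⟨x, y, hxy, by ext u; simp [h]⟩

theorem subset_singleton_of_card_le {α : Type*} [Nonempty α] {s : Finset α} (h : s.card ≤ 1) :
    ∃ p, ∀ u ∈ s, u = p := by
  rcases s.eq_empty_or_nonempty with rfl | ⟨p, hp⟩
  · exact ⟨Classical.arbitrary α, by simp⟩
  · exact ⟨p, fun u hu => Finset.card_le_one.1 h u hu p hp⟩

theorem subset_pair_of_card_le {α : Type*} [DecidableEq α] [Nonempty α] {s : Finset α}
    (h : s.card ≤ 2) : ∃ p q, ∀ u ∈ s, u = p ∨ u = q := by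
  rcases s.eq_empty_or_nonempty with rfl | ⟨p, hp⟩
  · exact ⟨Classical.arbitrary α, Classical.arbitrary α, by simp⟩
  · obtain ⟨q, hq⟩ := subset_singleton_of_card_le (s := s.erase p) (by
      rw [Finset.card_erase_of_mem hp]
      omega)
    exact ⟨p, q, fun u hu => by
      by_cases hup : u = p
      · exact Or.inl hup
      · exact Or.inr (hq u (Finset.mem_erase.2 ⟨hup, hu⟩))⟩

theorem adj_imp_of_degree_le_three {v a b : V} (hab : a ≠ b) (ha : G.Adj v a) (hb : G.Adj v b)
    (h : G.degree v ≤ 3) : ∃ t, ∀ u, G.Adj v u → u = a ∨ u = b ∨ u = t := by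
  have : Nonempty V := ⟨v⟩
  obtain ⟨t, ht⟩ := subset_singleton_of_card_le (s := ((G.neighborFinset v).erase a).erase b) (by
    rw [Finset.card_erase_of_mem (by simp [hab.symm, hb]), Finset.card_erase_of_mem (by simp [ha]),
      card_neighborFinset_eq_degree]
    omega)
  refine ⟨t, fun u hu => ?_⟩
  have := ht u
  simp [hu] at this
  tauto

theorem adj_imp_of_degree_le_four {v a b : V} (hab : a ≠ b) (ha : G.Adj v a) (hb : G.Adj v b)
    (h : G.degree v ≤ 4) : ∃ s t, ∀ u, G.Adj v u → u = a ∨ u = b ∨ u = s ∨ u = t := by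
  have : Nonempty V := ⟨v⟩
  obtain ⟨s, t, ht⟩ := subset_pair_of_card_le (s := ((G.neighborFinset v).erase a).erase b) (by
    rw [Finset.card_erase_of_mem (by simp [hab.symm, hb]), Finset.card_erase_of_mem (by simp [ha]),
      card_neighborFinset_eq_degree]
    omega)
  refine ⟨s, t, fun u hu => ?_⟩
  have := ht u
  simp [hu] at this
  tauto

/-- `v` has degree two and both its neighbours have degree at least four. -/
def Lone (G : SimpleGraph V) [DecidableRel G.Adj] (v : V) : Prop :=
  ∃ x y, x ≠ y ∧ (∀ u, G.Adj v u ↔ u = x ∨ u = y) ∧ G.Adj x y ∧ 4 ≤ G.degree x ∧ 4 ≤ G.degree y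

omit [DecidableEq V] in
theorem four_le_degree (hG : MaxNontraceable G) {v x y : V} (hxy : x ≠ y)
    (hv : ∀ u, G.Adj v u ↔ u = x ∨ u = y) (hx : G.degree x ≠ 2) :
    4 ≤ G.degree x := by
  classical
  have hadj := adj_of_degree_two hG hxy hv
  have hvx : G.Adj x v := ((hv x).2 (Or.inl rfl)).symm
  have hvy : G.Adj v y := (hv y).2 (Or.inr rfl)
  have h2 : 2 ≤ G.degree x := by
    rw [← card_neighborFinset_eq_degree, ← Finset.card_pair hvy.ne]
    exact Finset.card_le_card (by intro u; simp; rintro (rfl | rfl) <;> assumption)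
  by_contra hc
  obtain ⟨t, ht⟩ := adj_imp_of_degree_le_three hvy.ne hvx hadj (by omega)
  have h3 : (({v, y, t} : Finset V)).card = 3 := by
    refine le_antisymm Finset.card_le_three ?_
    have : G.neighborFinset x ⊆ {v, y, t} := fun u => by simpa using ht u
    have := Finset.card_le_card this
    rw [card_neighborFinset_eq_degree] at this
    omega
  have hN : G.neighborFinset x = {v, y, t} := by
    apply Finset.eq_of_subset_of_card_le
    · intro u
      simpa using ht u
    · rw [h3, card_neighborFinset_eq_degree]
      omega
  rw [Finset.card_eq_three] at h3
  have hvt : v ≠ t := by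
    rintro rfl
    obtain ⟨a, b, c, hab, hac, hbc, h⟩ := h3
    have := Finset.card_le_two (a := v) (b := y)
    have h4 : ({v, y, v} : Finset V) = {v, y} := by ext; simp; tauto
    rw [← h4, h, Finset.card_eq_three.2 ⟨a, b, c, hab, hac, hbc, rfl⟩] at this
    omega
  have hyt : y ≠ t := by
    rintro rfl
    obtain ⟨a, b, c, hab, hac, hbc, h⟩ := h3
    have := Finset.card_le_two (a := v) (b := y)
    have h4 : ({v, y, y} : Finset V) = {v, y} := by ext; simp
    rw [← h4, h, Finset.card_eq_three.2 ⟨a, b, c, hab, hac, hbc, rfl⟩] at this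
    omega
  exact not_degree_three_of_adj hG hxy hvt hyt hv
    (fun u => by rw [← mem_neighborFinset, hN]; simp)

theorem exists_blob_or_lone (hG : MaxNontraceable G) {v : V} (hv : G.degree v = 2) :
    (∃ B z, IsBlob G B z ∧ v ∈ B) ∨ Lone G v := by
  have key : ∀ x y, x ≠ y → (∀ u, G.Adj v u ↔ u = x ∨ u = y) → G.degree x = 2 →
      IsBlob G {v, x} y := by
    intro x y hxy h hx
    have hvx : G.Adj v x := (h x).2 (Or.inl rfl)
    have hvy : G.Adj v y := (h y).2 (Or.inr rfl)
    have hadj := adj_of_degree_two hG hxy h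
    refine Or.inr ⟨v, x, hvx.ne, rfl, h, ?_⟩
    have hN : ({v, y} : Finset V) = G.neighborFinset x := by
      apply Finset.eq_of_subset_of_card_le
      · intro u
        simp
        rintro (rfl | rfl)
        · exact hvx.symm
        · exact hadj
      · rw [card_neighborFinset_eq_degree, hx, Finset.card_pair hvy.ne]
    intro u
    rw [← mem_neighborFinset, ← hN]
    simp
  obtain ⟨x, y, hxy, h⟩ := adj_iff_of_degree_eq_two hv
  by_cases hx : G.degree x = 2
  · exact Or.inl ⟨_, _, key x y hxy h hx, by simp⟩
  have h' : ∀ u, G.Adj v u ↔ u = y ∨ u = x := fun u => by rw [h, or_comm]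
  by_cases hy : G.degree y = 2
  · exact Or.inl ⟨_, _, key y x hxy.symm h' hy, by simp⟩
  exact Or.inr ⟨x, y, hxy, h, adj_of_degree_two hG hxy h, four_le_degree hG hxy h hx,
    four_le_degree hG hxy.symm h' hy⟩

theorem Lone.degree_eq {v : V} (h : Lone G v) : G.degree v = 2 := by
  obtain ⟨x, y, hxy, h, -⟩ := h
  exact degree_eq_two_of_adj_iff hxy h

omit [DecidableEq V] in
theorem Lone.exists_of_adj {v x : V} (h : Lone G v) (hx : G.Adj v x) :
    ∃ y, x ≠ y ∧ (∀ u, G.Adj v u ↔ u = x ∨ u = y) ∧ G.Adj x y ∧ 4 ≤ G.degree x ∧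
      4 ≤ G.degree y := by
  obtain ⟨a, b, hab, h, hadj, ha, hb⟩ := h
  rcases (h x).1 hx with rfl | rfl
  · exact ⟨b, hab, h, hadj, ha, hb⟩
  · exact ⟨a, hab.symm, fun u => by rw [h, or_comm], hadj.symm, hb, ha⟩

omit [Fintype V] [DecidableRel G.Adj] in
theorem IsBlob.of_mem {B : Finset V} {z w : V} (h : IsBlob G B z) (hw : w ∈ B) :
    (B = {w} ∧ ∀ u, G.Adj w u ↔ u = z) ∨ ∃ w', w ≠ w' ∧ B = {w, w'} ∧
      (∀ u, G.Adj w u ↔ u = w' ∨ u = z) ∧ ∀ u, G.Adj w' u ↔ u = w ∨ u = z := by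
  rcases h with ⟨v, rfl, h⟩ | ⟨v, v', hv, rfl, h, h'⟩
  · simp at hw
    subst hw
    exact Or.inl ⟨rfl, h⟩
  · right
    simp at hw
    rcases hw with rfl | rfl
    · exact ⟨v', hv, rfl, h, h'⟩
    · exact ⟨v, hv.symm, Finset.pair_comm _ _, h', h⟩

theorem IsBlob.degree_eq {B : Finset V} {z w : V} (h : IsBlob G B z) (hw : w ∈ B) :
    G.degree w = B.card := by
  have hz := h.notMem
  rcases h.of_mem hw with ⟨rfl, k⟩ | ⟨w', hw', rfl, k, -⟩
  · simp [degree_eq_one_of_adj_iff k]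
  · rw [Finset.card_pair hw']
    exact degree_eq_two_of_adj_iff (by rintro rfl; simp at hz) k

theorem IsBlob.not_lone {B : Finset V} {z w : V} (h : IsBlob G B z) (hw : w ∈ B) :
    ¬ Lone G w := by
  intro hl
  have hd := hl.degree_eq
  rw [h.degree_eq hw] at hd
  rcases h.of_mem hw with ⟨rfl, -⟩ | ⟨w', hw', hB, h1, -⟩
  · simp at hd
  · obtain ⟨y, -, -, -, h2, -⟩ := hl.exists_of_adj ((h1 w').2 (Or.inl rfl))
    rw [h.degree_eq (by simp [hB])] at h2
    omega

theorem IsBlob.three_le_degree (hn : 22 ≤ Fintype.card V) (hG : MaxNontraceable G)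
    (hS : Spread G) {B : Finset V} {z : V} (h : IsBlob G B z) : 3 ≤ G.degree z := by
  have hz := h.notMem
  have hadj := fun w (hw : w ∈ B) => (h.adj hw).symm
  by_contra hc
  rcases h with ⟨w, rfl, h⟩ | ⟨v, v', hv, rfl, h, h'⟩
  · have hzw : G.Adj z w := hadj w (by simp)
    have h1 : 1 ≤ G.degree z := by
      rw [← card_neighborFinset_eq_degree, Nat.succ_le_iff, Finset.card_pos]
      exact ⟨w, by simpa⟩
    have h2 : G.degree z = 1 ∨ G.degree z = 2 := by omega
    rcases h2 with h2 | h2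
    · obtain ⟨x, hx⟩ := adj_iff_of_degree_eq_one h2
      have := (hx w).1 hzw
      subst this
      exact not_isolated_edge hn hG hS (fun u => (h u).1) (fun u => (hx u).1)
    · obtain ⟨x, y, hxy, hx⟩ := adj_iff_of_degree_eq_two h2
      rcases (hx w).1 hzw with rfl | rfl
      · exact not_degree_two_of_adj_pendant (by omega) hG hxy h hx
      · exact not_degree_two_of_adj_pendant (by omega) hG hxy.symm h
          (fun u => by rw [hx, or_comm])
  · have h1 : G.Adj z v := hadj v (by simp)
    have h2 : G.Adj z v' := hadj v' (by simp)
    have hN : ({v, v'} : Finset V) = G.neighborFinset z := by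
      apply Finset.eq_of_subset_of_card_le
      · intro u
        simp
        rintro (rfl | rfl) <;> assumption
      · rw [card_neighborFinset_eq_degree, Finset.card_pair hv]
        omega
    refine not_isolated_triangle hn hG hS (u := v) (v := v') (w := z) (fun u => (h u).1)
      (fun u => (h' u).1) (fun u hu => ?_)
    rw [← mem_neighborFinset, ← hN] at hu
    simpa using hu

theorem IsBlob.disjoint (hn : 22 ≤ Fintype.card V) (hG : MaxNontraceable G)
    (hS : Spread G) {A B : Finset V} {x y : V} (hA : IsBlob G A x) (hB : IsBlob G B y)
    (hAB : A ≠ B) : Disjoint A B := by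
  rw [Finset.disjoint_left]
  intro w hwA hwB
  have h1 := hA.degree_eq hwA
  have h2 := hB.degree_eq hwB
  rcases hA.of_mem hwA with ⟨rfl, h⟩ | ⟨w', hw', rfl, h, h'⟩ <;>
  rcases hB.of_mem hwB with ⟨rfl, k⟩ | ⟨u', hu', rfl, k, k'⟩
  · exact hAB rfl
  · rw [Finset.card_pair hu'] at h2
    simp at h1
    omega
  · rw [Finset.card_pair hw'] at h1
    simp at h2
    omega
  · have hx := hA.three_le_degree hn hG hS
    have hy := hB.degree_eq (w := u') (by simp)
    rw [Finset.card_pair hu'] at hy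
    rcases (h u').1 ((k u').2 (Or.inl rfl)) with rfl | rfl
    · exact hAB rfl
    · omega

end Degrees

section Charge

variable {V : Type*} [DecidableEq V] {G : SimpleGraph V} [Fintype V] [DecidableRel G.Adj]

theorem eight_le_degree_add_degree (hn : 22 ≤ Fintype.card V) (hG : MaxNontraceable G)
    (hS : Spread G) {A B : Finset V} {x y : V} (hA : IsBlob G A x) (hB : IsBlob G B y)
    (hAB : Disjoint A B) : 8 ≤ G.degree x + G.degree y := by
  have key : ∀ {A B : Finset V} {x y : V}, IsBlob G A x → IsBlob G B y → Disjoint A B →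
      G.degree x ≤ 3 → G.degree y ≤ 4 → False := by
    intro A B x y hA hB hAB hx hy
    obtain ⟨hxy, hxB, hyA⟩ := ends_ne_and_notMem hn hG hS hA hB hAB
    have hadj := ends_adj hn hG hS hA hB hAB
    obtain ⟨a, ha⟩ := Finset.card_pos.1 hA.card_pos
    obtain ⟨b, hb⟩ := Finset.card_pos.1 hB.card_pos
    obtain ⟨s, hs⟩ := adj_imp_of_degree_le_three (a := a) (b := y) (by rintro rfl; exact hyA ha)
      (hA.adj ha).symm hadj hx
    obtain ⟨p, r, hr⟩ := adj_imp_of_degree_le_four (a := b) (b := x) (by rintro rfl; exact hxB hb)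
      (hB.adj hb).symm hadj.symm hy
    exact not_few_inner_adj hn hG hS hA hB hAB (s := s) (p := p) (r := r)
      (fun u hu => by rcases hs u hu with rfl | h | h <;> tauto)
      (fun u hu => by rcases hr u hu with rfl | h | h <;> tauto)
  have h1 := hA.three_le_degree hn hG hS
  have h2 := hB.three_le_degree hn hG hS
  by_contra hc
  by_cases h3 : G.degree x ≤ 3
  · exact key hA hB hAB h3 (by omega)
  · exact key hB hA hAB.symm (by omega) (by omega)

open Classical in
/-- The number of lone neighbours of `v`. -/
noncomputable def loneCount (G : SimpleGraph V) [DecidableRel G.Adj] (v : V) : ℕ :=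
  ((G.neighborFinset v).filter (Lone G)).card

omit [DecidableEq V] in
theorem loneCount_le_degree (v : V) : loneCount G v ≤ G.degree v := by
  classical
  rw [← card_neighborFinset_eq_degree]
  exact Finset.card_filter_le _ _

omit [DecidableEq V] in
theorem exists_of_loneCount_pos {v : V} (h : 0 < loneCount G v) : ∃ w, G.Adj v w ∧ Lone G w := by
  classical
  obtain ⟨w, hw⟩ := Finset.card_pos.1 h
  simp at hw
  exact ⟨w, hw⟩

omit [DecidableEq V] in
theorem four_le_degree_of_loneCount_pos {v : V} (h : 0 < loneCount G v) : 4 ≤ G.degree v := by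
  obtain ⟨w, hw, hl⟩ := exists_of_loneCount_pos h
  obtain ⟨y, -, -, -, h4, -⟩ := hl.exists_of_adj hw.symm
  exact h4

open Classical in
theorem sum_loneCount : ∑ v, loneCount G v = ∑ v, if Lone G v then 2 else 0 := by
  have h1 : ∀ v, loneCount G v = ∑ u, if G.Adj v u ∧ Lone G u then 1 else 0 := by
    intro v
    rw [loneCount, ← Finset.card_filter]
    congr 1
    ext u
    simp
  simp only [h1]
  rw [Finset.sum_comm]
  refine Finset.sum_congr rfl fun u _ => ?_
  split_ifs with h
  · rw [← h.degree_eq, ← card_neighborFinset_eq_degree, ← Finset.card_filter]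
    congr 1
    ext v
    simp [h, G.adj_comm]
  · simp [h]

theorem loneCount_le (hn : 22 ≤ Fintype.card V) (hG : MaxNontraceable G)
    (hS : Spread G) {v : V} (hv : 3 ≤ G.degree v) : loneCount G v + 6 ≤ 2 * G.degree v := by
  classical
  by_contra hc
  have h0 := loneCount_le_degree (G := G) v
  have h4 := four_le_degree_of_loneCount_pos (G := G) (v := v) (by omega)
  have hsplit := Finset.card_filter_add_card_filter_not (s := G.neighborFinset v) (Lone G)
  rw [card_neighborFinset_eq_degree] at hsplit
  have hL : ∀ w, G.Adj v w → Lone G w → ∃ y, (∀ u, G.Adj w u ↔ u = v ∨ u = y) ∧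
      y ∈ (G.neighborFinset v).filter (fun u => ¬ Lone G u) := by
    intro w hw hl
    obtain ⟨y, -, h1, h2, -, h3⟩ := hl.exists_of_adj hw.symm
    refine ⟨y, h1, ?_⟩
    simp only [Finset.mem_filter, mem_neighborFinset]
    refine ⟨h2, fun h => ?_⟩
    rw [h.degree_eq] at h3
    omega
  have hle : 1 ≤ ((G.neighborFinset v).filter (fun u => ¬ Lone G u)).card := by
    obtain ⟨w, hw, hl⟩ := exists_of_loneCount_pos (G := G) (v := v) (by omega)
    obtain ⟨y, -, hy⟩ := hL w hw hl
    exact Finset.card_pos.2 ⟨y, hy⟩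
  have hk : loneCount G v = ((G.neighborFinset v).filter (Lone G)).card := rfl
  have h2 : 2 < ((G.neighborFinset v).filter (Lone G)).card := by omega
  have h1 : ((G.neighborFinset v).filter (fun u => ¬ Lone G u)).card ≤ 1 := by omega
  obtain ⟨a, b, c, ha, hb, hc, hab, hac, hbc⟩ := Finset.two_lt_card_iff.1 h2
  simp only [Finset.mem_filter, mem_neighborFinset] at ha hb hc
  obtain ⟨p, hp, hp'⟩ := hL a ha.1 ha.2
  obtain ⟨q, hq, hq'⟩ := hL b hb.1 hb.2
  obtain ⟨r, hr, hr'⟩ := hL c hc.1 hc.2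
  have := Finset.card_le_one.1 h1 p hp' q hq'
  subst this
  have := Finset.card_le_one.1 h1 p hp' r hr'
  subst this
  exact not_three_twins hn hG hS hab hac hbc hp hq hr

open Classical in
/-- Twice the excess of the degree of `v` over three, after every lone vertex has received one
unit from both its neighbours. -/
noncomputable def charge (G : SimpleGraph V) [DecidableRel G.Adj] (v : V) : ℤ :=
  2 * (G.degree v : ℤ) - 6 + (if Lone G v then 2 else 0) - loneCount G v

theorem sum_charge : ∑ v, charge G v = 2 * ∑ v, (G.degree v : ℤ) - 6 * Fintype.card V := by
  classical
  have h := congrArg (Nat.cast : ℕ → ℤ) (sum_loneCount (G := G))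
  push_cast at h
  simp only [charge, Finset.sum_sub_distrib, Finset.sum_add_distrib, h, ← Finset.mul_sum]
  simp
  ring

theorem charge_eq_of_blob {B : Finset V} {z w : V} (hB : IsBlob G B z) (hw : w ∈ B) :
    charge G w = 2 * B.card - 6 := by
  have h0 : loneCount G w = 0 := by
    by_contra h
    have := four_le_degree_of_loneCount_pos (Nat.pos_of_ne_zero h)
    have := hB.card_le
    rw [hB.degree_eq hw] at *
    omega
  rw [charge, hB.degree_eq hw, if_neg (hB.not_lone hw), h0]
  simp

theorem sum_charge_blob {B : Finset V} {z : V} (hB : IsBlob G B z) :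
    ∑ w ∈ B, charge G w = -4 := by
  rw [Finset.sum_congr rfl fun w hw => charge_eq_of_blob hB hw, Finset.sum_const]
  have h1 := hB.card_le
  have h2 := hB.card_pos
  have h3 : B.card = 1 ∨ B.card = 2 := by omega
  rcases h3 with h3 | h3 <;> simp [h3]

theorem charge_nonneg (hn : 22 ≤ Fintype.card V) (hG : MaxNontraceable G)
    (hS : Spread G) {v : V} (hv : ∀ B z, IsBlob G B z → v ∉ B) : 0 ≤ charge G v := by
  classical
  have h0 : G.degree v ≠ 0 := fun h => not_isolated hn hG hS (v := v) fun u hu => by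
    rw [← card_neighborFinset_eq_degree, Finset.card_eq_zero] at h
    rw [← mem_neighborFinset, h] at hu
    simp at hu
  have h1 : G.degree v ≠ 1 := fun h => by
    obtain ⟨x, hx⟩ := adj_iff_of_degree_eq_one h
    exact hv {v} x (Or.inl ⟨v, rfl, hx⟩) (by simp)
  rw [charge]
  by_cases h2 : G.degree v = 2
  · rcases exists_blob_or_lone hG h2 with ⟨B, z, hB, h⟩ | h
    · exact absurd h (hv B z hB)
    · have h3 : loneCount G v = 0 := by
        by_contra h
        have := four_le_degree_of_loneCount_pos (Nat.pos_of_ne_zero h)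
        omega
      simp [h, h2, h3]
  · have := loneCount_le hn hG hS (v := v) (by omega)
    split_ifs <;> omega

theorem ends_charge (hn : 22 ≤ Fintype.card V) (hG : MaxNontraceable G)
    (hS : Spread G) {A B : Finset V} {x y : V} (hA : IsBlob G A x) (hB : IsBlob G B y)
    (hAB : Disjoint A B) : 4 ≤ charge G x + charge G y := by
  classical
  have key : ∀ {A B : Finset V} {x y : V}, IsBlob G A x → IsBlob G B y → Disjoint A B →
      0 < loneCount G x → 4 ≤ charge G x := by
    intro A B x y hA hB hAB hk
    have cA := hA.card_le
    have cB := hB.card_le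
    obtain ⟨v, hxv, hl⟩ := exists_of_loneCount_pos hk
    obtain ⟨t, -, hv, -⟩ := hl.exists_of_adj hxv.symm
    have h3 := hB.three_le_degree hn hG hS
    have hsub : Finset.univ \ (A ∪ B ∪ {x}) ⊆ G.neighborFinset x := by
      intro u hu
      simp only [Finset.mem_sdiff, Finset.mem_univ, Finset.mem_union, Finset.mem_singleton,
        true_and, not_or] at hu
      rw [mem_neighborFinset]
      refine adj_of_adj_degree_two hn hG hS hA hB hAB hv (fun h => hA.not_lone h hl)
        (fun h => hB.not_lone h hl) ?_ hu.1.1 hu.1.2 hu.2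
      rintro rfl
      rw [hl.degree_eq] at h3
      omega
    have h4 := Finset.card_le_card hsub
    have h5 := Finset.le_card_sdiff (A ∪ B ∪ {x}) Finset.univ
    have h6 := Finset.card_union_le (A ∪ B) {x}
    have h7 := Finset.card_union_le A B
    rw [card_neighborFinset_eq_degree] at h4
    rw [Finset.card_univ] at h5
    rw [Finset.card_singleton] at h6
    have h8 := loneCount_le_degree (G := G) x
    rw [charge]
    split_ifs <;> omega
  have hnn : ∀ {B : Finset V} {z : V}, IsBlob G B z → 0 ≤ charge G z := by
    intro B z hB
    have h1 := hB.three_le_degree hn hG hS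
    refine charge_nonneg hn hG hS fun C y hC hz => ?_
    have h2 := hC.card_le
    rw [hC.degree_eq hz] at h1
    omega
  have hx := hnn hA
  have hy := hnn hB
  by_cases h1 : 0 < loneCount G x
  · have := key hA hB hAB h1
    omega
  by_cases h2 : 0 < loneCount G y
  · have := key hB hA hAB.symm h2
    omega
  have h3 := eight_le_degree_add_degree hn hG hS hA hB hAB
  rw [charge, charge]
  split_ifs <;> omega

theorem three_mul_le_sum_degree_of_spread (hn : 22 ≤ Fintype.card V) (hG : MaxNontraceable G)
    (hS : Spread G) : 3 * (Fintype.card V : ℤ) - 2 ≤ ∑ v, (G.degree v : ℤ) := by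
  classical
  suffices h : -4 ≤ ∑ v, charge G v by
    rw [sum_charge] at h
    omega
  let S : Finset (Finset V) := Finset.univ.filter fun B => ∃ z, IsBlob G B z
  have hmem : ∀ B, B ∈ S ↔ ∃ z, IsBlob G B z := fun B => by simp [S]
  have hdisj : ∀ A ∈ S, ∀ B ∈ S, A ≠ B → Disjoint A B := by
    intro A hA B hB hAB
    obtain ⟨x, hA⟩ := (hmem A).1 hA
    obtain ⟨y, hB⟩ := (hmem B).1 hB
    exact hA.disjoint hn hG hS hB hAB
  have hcard : S.card ≤ 2 := by
    by_contra hc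
    obtain ⟨A, B, C, hA, hB, hC, hAB, hAC, hBC⟩ := Finset.two_lt_card_iff.1 (not_le.1 hc)
    obtain ⟨x, kA⟩ := (hmem A).1 hA
    obtain ⟨y, kB⟩ := (hmem B).1 hB
    obtain ⟨z, kC⟩ := (hmem C).1 hC
    exact kA.not_three hn hG hS kB kC (hdisj A hA B hB hAB) (hdisj A hA C hC hAC)
      (hdisj B hB C hC hBC)
  have hU : ∑ v ∈ (S.biUnion fun B => B), charge G v = -4 * S.card := by
    rw [Finset.sum_biUnion hdisj, Finset.sum_congr rfl (g := fun _ => (-4 : ℤ)), Finset.sum_const]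
    · simp
      ring
    · intro B hB
      obtain ⟨z, hB⟩ := (hmem B).1 hB
      exact sum_charge_blob hB
  have hrest : ∀ v ∈ Finset.univ \ (S.biUnion fun B => B), 0 ≤ charge G v := by
    intro v hv
    refine charge_nonneg hn hG hS fun B z hB hvB => ?_
    simp only [Finset.mem_sdiff, Finset.mem_univ, true_and, Finset.mem_biUnion, not_exists,
      not_and] at hv
    exact hv B ((hmem B).2 ⟨z, hB⟩) hvB
  rw [← Finset.sum_sdiff (Finset.subset_univ (S.biUnion fun B => B)), hU]
  have h0 := Finset.sum_nonneg hrest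
  by_cases h2 : S.card = 2
  · obtain ⟨A, B, hAB, hS2⟩ := Finset.card_eq_two.1 h2
    have hA : A ∈ S := by simp [hS2]
    have hB : B ∈ S := by simp [hS2]
    have hd := hdisj A hA B hB hAB
    obtain ⟨x, kA⟩ := (hmem A).1 hA
    obtain ⟨y, kB⟩ := (hmem B).1 hB
    obtain ⟨hxy, -⟩ := ends_ne_and_notMem hn hG hS kA kB hd
    have hmem' : ∀ {C : Finset V} {z : V}, IsBlob G C z → z ∈ Finset.univ \ (S.biUnion fun B => B) := by
      intro C z hC
      simp only [Finset.mem_sdiff, Finset.mem_univ, true_and, Finset.mem_biUnion, not_exists,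
        not_and]
      intro D hD hz
      obtain ⟨y, kD⟩ := (hmem D).1 hD
      have h1 := hC.three_le_degree hn hG hS
      have h2 := kD.card_le
      rw [kD.degree_eq hz] at h1
      omega
    have hsub : ({x, y} : Finset V) ⊆ Finset.univ \ (S.biUnion fun B => B) := by
      intro u hu
      simp only [Finset.mem_insert, Finset.mem_singleton] at hu
      rcases hu with rfl | rfl
      · exact hmem' kA
      · exact hmem' kB
    have h3 := Finset.sum_le_sum_of_subset_of_nonneg hsub fun v hv _ => hrest v hv
    rw [Finset.sum_pair hxy] at h3
    have h4 := ends_charge hn hG hS kA kB hd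
    rw [h2]
    push_cast
    linarith
  · have : (S.card : ℤ) ≤ 1 := by omega
    linarith

theorem three_mul_le_sum_degree_of_not_spread (hn : 22 ≤ Fintype.card V)
    (hS : ¬ Spread G) : 3 * (Fintype.card V : ℤ) - 2 ≤ ∑ v, (G.degree v : ℤ) := by
  simp only [Spread, not_forall, not_exists, not_and, not_not] at hS
  obtain ⟨T, hT, h⟩ := hS
  have hc := Finset.card_compl T
  have h1 : ∀ v ∈ Tᶜ, (Tᶜ.card : ℤ) - 1 ≤ G.degree v := by
    intro v hv
    have hsub : Tᶜ.erase v ⊆ G.neighborFinset v := by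
      intro u hu
      simp only [Finset.mem_erase, Finset.mem_compl] at hu hv
      rw [mem_neighborFinset]
      exact h v u hv hu.2 hu.1.symm
    have := Finset.card_le_card hsub
    rw [Finset.card_erase_of_mem hv, card_neighborFinset_eq_degree] at this
    omega
  have h2 := Finset.sum_le_sum h1
  rw [Finset.sum_const, nsmul_eq_mul] at h2
  have h3 := Finset.sum_le_sum_of_subset_of_nonneg (Finset.subset_univ Tᶜ)
    (f := fun v => (G.degree v : ℤ)) fun v _ _ => by positivity
  have h4 : (Fintype.card V : ℤ) - 6 ≤ Tᶜ.card := by omega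
  nlinarith

theorem MaxNontraceable.three_mul_le (hn : 22 ≤ Fintype.card V) (hG : MaxNontraceable G) :
    3 * (Fintype.card V : ℤ) - 2 ≤ 2 * (Nat.card G.edgeSet : ℤ) := by
  have h : ∑ v, (G.degree v : ℤ) = 2 * (Nat.card G.edgeSet : ℤ) := by
    rw [Nat.card_eq_fintype_card, ← edgeFinset_card]
    exact_mod_cast G.sum_degrees_eq_twice_card_edges
  rw [← h]
  by_cases hS : Spread G
  · exact three_mul_le_sum_degree_of_spread hn hG hS
  · exact three_mul_le_sum_degree_of_not_spread hn hS

end Charge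

section

/-- A code for the parity, or for the repeated and the single entry, of a triple of colours. -/
def tripleCode (a b c : Fin 3) : ℕ :=
  if a = b then 2 + 3 * c + a else if a = c then 2 + 3 * b + a else
    if b = c then 2 + 3 * a + b else if b = a + 1 then 0 else 1

/-- The effect of a star on the codes of colour triples. -/
def flipCode (n : ℕ) : ℕ :=
  if n < 2 then n else 2 + 3 * ((n - 2) / 3) + (3 - (n - 2) % 3 - (n - 2) / 3)

theorem tripleCode_step : ∀ a p : Fin 3, a ≠ p → ∀ b q : Fin 3, b ≠ q → p ≠ q →
    ∀ c r : Fin 3, c ≠ r → p ≠ r → q ≠ r → ∀ a' : Fin 3, a' ≠ a → a' ≠ p →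
    ∀ b' : Fin 3, b' ≠ b → b' ≠ q → ∀ c' : Fin 3, c' ≠ c → c' ≠ r →
    tripleCode a' b' c' = flipCode (tripleCode a b c) := by
  decide +kernel

theorem tripleCode_twist : ∀ a p : Fin 3, a ≠ p → ∀ b q : Fin 3, b ≠ q → p ≠ q →
    ∀ c r : Fin 3, c ≠ r → p ≠ r → q ≠ r → ∀ a' : Fin 3, a' ≠ a → a' ≠ p →
    ∀ b' : Fin 3, b' ≠ b → b' ≠ q → ∀ c' : Fin 3, c' ≠ c → c' ≠ r →
    tripleCode a' b' c' ≠ tripleCode a c b := by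
  decide +kernel

theorem flipCode_flipCode_tripleCode : ∀ a p : Fin 3, a ≠ p → ∀ b q : Fin 3, b ≠ q → p ≠ q →
    ∀ c r : Fin 3, c ≠ r → p ≠ r → q ≠ r →
    flipCode (flipCode (tripleCode a b c)) = tripleCode a b c := by
  decide +kernel

/-- The end of the `j`-th edge leaving the `i`-th block of a flower snark with `k` blocks. -/
def nextLeaf (k i j : ℕ) : ℕ :=
  if i + 1 < k then 4 * (i + 1) + j else if j = 1 then 1 else if j = 2 then 3 else 2

/-- The relation `R` contains a flower snark with `k` blocks, in which the centre `4 * i` of the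
`i`-th block may be replaced by a triangle on `4 * i`, `s i` and `t i`. -/
def HasFlower (R : ℕ → ℕ → Prop) (k : ℕ) (s t : ℕ → ℕ) : Prop :=
  ∀ i < k, (R (4 * i) (4 * i + 1) ∧ R (s i) (4 * i + 2) ∧ R (t i) (4 * i + 3)) ∧
    (s i = 4 * i ∧ t i = 4 * i ∨ 4 * k ≤ s i ∧ 4 * k ≤ t i ∧ s i ≠ t i ∧
      R (4 * i) (s i) ∧ R (4 * i) (t i) ∧ R (s i) (t i)) ∧
    (R (4 * i + 1) (nextLeaf k i 1) ∧ R (4 * i + 2) (nextLeaf k i 2) ∧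
      R (4 * i + 3) (nextLeaf k i 3))

variable {R : ℕ → ℕ → Prop} {c : ℕ → ℕ → Fin 3} {k : ℕ} {s t : ℕ → ℕ}

theorem HasFlower.star_ne (h : HasFlower R k s t) (hs : ∀ u v, R u v → R v u)
    (hc : ∀ u v, c u v = c v u) (hp : ∀ u v w, R u v → R u w → v ≠ w → c u v ≠ c u w)
    {i : ℕ} (hi : i < k) :
    c (4 * i) (4 * i + 1) ≠ c (s i) (4 * i + 2) ∧ c (4 * i) (4 * i + 1) ≠ c (t i) (4 * i + 3) ∧
      c (s i) (4 * i + 2) ≠ c (t i) (4 * i + 3) := by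
  obtain ⟨⟨h1, h2, h3⟩, h4, -⟩ := h i hi
  rcases h4 with ⟨e1, e2⟩ | ⟨k1, k2, k3, h5, h6, h7⟩
  · rw [e1] at h2 ⊢
    rw [e2] at h3 ⊢
    exact ⟨hp _ _ _ h1 h2 (by omega), hp _ _ _ h1 h3 (by omega), hp _ _ _ h2 h3 (by omega)⟩
  · have q1 := hp _ _ _ h1 h5 (by omega)
    have q2 := hp _ _ _ h1 h6 (by omega)
    have q3 := hp _ _ _ h5 h6 k3
    have q4 := hp _ _ _ h2 (hs _ _ h5) (by omega)
    have q5 := hp _ _ _ h2 h7 (by omega)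
    have q6 := hp _ _ _ (hs _ _ h5) h7 (by omega)
    have q7 := hp _ _ _ h3 (hs _ _ h6) (by omega)
    have q8 := hp _ _ _ h3 (hs _ _ h7) (by omega)
    have q9 := hp _ _ _ (hs _ _ h6) (hs _ _ h7) (by omega)
    rw [hc (s i) (4 * i)] at q4 q6
    rw [hc (t i) (4 * i)] at q7 q9
    rw [hc (t i) (s i)] at q8 q9
    generalize c (4 * i) (4 * i + 1) = a1 at *
    generalize c (s i) (4 * i + 2) = a2 at *
    generalize c (t i) (4 * i + 3) = a3 at *
    generalize c (4 * i) (s i) = b1 at *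
    generalize c (4 * i) (t i) = b2 at *
    generalize c (s i) (t i) = b3 at *
    refine ⟨?_, ?_, ?_⟩ <;> omega

/-- Flower snarks with an odd number of blocks have no proper edge colouring with three colours. -/
theorem HasFlower.not_colourable (h : HasFlower R k s t) (hs : ∀ u v, R u v → R v u)
    (hk : k % 2 = 1) (hk3 : 3 ≤ k)
    (hc : ∀ u v, c u v = c v u) (hp : ∀ u v w, R u v → R u w → v ≠ w → c u v ≠ c u w) : False := by
  set X : ℕ → ℕ → Fin 3 := fun i j => c (4 * i + j) (nextLeaf k i j) with hX
  have step : ∀ i, i + 1 < k → tripleCode (X (i + 1) 1) (X (i + 1) 2) (X (i + 1) 3)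
      = flipCode (tripleCode (X i 1) (X i 2) (X i 3)) ∧
      flipCode (flipCode (tripleCode (X i 1) (X i 2) (X i 3)))
        = tripleCode (X i 1) (X i 2) (X i 3) := by
    intro i hi
    obtain ⟨n1, n2, n3⟩ := h.star_ne hs hc hp hi
    obtain ⟨⟨h1, h2, h3⟩, h4, h5, h6, h7⟩ := h (i + 1) hi
    obtain ⟨-, -, g5, g6, g7⟩ := h i (by omega)
    have key : ∀ j z, R z (4 * (i + 1) + j) → R (4 * i + j) (nextLeaf k i j) →
        R (4 * (i + 1) + j) (nextLeaf k (i + 1) j) → 1 ≤ j → j ≤ 3 → 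
        (z = 4 * (i + 1) ∨ 4 * k ≤ z) →
        X i j ≠ c z (4 * (i + 1) + j) ∧ X (i + 1) j ≠ X i j ∧
          X (i + 1) j ≠ c z (4 * (i + 1) + j) := by
      intro j z a1 a2 a3 j1 j3 hz
      have e : nextLeaf k i j = 4 * (i + 1) + j := by simp [nextLeaf, hi]
      have e' : (i + 2 < k ∧ nextLeaf k (i + 1) j = 4 * (i + 2) + j) ∨
          i + 2 = k ∧ nextLeaf k (i + 1) j ≤ 3 ∧ 1 ≤ nextLeaf k (i + 1) j := by
        unfold nextLeaf
        split_ifs <;> omega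
      simp only [hX]
      rw [e] at a2 ⊢
      rw [hc (4 * i + j), hc z]
      exact ⟨hp _ _ _ (hs _ _ a2) (hs _ _ a1) (by omega), hp _ _ _ a3 (hs _ _ a2) (by omega),
        hp _ _ _ a3 (hs _ _ a1) (by omega)⟩
    obtain ⟨p1, p2, p3⟩ := key 1 _ h1 g5 h5 (by omega) (by omega) (by omega)
    obtain ⟨q1, q2, q3⟩ := key 2 _ h2 g6 h6 (by omega) (by omega) (by omega)
    obtain ⟨r1, r2, r3⟩ := key 3 _ h3 g7 h7 (by omega) (by omega) (by omega)
    exact ⟨tripleCode_step _ _ p1 _ _ q1 n1 _ _ r1 n2 n3 _ p2 p3 _ q2 q3 _ r2 r3,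
      flipCode_flipCode_tripleCode _ _ p1 _ _ q1 n1 _ _ r1 n2 n3⟩
  have even : ∀ i, 2 * i < k → tripleCode (X (2 * i) 1) (X (2 * i) 2) (X (2 * i) 3)
      = tripleCode (X 0 1) (X 0 2) (X 0 3) := by
    intro i
    induction i with
    | zero => intro; rfl
    | succ i ih =>
      intro hi
      rw [← ih (by omega), ← (step (2 * i) (by omega)).2, ← (step (2 * i) (by omega)).1,
        ← (step (2 * i + 1) (by omega)).1]
      rfl
  obtain ⟨l, rfl⟩ : ∃ l, k = 2 * l + 1 := ⟨k / 2, by omega⟩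
  have e := even l (by omega)
  obtain ⟨n1, n2, n3⟩ := h.star_ne hs hc hp (i := 0) (by omega)
  obtain ⟨⟨h1, h2, h3⟩, h4, h5, h6, h7⟩ := h 0 (by omega)
  obtain ⟨-, -, g5, g6, g7⟩ := h (2 * l) (by omega)
  have key : ∀ j j' z, R z (4 * 0 + j) → R (4 * (2 * l) + j') (nextLeaf (2 * l + 1) (2 * l) j') →
      R (4 * 0 + j) (nextLeaf (2 * l + 1) 0 j) → 1 ≤ j → j ≤ 3 → 
      (z = 4 * 0 ∨ 4 * (2 * l + 1) ≤ z) → 1 ≤ j' → j' ≤ 3 → 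
      nextLeaf (2 * l + 1) (2 * l) j' = j →
      X (2 * l) j' ≠ c z (4 * 0 + j) ∧ X 0 j ≠ X (2 * l) j' ∧
        X 0 j ≠ c z (4 * 0 + j) := by
    intro j j' z a1 a2 a3 j1 j3 hz j1' j3' e
    have e' : nextLeaf (2 * l + 1) 0 j = 4 + j := by 
      simp [nextLeaf, show 0 < l by omega]
    simp only [hX]
    rw [e] at a2 ⊢
    simp only [mul_zero, zero_add] at a1 a3 ⊢
    rw [hc _ j, hc z]
    exact ⟨hp _ _ _ (hs _ _ a2) (hs _ _ a1) (by omega), hp _ _ _ a3 (hs _ _ a2) (by omega),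
      hp _ _ _ a3 (hs _ _ a1) (by omega)⟩
  obtain ⟨p1, p2, p3⟩ := key 1 1 _ h1 g5 h5 (by omega) (by omega) (by omega) (by omega)
    (by omega) (by simp [nextLeaf])
  obtain ⟨q1, q2, q3⟩ := key 2 3 _ h2 g7 h6 (by omega) (by omega) (by omega) (by omega)
    (by omega) (by simp [nextLeaf])
  obtain ⟨r1, r2, r3⟩ := key 3 2 _ h3 g6 h7 (by omega) (by omega) (by omega) (by omega)
    (by omega) (by simp [nextLeaf])
  exact tripleCode_twist _ _ p1 _ _ q1 n1 _ _ r1 n2 n3 _ p2 p3 _ q2 q3 _ r2 r3 e.symm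
end

section

variable {β : Type}

/-- Evaluates `n` before passing it to the continuation `k`. -/
def forceNat (n : ℕ) (k : ℕ → β) : β :=
  Nat.rec (motive := fun _ => β) (k 0) (fun p _ => k (Nat.succ p)) n

/-- Passes `l.reverse ++ r` to the continuation `k`. -/
def revApp (l r : List ℕ) (k : List ℕ → β) : β :=
  List.rec (motive := fun _ => List ℕ → β) k (fun a _ ih r => ih (a :: r)) l r

/-- If `l = P ++ w :: Q`, passes `P.reverse ++ r` and `Q` to the continuation `k`. -/
def splitAtElem (w : ℕ) (l r : List ℕ) (k : List ℕ → List ℕ → β) (d : β) : β :=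
  List.rec (motive := fun _ => List ℕ → β) (fun _ => d)
    (fun a t ih r => cond (Nat.beq a w) (k r t) (ih (a :: r))) l r

/-- The `i`-th neighbour of `u` in the cubic graph with table `T`. -/
def nb (T u i : ℕ) : ℕ :=
  Nat.mod (Nat.shiftRight T (Nat.mul 6 (Nat.add (Nat.mul 3 u) i))) 64

/-- Rotates the first of two disjoint paths along the `i`-th edge at its head. -/
def rotate (T i : ℕ) (A B : List ℕ) (k : List ℕ → List ℕ → β) (d : β) : β :=
  List.rec (motive := fun _ => β) d (fun u _ _ =>
    forceNat (nb T u i) fun w =>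
      splitAtElem w A []
        (fun R Q => revApp R [] fun P => revApp P (w :: Q) fun A' => k A' B)
        (splitAtElem w B []
          (fun R Q => List.rec (motive := fun _ => β) d
            (fun _ _ _ => revApp R (w :: A) fun A' => k A' Q) Q) d)) A

/-- Adds the pair of heads of `A` and `B` to the set of pairs encoded by `S`. -/
def record (S : ℕ) (A B : List ℕ) (k : ℕ → β) : β :=
  List.rec (motive := fun _ => β) (k S) (fun u _ _ =>
    List.rec (motive := fun _ => β) (k S) (fun v _ _ =>
      forceNat (Nat.lor S (Nat.shiftLeft 1 (Nat.add (Nat.mul 64 u) v))) k) B) A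

/-- Performs the rotations encoded by the base 8 digits of `P`, where the digit 7 restores the
last pair of paths in `st`, and collects the pairs of heads. -/
def explore (T fuel P S : ℕ) (A B : List ℕ) (st : List (List ℕ × List ℕ)) (k : ℕ → β) : β :=
  Nat.rec (motive := fun _ => ℕ → ℕ → List ℕ → List ℕ → List (List ℕ × List ℕ) → β)
    (fun _ S _ _ _ => k S)
    (fun _ ih P S A B st =>
      forceNat (Nat.div P 8) fun P' =>
      forceNat (Nat.mod P 8) fun c =>
      cond (Nat.beq c 7)
        (List.rec (motive := fun _ => β) (k S)
          (fun s st' _ => Prod.rec (motive := fun _ => β) (fun A' B' => ih P' S A' B' st') s) st)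
        (cond (Nat.ble c 2)
          (rotate T (Nat.mod c 3) A B
            (fun A' B' => record S A' B' fun S' => ih P' S' A' B' ((A, B) :: st)) (k S))
          (rotate T (Nat.mod c 3) B A
            (fun B' A' => record S A' B' fun S' => ih P' S' A' B' ((A, B) :: st)) (k S))))
    fuel P S A B st

def allBelow (n : ℕ) (p : ℕ → Bool) : Bool :=
  Nat.rec (motive := fun _ => Bool) true (fun i ih => cond (p i) ih false) n

def anyBelow (n : ℕ) (p : ℕ → Bool) : Bool :=
  Nat.rec (motive := fun _ => Bool) false (fun i ih => cond (p i) true ih) n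

def hAdj (T u v : ℕ) : Bool :=
  cond (Nat.beq v (nb T u 0)) true (cond (Nat.beq v (nb T u 1)) true (Nat.beq v (nb T u 2)))

def hasPair (S u v : ℕ) : Bool :=
  Nat.beq (Nat.mod (Nat.shiftRight S (Nat.add (Nat.mul 64 u) v)) 2) 1

def closedPairs (T m x y S : ℕ) : Bool :=
  cond (allBelow m fun u => allBelow m fun v =>
      cond (hasPair S u v) true (cond (hasPair S v u) true (cond (Nat.beq u v) true (hAdj T u v))))
    (cond (allBelow m fun v => cond (Nat.beq v x) true (anyBelow m fun u => hasPair S u v))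
      (allBelow m fun u => cond (Nat.beq u y) true (anyBelow m fun v => hasPair S u v)) false) false

def coverCheck (T m x y fuel P : ℕ) (A B : List ℕ) : Bool :=
  record 0 A B fun S => explore T fuel P S A B [] fun S' => closedPairs T m x y S'
end

section

variable {β : Type}

theorem forceNat_eq (n : ℕ) (k : ℕ → β) : forceNat n k = k n := by
  cases n <;> rfl

theorem revApp_eq (l r : List ℕ) (k : List ℕ → β) : revApp l r k = k (l.reverse ++ r) := by
  induction l generalizing r with
  | nil => rfl
  | cons a l ih =>
    change revApp l (a :: r) k = _
    rw [ih]
    simp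

theorem splitAtElem_eq (w : ℕ) (l r : List ℕ) (k : List ℕ → List ℕ → β) (d : β) :
    (∃ P Q, l = P ++ w :: Q ∧ splitAtElem w l r k d = k (P.reverse ++ r) Q) ∨
      splitAtElem w l r k d = d := by
  induction l generalizing r with
  | nil => exact Or.inr rfl
  | cons a l ih =>
    have e : splitAtElem w (a :: l) r k d =
      cond (Nat.beq a w) (k r l) (splitAtElem w l (a :: r) k d) := rfl
    rw [e]
    cases h : Nat.beq a w with
    | true => exact Or.inl ⟨[], l, by rw [Nat.eq_of_beq_eq_true h]; rfl, rfl⟩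
    | false =>
      rcases ih (a :: r) with ⟨P, Q, rfl, h2⟩ | h2
      · exact Or.inl ⟨a :: P, Q, rfl, by simpa using h2⟩
      · exact Or.inr h2

variable {R : ℕ → ℕ → Prop} {T m x y : ℕ}

/-- The lists `A` and `B` are disjoint paths of `R` which end in `x` and `y` and cover all numbers
below `m`. -/
def PathPair (R : ℕ → ℕ → Prop) (m x y : ℕ) (A B : List ℕ) : Prop :=
  A.IsChain R ∧ B.IsChain R ∧ (A ++ B).Perm (List.range m) ∧ A.getLast? = some x ∧
    B.getLast? = some y

/-- There are disjoint paths from `u` to `x` and from `v` to `y` that cover all numbers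
below `m`. -/
def Linked (R : ℕ → ℕ → Prop) (m x y u v : ℕ) : Prop :=
  ∃ A B, PathPair R m x y (u :: A) (v :: B)

theorem PathPair.symm {A B : List ℕ} (h : PathPair R m x y A B) : PathPair R m y x B A :=
  ⟨h.2.1, h.1, List.perm_append_comm.trans h.2.2.1, h.2.2.2.2, h.2.2.2.1⟩

theorem rotate_sound (hs : ∀ u v, R u v → R v u) (hR : ∀ u < m, ∀ i < 3, R u (nb T u i))
    {i : ℕ} (hi : i < 3) {A B : List ℕ} (h : PathPair R m x y A B) {k : List ℕ → List ℕ → β} {d : β} :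
    (∃ A' B', PathPair R m x y A' B' ∧ rotate T i A B k d = k A' B') ∨ rotate T i A B k d = d := by
  rcases A with _ | ⟨u, A⟩
  · exact Or.inr rfl
  obtain ⟨hA, hB, hp, hx, hy⟩ := h
  have hu : u < m := by simpa using hp.subset (show u ∈ (u :: A) ++ B by simp)
  have hw := hR u hu i hi
  have e : rotate T i (u :: A) B k d = forceNat (nb T u i) fun w =>
      splitAtElem w (u :: A) []
        (fun R Q => revApp R [] fun P => revApp P (w :: Q) fun A' => k A' B)
        (splitAtElem w B []
          (fun R Q => List.rec (motive := fun _ => β) d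
            (fun _ _ _ => revApp R (w :: u :: A) fun A' => k A' Q) Q) d) := rfl
  rw [e, forceNat_eq]
  generalize nb T u i = w at *
  rcases splitAtElem_eq w (u :: A) []
        (fun R Q => revApp R [] fun P => revApp P (w :: Q) fun A' => k A' B)
        (splitAtElem w B []
          (fun R Q => List.rec (motive := fun _ => β) d
            (fun _ _ _ => revApp R (w :: u :: A) fun A' => k A' Q) Q) d) with ⟨P, Q, e1, e2⟩ | e2
  · left
    refine ⟨P.reverse ++ w :: Q, B, ⟨?_, hB, ?_, ?_, hy⟩, by rw [e2, revApp_eq, revApp_eq]; simp⟩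
    · rw [e1, List.isChain_append] at hA
      rw [List.isChain_append]
      refine ⟨?_, hA.2.1, ?_⟩
      · rw [List.isChain_reverse]
        exact hA.1.imp fun a b => hs a b
      · intro a ha b hb
        rcases P with _ | ⟨p, P⟩
        · simp at ha
        · simp only [List.cons_append, List.cons.injEq] at e1
          simp at ha hb
          rw [← ha, ← e1.1, ← hb]
          exact hw
    · refine List.Perm.trans ?_ hp
      rw [e1]
      exact ((List.reverse_perm P).append_right _).append_right _
    · rw [e1] at hx
      simpa using hx
  · rw [e2]
    rcases splitAtElem_eq w B [] (fun R Q => List.rec (motive := fun _ => β) d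
            (fun _ _ _ => revApp R (w :: u :: A) fun A' => k A' Q) Q) d with ⟨P, Q, e1, e2⟩ | e2
    · rw [e2]
      rcases Q with _ | ⟨q, Q⟩
      · exact Or.inr rfl
      left
      refine ⟨P ++ w :: u :: A, q :: Q, ⟨?_, ?_, ?_, ?_, ?_⟩, ?_⟩
      · rw [e1, List.isChain_append] at hB
        rw [List.isChain_append]
        refine ⟨hB.1, ?_, fun a ha b hb => hB.2.2 a ha b (by simpa using hb)⟩
        exact List.isChain_cons_cons.2 ⟨hs _ _ hw, hA⟩
      · rw [e1, List.isChain_append, List.isChain_cons_cons] at hB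
        exact hB.2.1.2
      · refine List.Perm.trans ?_ hp
        rw [e1]
        refine List.perm_iff_count.2 fun a => ?_
        simp only [List.count_append, List.count_cons]
        omega
      · simpa using hx
      · rw [e1] at hy
        simpa using hy
      · change revApp (P.reverse ++ []) (w :: u :: A) (fun A' => k A' (q :: Q)) = _
        rw [revApp_eq]
        simp
    · exact Or.inr e2

/-- All pairs encoded by `S` are linked. -/
def Records (R : ℕ → ℕ → Prop) (m x y S : ℕ) : Prop :=
  ∀ u v, v < 64 → S.testBit (64 * u + v) = true → Linked R m x y u v

theorem record_sound (hm : m ≤ 64) {S : ℕ} (hS : Records R m x y S) {A B : List ℕ}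
    (h : PathPair R m x y A B) {k : ℕ → β} :
    ∃ S', Records R m x y S' ∧ record S A B k = k S' := by
  rcases A with _ | ⟨u, A⟩
  · exact ⟨S, hS, rfl⟩
  rcases B with _ | ⟨v, B⟩
  · exact ⟨S, hS, rfl⟩
  have hv : v < m := by simpa using h.2.2.1.subset (show v ∈ (u :: A) ++ v :: B by simp)
  have e : record S (u :: A) (v :: B) k
    = forceNat (Nat.lor S (Nat.shiftLeft 1 (Nat.add (Nat.mul 64 u) v))) k := rfl
  refine ⟨S ||| 1 <<< (64 * u + v), ?_, by rw [e, forceNat_eq]; rfl⟩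
  intro u' v' hv' hb
  rw [Nat.testBit_or, Bool.or_eq_true] at hb
  rcases hb with hb | hb
  · exact hS u' v' hv' hb
  · rw [Nat.one_shiftLeft, Nat.testBit_two_pow, decide_eq_true_eq] at hb
    obtain rfl : u = u' := by omega
    obtain rfl : v = v' := by omega
    exact ⟨A, B, h⟩

theorem explore_succ (n P S : ℕ) (A B : List ℕ) (st : List (List ℕ × List ℕ)) (k : ℕ → β) :
    explore T (n + 1) P S A B st k =
      cond (Nat.beq (Nat.mod P 8) 7)
        (List.rec (motive := fun _ => β) (k S)
          (fun s st' _ => explore T n (Nat.div P 8) S s.1 s.2 st' k) st)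
        (cond (Nat.ble (Nat.mod P 8) 2)
          (rotate T (Nat.mod (Nat.mod P 8) 3) A B (fun A' B' => record S A' B' fun S' =>
            explore T n (Nat.div P 8) S' A' B' ((A, B) :: st) k) (k S))
          (rotate T (Nat.mod (Nat.mod P 8) 3) B A (fun B' A' => record S A' B' fun S' =>
            explore T n (Nat.div P 8) S' A' B' ((A, B) :: st) k) (k S))) := by
  have e : explore T (n + 1) P S A B st k = forceNat (Nat.div P 8) fun P' =>
      forceNat (Nat.mod P 8) fun c =>
      cond (Nat.beq c 7)
        (List.rec (motive := fun _ => β) (k S)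
          (fun s st' _ => explore T n P' S s.1 s.2 st' k) st)
        (cond (Nat.ble c 2)
          (rotate T (Nat.mod c 3) A B
            (fun A' B' => record S A' B' fun S' => explore T n P' S' A' B' ((A, B) :: st) k) (k S))
          (rotate T (Nat.mod c 3) B A
            (fun B' A' => record S A' B' fun S' => explore T n P' S' A' B' ((A, B) :: st) k)
            (k S))) := rfl
  rw [e, forceNat_eq, forceNat_eq]

theorem explore_sound (hs : ∀ u v, R u v → R v u) (hR : ∀ u < m, ∀ i < 3, R u (nb T u i))
    (hm : m ≤ 64) (fuel P S : ℕ) (hS : Records R m x y S) {A B : List ℕ}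
    (h : PathPair R m x y A B) (st : List (List ℕ × List ℕ))
    (hst : ∀ s ∈ st, PathPair R m x y s.1 s.2) {k : ℕ → β} :
    ∃ S', Records R m x y S' ∧ explore T fuel P S A B st k = k S' := by
  induction fuel generalizing P S A B st with
  | zero => exact ⟨S, hS, rfl⟩
  | succ n ih =>
    rw [explore_succ]
    cases Nat.beq (Nat.mod P 8) 7 with
    | true =>
      rcases st with _ | ⟨s, st⟩
      · exact ⟨S, hS, rfl⟩
      · exact ih _ _ hS (hst s (by simp)) st fun z hz => hst z (by simp [hz])
    | false =>
      have hst' : ∀ s ∈ (A, B) :: st, PathPair R m x y s.1 s.2 := by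
        intro s hs
        rcases List.mem_cons.1 hs with rfl | hs
        · exact h
        · exact hst s hs
      cases Nat.ble (Nat.mod P 8) 2 with
      | true =>
        simp only [cond_true, cond_false]
        rcases rotate_sound hs hR (i := Nat.mod (Nat.mod P 8) 3) (Nat.mod_lt _ (by omega)) h with
          ⟨A', B', h', e⟩ | e
        · rw [e]
          obtain ⟨S', hS', e⟩ := record_sound hm hS h'
          rw [e]
          exact ih _ _ hS' h' _ hst'
        · rw [e]
          exact ⟨S, hS, rfl⟩
      | false =>
        simp only [cond_false]
        rcases rotate_sound hs hR (i := Nat.mod (Nat.mod P 8) 3) (Nat.mod_lt _ (by omega)) h.symm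
          with ⟨B', A', h', e⟩ | e
        · rw [e]
          obtain ⟨S', hS', e⟩ := record_sound hm hS h'.symm
          rw [e]
          exact ih _ _ hS' h'.symm _ hst'
        · rw [e]
          exact ⟨S, hS, rfl⟩

theorem allBelow_iff {n : ℕ} {p : ℕ → Bool} : allBelow n p = true ↔ ∀ i < n, p i = true := by
  induction n with
  | zero => simp [allBelow]
  | succ n ih =>
    have e : allBelow (n + 1) p = cond (p n) (allBelow n p) false := rfl
    rw [e, Bool.cond_false_right, Bool.and_eq_true, ih, Nat.forall_lt_succ_right, and_comm]

theorem anyBelow_iff {n : ℕ} {p : ℕ → Bool} : anyBelow n p = true ↔ ∃ i < n, p i = true := by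
  induction n with
  | zero => simp [anyBelow]
  | succ n ih =>
    have e : anyBelow (n + 1) p = cond (p n) true (anyBelow n p) := rfl
    rw [e, Bool.cond_true_left, Bool.or_eq_true, ih, Nat.exists_lt_succ_right, or_comm]

theorem hasPair_eq (S u v : ℕ) : hasPair S u v = S.testBit (64 * u + v) := by
  rw [Nat.testBit_eq_decide_div_mod_eq, ← Nat.shiftRight_eq_div_pow, Bool.eq_iff_iff,
    decide_eq_true_eq]
  exact Iff.of_eq Nat.beq_eq

/-- Every pair of heads needed for maximality is linked. -/
structure WellLinked (R : ℕ → ℕ → Prop) (m x y : ℕ) : Prop where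
  pair : ∀ u < m, ∀ v < m, u ≠ v → ¬ R u v → Linked R m x y u v ∨ Linked R m x y v u
  left : ∀ v < m, v ≠ x → ∃ u < m, Linked R m x y u v
  right : ∀ u < m, u ≠ y → ∃ v < m, Linked R m x y u v

theorem wellLinked_of_coverCheck (hs : ∀ u v, R u v → R v u)
    (hR : ∀ u < m, ∀ i < 3, R u (nb T u i)) (hm : m ≤ 64) {fuel P : ℕ} {A B : List ℕ}
    (h : PathPair R m x y A B) (hc : coverCheck T m x y fuel P A B = true) :
    WellLinked R m x y := by
  unfold coverCheck at hc
  obtain ⟨S, hS, e⟩ := record_sound (R := R) (k := fun S => explore T fuel P S A B [] fun S' =>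
    closedPairs T m x y S') hm (S := 0) (fun u v _ h => by simp at h) h
  rw [e] at hc
  obtain ⟨S', hS', e⟩ := explore_sound hs hR hm fuel P S hS h [] (by simp) (k := closedPairs T m x y)
  rw [e] at hc
  simp only [closedPairs, Bool.cond_false_right, Bool.and_eq_true, allBelow_iff, anyBelow_iff,
    Bool.cond_true_left, Bool.or_eq_true, hasPair_eq, hAdj, Nat.beq_eq] at hc
  obtain ⟨h1, h2, h3⟩ := hc
  refine ⟨fun u hu v hv huv hr => ?_, fun v hv hvx => ?_, fun u hu huy => ?_⟩
  · have := h1 u hu v hv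
    rcases this with h | h | h | h | h | h
    · exact Or.inl (hS' u v (by omega) h)
    · exact Or.inr (hS' v u (by omega) h)
    · exact absurd h huv
    · exact absurd (h ▸ hR u hu 0 (by omega)) hr
    · exact absurd (h ▸ hR u hu 1 (by omega)) hr
    · exact absurd (h ▸ hR u hu 2 (by omega)) hr
  · rcases h2 v hv with h | ⟨u, hu, h⟩
    · exact absurd h hvx
    · exact ⟨u, hu, hS' u v (by omega) h⟩
  · rcases h3 u hu with h | ⟨v, hv, h⟩
    · exact absurd h huy
    · exact ⟨v, hv, hS' u v (by omega) h⟩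
end

section

variable {R : ℕ → ℕ → Prop} {m x y : ℕ} {q : ℕ → ℕ}

/-- The injective map `q` numbers the vertices of a Hamiltonian path of `R` from `x` to `y`. -/
structure PathNumbering (R : ℕ → ℕ → Prop) (m x y : ℕ) (q : ℕ → ℕ) : Prop where
  pos : ∀ u < m, 1 ≤ q u
  le : ∀ u < m, q u ≤ m
  inj : ∀ u < m, ∀ v < m, q u = q v → u = v
  surj : ∀ i, 1 ≤ i → i ≤ m → ∃ u < m, q u = i
  adj : ∀ u < m, ∀ v < m, q v = q u + 1 → R u v
  left : q x = 1
  right : q y = m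

/-- The colouring that alternates along a Hamiltonian path and gives the closing edge colour 0. -/
def pathColour (m : ℕ) (q : ℕ → ℕ) (u v : ℕ) : Fin 3 :=
  if q v = q u + 1 then (if q u % 2 = 0 then 0 else 1) else
    if q u = q v + 1 then (if q v % 2 = 0 then 0 else 1) else
      if q u = 1 ∧ q v = m ∨ q v = 1 ∧ q u = m then 0 else 2

theorem pathColour_comm (u v : ℕ) : pathColour m q u v = pathColour m q v u := by
  unfold pathColour
  split_ifs <;> first | rfl | omega

theorem PathNumbering.pathColour_ne (h : PathNumbering R m x y q) (hlt : ∀ u v, R u v → u < m ∧ v < m)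
    (hs : ∀ u v, R u v → R v u) (hxy : R x y) (hm : m % 2 = 0) (hm4 : 4 ≤ m) {f : ℕ → ℕ → ℕ}
    (hf : ∀ u v, R u v → v = f u 0 ∨ v = f u 1 ∨ v = f u 2) (u v w : ℕ) (huv : R u v)
    (huw : R u w) (hvw : v ≠ w) : pathColour m q u v ≠ pathColour m q u w := by
  intro e
  obtain ⟨hu, hv⟩ := hlt _ _ huv
  have hw := (hlt _ _ huw).2
  have q0 : q v ≠ q w := fun e => hvw (h.inj _ hv _ hw e)
  have qv := h.pos v hv
  have qw := h.pos w hw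
  have qu := h.pos u hu
  have qu' := h.le u hu
  have qv' := h.le v hv
  have qw' := h.le w hw
  have hcase : (q v = q u + 1 ∨ q u = q v + 1 ∨ q u = 1 ∧ q v = m ∨ q v = 1 ∧ q u = m) ∨
      (q w = q u + 1 ∨ q u = q w + 1 ∨ q u = 1 ∧ q w = m ∨ q w = 1 ∧ q u = m) := by
    by_contra! hn
    obtain ⟨a, ha, haq⟩ : ∃ a, R u a ∧ (q a = q u + 1 ∨ q u = m ∧ q a = 1) := by
      by_cases hum : q u = m
      · have : u = y := h.inj _ hu _ (hlt _ _ hxy).2 (hum.trans h.right.symm)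
        exact ⟨x, this ▸ hs _ _ hxy, Or.inr ⟨hum, h.left⟩⟩
      · obtain ⟨a, ha, e⟩ := h.surj (q u + 1) (by omega) (by omega)
        exact ⟨a, h.adj _ hu _ ha e, Or.inl e⟩
    obtain ⟨b, hb, hbq⟩ : ∃ b, R u b ∧ (q u = q b + 1 ∨ q u = 1 ∧ q b = m) := by
      by_cases hum : q u = 1
      · have : u = x := h.inj _ hu _ (hlt _ _ hxy).1 (hum.trans h.left.symm)
        exact ⟨y, this ▸ hxy, Or.inr ⟨hum, h.right⟩⟩
      · obtain ⟨a, ha, e⟩ := h.surj (q u - 1) (by omega) (by omega)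
        exact ⟨a, hs _ _ (h.adj _ ha _ hu (by omega)), Or.inl (by omega)⟩
    obtain ⟨⟨k1, k2, k3, k4⟩, l1, l2, l3, l4⟩ := hn
    have n1 : a ≠ b := by
      rintro rfl
      clear k1 k2 k3 k4 l1 l2 l3 l4
      omega
    have n2 : a ≠ v := by
      rintro rfl
      exact haq.elim k1 fun h => k4 h.2 h.1
    have n3 : a ≠ w := by
      rintro rfl
      exact haq.elim l1 fun h => l4 h.2 h.1
    have n4 : b ≠ v := by
      rintro rfl
      exact hbq.elim k2 fun h => k3 h.1 h.2
    have n5 : b ≠ w := by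
      rintro rfl
      exact hbq.elim l2 fun h => l3 h.1 h.2
    have h1 := hf _ _ ha
    have h2 := hf _ _ hb
    have h3 := hf _ _ huv
    have h4 := hf _ _ huw
    clear * - h1 h2 h3 h4 n1 n2 n3 n4 n5 hvw
    grind
  unfold pathColour at e
  split_ifs at e <;> omega

end

section

variable {n : ℕ} {G : SimpleGraph (Fin n)} {P R : ℕ → ℕ → Prop} {m x y : ℕ}

theorem traceable_sup_edge_of_perm (hG : ∀ u v : Fin n, P u v → G.Adj u v) {a b : Fin n}
    {A B : List ℕ} (hA : (a.1 :: A).IsChain P) (hB : (b.1 :: B).IsChain P)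
    (hp : ((a.1 :: A) ++ (b.1 :: B)).Perm (List.range n)) : Traceable (G ⊔ edge a b) := by
  have hlt : ∀ w ∈ (a.1 :: A) ++ (b.1 :: B), w < n := fun w hw => by
    simpa using hp.subset hw
  lift A to List (Fin n) using fun w hw => hlt w (by simp [hw])
  lift B to List (Fin n) using fun w hw => hlt w (by simp [hw])
  have hnd := hp.nodup_iff.2 List.nodup_range
  have e : ((a.1 :: A.map Fin.val) ++ (b.1 :: B.map Fin.val)) =
    ((a :: A) ++ (b :: B)).map Fin.val := by simp
  have hab : a ≠ b := by
    rintro rfl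
    simp at hnd
  refine traceable_sup_edge_of_cover (A := A) (B := B) hab ⟨?_, ?_, ?_, ?_⟩
  · rw [← List.map_cons, List.isChain_map] at hA
    exact hA.imp fun u v => hG u v
  · rw [← List.map_cons, List.isChain_map] at hB
    exact hB.imp fun u v => hG u v
  · rw [e] at hnd
    exact hnd.of_map
  · intro w
    have : w.1 ∈ List.range n := by simp
    rw [← hp.mem_iff, e, List.mem_map] at this
    obtain ⟨z, hz, e⟩ := this
    rwa [← Fin.ext e]

/-- The graph `G` arises from `R` by attaching a pendant vertex `m` to `x` and a clique, whose
vertices are the numbers between `m` and `n`, to `y`. -/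
structure IsPendant (G : SimpleGraph (Fin n)) (R : ℕ → ℕ → Prop) (m x y : ℕ) : Prop where
  base : ∀ u v : Fin n, u.1 < m → v.1 < m → (G.Adj u v ↔ R u v)
  left : ∀ u v : Fin n, u.1 = m → (G.Adj u v ↔ v.1 = x)
  right : ∀ u v : Fin n, m < u.1 → (G.Adj u v ↔ v.1 = y ∨ m < v.1 ∧ v ≠ u)

theorem IsPendant.traceable_of_lt (h : IsPendant G R m x y) (hn : n = m + 2 ∨ n = m + 3)
    (hlt : ∀ u v, R u v → u < m ∧ v < m) (hx : x < m) (hy : y < m) (hm : 2 ≤ m)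
    (hw : WellLinked R m x y) {u v : Fin n} (huv : u < v) (hadj : ¬ G.Adj u v) :
    Traceable (G ⊔ edge u v) := by
  have huv : u.1 < v.1 := huv
  set P : ℕ → ℕ → Prop := fun u v => ∃ (hu : u < n) (hv : v < n), G.Adj ⟨u, hu⟩ ⟨v, hv⟩ with hP
  have hG : ∀ u v : Fin n, P u v → G.Adj u v := fun u v ⟨_, _, h⟩ => h
  have sP : ∀ u v, P u v → P v u := fun u v ⟨a, b, h⟩ => ⟨b, a, h.symm⟩
  have hR : ∀ u v, R u v → P u v := by
    intro u v huv
    obtain ⟨hu, hv⟩ := hlt _ _ huv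
    exact ⟨by omega, by omega, (h.base _ _ hu hv).2 huv⟩
  have hPx : P x m := sP _ _ ⟨by omega, by omega, (h.left _ _ rfl).2 rfl⟩
  have hPy : ∀ w, m < w → w < n → P y w := fun w h1 h2 =>
    sP _ _ ⟨h2, by omega, (h.right _ _ h1).2 (Or.inl rfl)⟩
  have hbl : ∀ c, m < c → c < n → ∃ bl, (c :: bl).IsChain P ∧ (∀ w ∈ c :: bl, m < w ∧ w < n) ∧
      (List.range n).Perm (List.range m ++ m :: c :: bl) := by
    intro c h1 h2
    rcases hn with rfl | rfl
    · obtain rfl : c = m + 1 := by omega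
      exact ⟨[], by simp, by simp, by simp [List.range_succ]⟩
    · obtain ⟨w, hw, e⟩ : ∃ w, m < w ∧ (c = m + 1 ∧ w = m + 2 ∨ c = m + 2 ∧ w = m + 1) := by
        rcases (show c = m + 1 ∨ c = m + 2 by omega) with rfl | rfl
        · exact ⟨m + 2, by omega, by omega⟩
        · exact ⟨m + 1, by omega, by omega⟩
      refine ⟨[w], List.isChain_pair.2 ⟨h2, by omega, (h.right _ _ h1).2 (Or.inr ⟨hw, ?_⟩)⟩, ?_, ?_⟩
      · rw [Ne, Fin.mk.injEq]
        omega
      · intro z hz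
        simp only [List.mem_cons, List.not_mem_nil, or_false] at hz
        omega
      · rcases e with ⟨rfl, rfl⟩ | ⟨rfl, rfl⟩
        · simp [List.range_succ]
        · simp only [List.range_succ, List.append_assoc, List.cons_append, List.nil_append]
          exact List.Perm.append_left _ (List.Perm.cons _ (List.Perm.swap _ _ _))
  have chx : ∀ A B, PathPair R m x y A B → (A ++ [m]).IsChain P := by
    intro A B hAB
    refine List.isChain_append.2 ⟨hAB.1.imp hR, by simp, fun a ha b hb => ?_⟩
    rw [hAB.2.2.2.1] at ha
    simp at ha hb
    rw [← ha, ← hb]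
    exact hPx
  have chy : ∀ A B v bl, PathPair R m x y A B → (v :: bl).IsChain P → m < v → v < n →
      (B ++ v :: bl).IsChain P := by
    intro A B v bl hAB hc h1 h2
    refine List.isChain_append.2 ⟨hAB.2.1.imp hR, hc, fun a ha b hb => ?_⟩
    rw [hAB.2.2.2.2] at ha
    simp at ha hb
    rw [← ha, ← hb]
    exact hPy v h1 h2
  have chy' : ∀ A B v bl, PathPair R m x y A B → (v :: bl).IsChain P →
      (∀ w ∈ v :: bl, m < w ∧ w < n) → (v :: (bl ++ B.reverse)).IsChain P := by
    intro A B v bl hAB hc h1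
    rw [← List.cons_append]
    refine List.isChain_append.2 ⟨hc, ?_, fun a ha b hb => ?_⟩
    · rw [List.isChain_reverse]
      exact hAB.2.1.imp fun u v huv => sP _ _ (hR _ _ huv)
    · rw [List.head?_reverse, hAB.2.2.2.2] at hb
      simp at hb
      rw [← hb]
      obtain ⟨k1, k2⟩ := h1 a (List.mem_of_mem_getLast? ha)
      exact sP _ _ (hPy a k1 k2)
  have chx' : ∀ A B, PathPair R m x y A B → (m :: A.reverse).IsChain P := by
    intro A B hAB
    have := List.isChain_reverse.2 ((chx A B hAB).imp fun a b => sP a b)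
    simpa using this
  obtain ⟨bl, hb1, hb2, hb3⟩ := hbl (m + 1) (by omega) (by omega)
  have hvn := v.2
  rcases lt_trichotomy v.1 m with hv | hv | hv
  · have key : ∀ u v : Fin n, Linked R m x y u v → Traceable (G ⊔ edge u v) := by
      rintro u v ⟨A, B, hAB⟩
      refine traceable_sup_edge_of_perm hG (A := A ++ [m]) (B := B ++ (m + 1) :: bl)
        (chx _ _ hAB) (chy _ _ _ _ hAB hb1 (by omega) (by omega)) ?_
      refine List.Perm.trans (List.perm_iff_count.2 fun z => ?_) hb3.symm
      have := hAB.2.2.1.count_eq z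
      simp only [List.count_append, List.count_cons, List.count_nil] at this ⊢
      omega
    rcases hw.pair u (by omega) v hv (by omega)
      (fun hr => hadj ((h.base _ _ (by omega) hv).2 hr)) with hl | hl
    · exact key u v hl
    · rw [edge_comm]
      exact key v u hl
  · obtain ⟨w, hwm, A, B, hAB⟩ := hw.left u (by omega) fun e => hadj ((h.left v u hv).2 e).symm
    rw [edge_comm]
    refine traceable_sup_edge_of_perm hG (A := (w :: A).reverse) (B := B ++ (m + 1) :: bl)
        (hv ▸ chx' _ _ hAB) (chy _ _ _ _ hAB hb1 (by omega) (by omega)) ?_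
    refine List.Perm.trans (List.perm_iff_count.2 fun z => ?_) hb3.symm
    have := hAB.2.2.1.count_eq z
    simp only [List.count_append, List.count_cons, List.count_reverse, hv] at this ⊢
    omega
  · obtain ⟨bl, hb1, hb2, hb3⟩ := hbl v hv v.2
    rcases lt_trichotomy u.1 m with hu | hu | hu
    · obtain ⟨w, hwm, A, B, hAB⟩ := hw.right u hu fun e =>
        hadj ((h.right v u hv).2 (Or.inl e)).symm
      refine traceable_sup_edge_of_perm hG (A := A ++ [m]) (B := bl ++ (w :: B).reverse)
        (chx _ _ hAB) (chy' _ _ _ _ hAB hb1 hb2) ?_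
      refine List.Perm.trans (List.perm_iff_count.2 fun z => ?_) hb3.symm
      have := hAB.2.2.1.count_eq z
      simp only [List.count_append, List.count_cons, List.count_reverse, List.count_nil] at this ⊢
      omega
    · obtain ⟨w, hwm, hwx⟩ : ∃ w < m, w ≠ x := by
        by_cases hx0 : x = 0
        · exact ⟨1, by omega, by omega⟩
        · exact ⟨0, by omega, by omega⟩
      obtain ⟨z, -, A, B, hAB⟩ := hw.left w hwm hwx
      refine traceable_sup_edge_of_perm hG (A := (z :: A).reverse) (B := bl ++ (w :: B).reverse)
        (hu ▸ chx' _ _ hAB) (chy' _ _ _ _ hAB hb1 hb2) ?_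
      refine List.Perm.trans (List.perm_iff_count.2 fun z => ?_) hb3.symm
      have := hAB.2.2.1.count_eq z
      simp only [List.count_append, List.count_cons, List.count_reverse, hu] at this ⊢
      omega
    · exact absurd ((h.right u v hu).2 (Or.inr ⟨hv, by rintro rfl; omega⟩)) hadj

theorem IsPendant.exists_numbering (h : IsPendant G R m x y) (hn : n = m + 2 ∨ n = m + 3)
    (hx : x < m) (hy : y < m) (hm : 4 ≤ m) (ht : Traceable G) : ∃ q, PathNumbering R m x y q := by
  obtain ⟨l, hl⟩ := ht.exists_hamList
  obtain ⟨pos, hp⟩ := hl.exists_pathOrder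
  have hlen : l.length = n := by
    have := List.toFinset_card_of_nodup hl.2.1
    rw [← this, show l.toFinset = Finset.univ from by ext w; simp [hl.2.2 w]]
    simp
  rw [hlen] at hp
  have hA : IsBlob G {(⟨m, by omega⟩ : Fin n)} ⟨x, by omega⟩ :=
    Or.inl ⟨_, rfl, fun u => by rw [h.left _ _ rfl, Fin.ext_iff]⟩
  obtain ⟨B, hB, hBm, hBc⟩ : ∃ B : Finset (Fin n), IsBlob G B ⟨y, by omega⟩ ∧
      (∀ w, w ∈ B ↔ m < w.1) ∧ B.card = n - m - 1 := by
    rcases hn with rfl | rfl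
    · refine ⟨{⟨m + 1, by omega⟩}, Or.inl ⟨_, rfl, fun u => ?_⟩, fun w => ?_, by simp⟩
      · rw [h.right _ _ (by simp)]
        simp only [Fin.ext_iff, Ne]
        have := u.2
        omega
      · simp only [Finset.mem_singleton, Fin.ext_iff]
        have := w.2
        omega
    · refine ⟨{⟨m + 1, by omega⟩, ⟨m + 2, by omega⟩}, Or.inr ⟨_, _, by simp, rfl, fun u => ?_,
        fun u => ?_⟩, fun w => ?_, ?_⟩
      · rw [h.right _ _ (by simp)]
        simp only [Fin.ext_iff, Ne]
        have := u.2
        omega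
      · rw [h.right _ _ (by simp)]
        simp only [Fin.ext_iff, Ne]
        have := u.2
        omega
      · simp only [Finset.mem_singleton, Finset.mem_insert, Fin.ext_iff]
        have := w.2
        omega
      · rw [Finset.card_pair (by simp)]
        omega
  obtain ⟨pos, hp, he⟩ := hA.exists_ends hB
    (by rw [Finset.disjoint_singleton_left, hBm]; simp) hp (by omega)
  have e1 : n - 1 - B.card = m := by omega
  have hl := he.left
  have hr := he.right
  have hpx := he.pos_left
  have hpy := he.pos_right
  rw [e1] at hpy
  simp only [e1, hBm] at hr
  simp only [Finset.mem_singleton, Finset.card_singleton, Fin.ext_iff] at hl hpx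
  refine ⟨fun u => if hu : u < n then pos ⟨u, hu⟩ else 0, ?_, ?_, ?_, ?_, ?_, ?_, ?_⟩
  · intro u hu
    rw [dif_pos (by omega)]
    have := hl ⟨u, by omega⟩
    dsimp only at this
    omega
  · intro u hu
    rw [dif_pos (by omega)]
    have := hr ⟨u, by omega⟩
    dsimp only at this
    omega
  · intro u hu v hv e
    rw [dif_pos (by omega), dif_pos (by omega)] at e
    simpa using hp.inj e
  · intro i h1 h2
    obtain ⟨v, rfl⟩ := hp.surj i (by omega)
    have := hl v
    have := hr v
    exact ⟨v, by omega, by rw [dif_pos v.2]⟩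
  · intro u hu v hv e
    rw [dif_pos (by omega), dif_pos (by omega)] at e
    exact (h.base _ _ hu hv).1 (hp.adj _ _ e)
  · rw [dif_pos (by omega)]
    exact hpx
  · rw [dif_pos (by omega)]
    exact hpy

theorem IsPendant.maxNontraceable (h : IsPendant G R m x y) (hn : n = m + 2 ∨ n = m + 3)
    (hlt : ∀ u v, R u v → u < m ∧ v < m) (hs : ∀ u v, R u v → R v u) (hxy : R x y)
    (hm : m % 2 = 0) (hm4 : 4 ≤ m) {f : ℕ → ℕ → ℕ}
    (hf : ∀ u v, R u v → v = f u 0 ∨ v = f u 1 ∨ v = f u 2) {k : ℕ} {s t : ℕ → ℕ}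
    (hF : HasFlower R k s t) (hk : k % 2 = 1) (hk3 : 3 ≤ k) (hw : WellLinked R m x y) :
    MaxNontraceable G := by
  obtain ⟨hx, hy⟩ := hlt _ _ hxy
  refine ⟨fun ht => ?_, fun u v huv hadj => ?_⟩
  · obtain ⟨q, hq⟩ := h.exists_numbering hn hx hy hm4 ht
    exact hF.not_colourable hs hk hk3 (pathColour_comm (m := m) (q := q))
      (hq.pathColour_ne hlt hs hxy hm hm4 hf)
  · rcases lt_or_gt_of_ne huv with h' | h'
    · exact h.traceable_of_lt hn hlt hx hy (by omega) hw h' hadj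
    · rw [edge_comm]
      exact h.traceable_of_lt hn hlt hx hy (by omega) hw h' fun e => hadj e.symm
end

section

variable {T m x y n : ℕ}

/-- The adjacency relation on the numbers below `m` with table `T`. -/
def TableAdj (T m u v : ℕ) : Prop := u < m ∧ hAdj T u v = true

instance (T m u v : ℕ) : Decidable (TableAdj T m u v) := inferInstanceAs (Decidable (_ ∧ _))

/-- Checks that the table `T` describes a loopless symmetric relation on the numbers below `m`. -/
def tableCheck (T m : ℕ) : Bool :=
  allBelow m fun u => allBelow 3 fun i =>
    cond (Nat.ble m (nb T u i)) false (cond (Nat.beq (nb T u i) u) false (hAdj T (nb T u i) u))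

theorem hAdj_iff {u v : ℕ} :
    hAdj T u v = true ↔ v = nb T u 0 ∨ v = nb T u 1 ∨ v = nb T u 2 := by
  simp only [hAdj, Bool.cond_true_left, Bool.or_eq_true, Nat.beq_eq]

theorem tableCheck_iff : tableCheck T m = true ↔ ∀ u < m, ∀ i < 3,
    nb T u i < m ∧ nb T u i ≠ u ∧ hAdj T (nb T u i) u = true := by
  simp only [tableCheck, allBelow_iff, Bool.cond_false_left, Bool.and_eq_true, Bool.not_eq_true',
    ← Bool.not_eq_true, Nat.beq_eq, Nat.ble_eq, not_le, Ne]

theorem TableAdj.exists_nb {u v : ℕ} (h : TableAdj T m u v) : ∃ i < 3, v = nb T u i := by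
  rcases hAdj_iff.1 h.2 with h | h | h
  · exact ⟨0, by omega, h⟩
  · exact ⟨1, by omega, h⟩
  · exact ⟨2, by omega, h⟩

theorem tableAdj_nb {u : ℕ} (hu : u < m) : ∀ i < 3, TableAdj T m u (nb T u i) := by
  intro i hi
  refine ⟨hu, hAdj_iff.2 ?_⟩
  interval_cases i <;> simp

theorem TableAdj.symm (h : tableCheck T m = true) {u v : ℕ} (huv : TableAdj T m u v) :
    TableAdj T m v u := by
  obtain ⟨i, hi, rfl⟩ := huv.exists_nb
  obtain ⟨h1, -, h3⟩ := tableCheck_iff.1 h u huv.1 i hi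
  exact ⟨h1, h3⟩

theorem TableAdj.lt (h : tableCheck T m = true) {u v : ℕ} (huv : TableAdj T m u v) :
    u < m ∧ v < m :=
  ⟨huv.1, (huv.symm h).1⟩

theorem TableAdj.ne (h : tableCheck T m = true) {u v : ℕ} (huv : TableAdj T m u v) : u ≠ v := by
  obtain ⟨i, hi, rfl⟩ := huv.exists_nb
  exact (tableCheck_iff.1 h u huv.1 i hi).2.1.symm

/-- The adjacency relation obtained by attaching `m` to `x` and a clique on the numbers above `m`
to `y`. -/
def pendantAdj (T m x y u v : ℕ) : Bool :=
  cond (Nat.ble m u)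
    (cond (Nat.beq u m) (Nat.beq v x)
      (cond (Nat.beq v y) true (cond (Nat.ble v m) false (cond (Nat.beq v u) false true))))
    (cond (Nat.ble m v) (cond (Nat.beq v m) (Nat.beq u x) (Nat.beq u y)) (hAdj T u v))

def pendantGraph (T m x y n : ℕ) : SimpleGraph (Fin n) :=
  SimpleGraph.fromRel fun u v => pendantAdj T m x y u v = true

theorem pendantAdj_iff {u v : ℕ} : pendantAdj T m x y u v = true ↔
    TableAdj T m u v ∧ v < m ∨ u < m ∧ v = m ∧ u = x ∨ u < m ∧ m < v ∧ u = y ∨ u = m ∧ v = x ∨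
      m < u ∧ (v = y ∨ m < v ∧ v ≠ u) := by
  unfold pendantAdj TableAdj
  simp only [Bool.cond_eq_ite, Nat.beq_eq, Nat.ble_eq]
  cases hAdj T u v <;> split_ifs <;> simp <;> omega

theorem pendantGraph_adj (hT : tableCheck T m = true) (hx : x < m) (hy : y < m) {u v : Fin n} :
    (pendantGraph T m x y n).Adj u v ↔ pendantAdj T m x y u v = true := by
  unfold pendantGraph
  rw [SimpleGraph.fromRel_adj, pendantAdj_iff, pendantAdj_iff, Ne, Fin.ext_iff]
  have h1 : TableAdj T m u v → TableAdj T m v u := fun h => h.symm hT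
  have h2 : TableAdj T m v u → TableAdj T m u v := fun h => h.symm hT
  have h3 : TableAdj T m u v → u.1 ≠ v := fun h => h.ne hT
  have h4 : TableAdj T m u v → v.1 < m := fun h => (h.lt hT).2
  generalize TableAdj T m u v = p at *
  generalize TableAdj T m v u = q at *
  by_cases hp : p <;> by_cases hq : q <;> simp [hp, hq] at h1 h2 h3 h4 ⊢ <;> omega

theorem isPendant_pendantGraph (hT : tableCheck T m = true) (hx : x < m) (hy : y < m) :
    IsPendant (pendantGraph T m x y n) (TableAdj T m) m x y := by
  refine ⟨fun u v hu hv => ?_, fun u v hu => ?_, fun u v hu => ?_⟩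
  · rw [pendantGraph_adj hT hx hy, pendantAdj_iff]
    refine ⟨fun h => ?_, fun h => Or.inl ⟨h, hv⟩⟩
    rcases h with h | h | h | h | h
    · exact h.1
    all_goals omega
  · rw [pendantGraph_adj hT hx hy, pendantAdj_iff, hu]
    refine ⟨fun h => ?_, fun h => by simp [h]⟩
    rcases h with h | h | h | h | h
    · exact absurd h.1.1 (lt_irrefl _)
    all_goals omega
  · rw [pendantGraph_adj hT hx hy, pendantAdj_iff, Fin.ne_iff_vne]
    refine ⟨fun h => ?_, fun h => by simp [h, hu]⟩
    rcases h with h | h | h | h | h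
    · exact absurd h.1.1 hu.not_gt
    all_goals omega

/-- The number of `i < n` that satisfy `p`, added to `a`. -/
def countBelow (n a : ℕ) (p : ℕ → Bool) : ℕ :=
  Nat.rec (motive := fun _ => ℕ → ℕ) (fun a => a)
    (fun i ih a => cond (p i) (forceNat (Nat.succ a) ih) (ih a)) n a

theorem countBelow_eq (n a : ℕ) (p : ℕ → Bool) :
    countBelow n a p = a + ∑ i ∈ Finset.range n, if p i = true then 1 else 0 := by
  induction n generalizing a with
  | zero => rfl
  | succ n ih =>
    have e : countBelow (n + 1) a p = cond (p n) (forceNat (Nat.succ a) fun a => countBelow n a p)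
      (countBelow n a p) := rfl
    rw [e, Finset.sum_range_succ, forceNat_eq, ih, ih]
    cases p n <;> simp; omega

/-- The sum of the degrees of the pendant graph with `n` vertices. -/
def degreeSum (T m x y n : ℕ) : ℕ :=
  Nat.rec (motive := fun _ => ℕ → ℕ) (fun a => a)
    (fun u ih a => forceNat (countBelow n a fun v => pendantAdj T m x y u v) ih) n 0

theorem two_mul_card_edgeSet (hT : tableCheck T m = true) (hx : x < m) (hy : y < m) :
    2 * Nat.card (pendantGraph T m x y n).edgeSet = degreeSum T m x y n := by
  classical
  have key : ∀ (k a : ℕ), Nat.rec (motive := fun _ => ℕ → ℕ) (fun a => a)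
      (fun u ih a => forceNat (countBelow n a fun v => pendantAdj T m x y u v) ih) k a =
      a + ∑ u ∈ Finset.range k, ∑ v ∈ Finset.range n,
        if pendantAdj T m x y u v = true then 1 else 0 := by
    intro k
    induction k with
    | zero => intro a; rfl
    | succ k ih =>
      intro a
      dsimp only
      rw [forceNat_eq, ih, countBelow_eq, Finset.sum_range_succ]
      omega
  rw [degreeSum, key, zero_add, Nat.card_eq_fintype_card, ← edgeFinset_card,
    ← sum_degrees_eq_twice_card_edges, ← Fin.sum_univ_eq_sum_range
      (fun u => ∑ v ∈ Finset.range n, if pendantAdj T m x y u v = true then 1 else 0)]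
  refine Finset.sum_congr rfl fun u _ => ?_
  rw [← Fin.sum_univ_eq_sum_range (fun v => if pendantAdj T m x y u v = true then 1 else 0),
    ← card_neighborFinset_eq_degree, neighborFinset_eq_filter, Finset.card_filter]
  exact Finset.sum_congr rfl fun v _ => if_congr (pendantGraph_adj hT hx hy) rfl rfl

/-- The certificate for the pendant graphs with table `T` that can be checked by evaluation. -/
def certificate (T m x y fuel P : ℕ) (A B : List ℕ) : Bool :=
  cond (tableCheck T m)
    (cond (Nat.beq (degreeSum T m x y (m + 2)) (3 * m + 4))
      (cond (Nat.beq (degreeSum T m x y (m + 3)) (3 * m + 8))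
        (coverCheck T m x y fuel P A B) false) false) false

theorem exists_maxNontraceable_of_certificate {fuel P : ℕ} {A B : List ℕ} {k : ℕ} {s t : ℕ → ℕ}
    (hc : certificate T m x y fuel P A B = true) (hAB : PathPair (TableAdj T m) m x y A B)
    (hF : HasFlower (TableAdj T m) k s t) (hk : k % 2 = 1) (hk3 : 3 ≤ k)
    (hxy : TableAdj T m x y) (hm : m % 2 = 0) (hm4 : 4 ≤ m) (hm64 : m ≤ 64)
    (hn : n = m + 2 ∨ n = m + 3) :
    ∃ G : SimpleGraph (Fin n), MaxNontraceable G ∧ Nat.card G.edgeSet = (3 * n - 1) / 2 := by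
  simp only [certificate, Bool.cond_false_right, Bool.and_eq_true, Nat.beq_eq] at hc
  obtain ⟨hT, h2, h3, hc⟩ := hc
  obtain ⟨hx, hy⟩ := hxy.lt hT
  have hs : ∀ u v, TableAdj T m u v → TableAdj T m v u := fun u v h => h.symm hT
  refine ⟨pendantGraph T m x y n, ?_, ?_⟩
  · exact (isPendant_pendantGraph hT hx hy).maxNontraceable hn (fun u v h => h.lt hT) hs hxy hm hm4
      (f := nb T) (fun u v h => hAdj_iff.1 h.2) hF hk hk3
      (wellLinked_of_coverCheck hs (fun u hu => tableAdj_nb hu) hm64 hAB hc)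
  · have e := two_mul_card_edgeSet (n := n) hT hx hy
    rcases hn with rfl | rfl
    · rw [h2] at e
      omega
    · rw [h3] at e
      omega
end

section

variable {n : ℕ}

set_option maxRecDepth 100000
set_option maxHeartbeats 1000000

theorem exists_maxNontraceable_pendant_20 (hn : n = 22 ∨ n = 23) :
    ∃ G : SimpleGraph (Fin n), MaxNontraceable G ∧ Nat.card G.edgeSet = (3 * n - 1) / 2 := by
  have hc : certificate
      82700790287454323631248256361299879326472841875316700251254820538145450945734223717875693467652637918769281
      20 0 1 393
      4746580798175833203341717597821945166886146317882253967157031167952197169642642532179729638838695962075676341754487614621994848274275504434473980746265479240006247749716788089503990851785502771014985828736671964833431421168059781600449745914111069555061468340053256620636897719689723088161672675538871839920756361156167379236678797617241864309349578707969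
      [9, 5, 4, 7, 3, 18, 14, 12, 13, 17, 16, 19, 15, 11, 8, 10, 6, 2, 0]
      [1] = true := by
    decide +kernel
  refine exists_maxNontraceable_of_certificate (k := 5)
    (s := fun i => 4 * i)
    (t := fun i => 4 * i) hc
    ⟨by decide +kernel, by decide +kernel, by decide +kernel, rfl, rfl⟩ ?_ rfl (by omega)
    (by decide +kernel) rfl (by omega) (by omega) hn
  unfold HasFlower nextLeaf
  decide +kernel

theorem exists_maxNontraceable_pendant_28 (hn : n = 30 ∨ n = 31) :
    ∃ G : SimpleGraph (Fin n), MaxNontraceable G ∧ Nat.card G.edgeSet = (3 * n - 1) / 2 := by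
  have hc : certificate
      1948181439989397342543502225907352411596149535682576373316443553222397141199673129960629135039670316376902684314924577161574336396573225708590821552257
      28 0 1 873
      17091369094261009505165647060563572188923539934133133431544064514986746362209151582935083474970858167500820510606599564649257145415334966307422869795256580923277709002660731954732683674111583117335436310734016940506911862198075118541080260102034186580405656164082073316486697256708593807594612552537957309016363825068092268357778708274654754786482453193988676408810928275042083716662891338491780472601527595425139200676047919151570312845041677779251138601804446350628216671110459023029641018245419831856728788777659290271736187967298432191909203475819887376576075449452184359426568609127714478369555682624481486361418852096785364069690041940258019151533617611275574759079537592261386675629922446064820193629887498059783594045826927452929630932872542127516784725994029490606424430448480257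
      [16, 17, 13, 12, 14, 18, 22, 26, 3, 7, 4, 6, 10, 8, 11, 15, 19, 23, 20, 21, 25, 24, 27, 2,
       0]
      [9, 5, 1] = true := by
    decide +kernel
  refine exists_maxNontraceable_of_certificate (k := 7)
    (s := fun i => 4 * i)
    (t := fun i => 4 * i) hc
    ⟨by decide +kernel, by decide +kernel, by decide +kernel, rfl, rfl⟩ ?_ rfl (by omega)
    (by decide +kernel) rfl (by omega) (by omega) hn
  unfold HasFlower nextLeaf
  decide +kernel

theorem exists_maxNontraceable_pendant_36 (hn : n = 38 ∨ n = 39) :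
    ∃ G : SimpleGraph (Fin n), MaxNontraceable G ∧ Nat.card G.edgeSet = (3 * n - 1) / 2 := by
  have hc : certificate
      45762771108016222641243433281306679216321084835028745775104256106530908281171064601160926163811779822718443481551147650510831364856909424059719305234254284562036742375188026698180692511173914753
      36 0 1 1545
      1648245382831280364066559559747966627659324420590564828895752590528230811483308879529195582676673137528007037579861236355656168918543836961975238471618777566686586287698253987580981388071662549148484308332530812693383980679594837872807182809902471349733143113704266537058877439975788438219313794657377500782380921794705122852815848074479877593344776697161360654006184659696540750071609204951464214224619090902359785808686871667351647006722074468719345018274271572236193636998058037141610799148747009827052840502592885680729530752611182112140993855673758567114813537679030584329009086268000371701550329916289052489946494338359836410500173252142981812081509301769548741167002244113716652679096076321628364031593392353681935846048471379568472417095826156780437755642627637062781585789952058410716718623399792472930890720816435958381251507083779182391164174268758562367690115868637784916700701621552700482364059785686382807255283694235223303753818577066973639469886489794659825061812980236092946044418585883337420842875459035816054941765267283962097179961833758232170552318138266349881414668753135541260043471553179139318224390893480972858169467598428665193097528874803826987445842422578498985265987746148557570127069793754612189084196224391157743373361011356794318783964042244723585418669912832609583948984706744724348282949101480137563515156377696887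81406075446192800353030923347855942862749336064
      [35, 2, 0]
      [13, 17, 21, 20, 23, 19, 16, 18, 22, 26, 30, 28, 31, 27, 24, 25, 29, 33, 32, 34, 3, 7, 4, 6,
       10, 14, 12, 15, 11, 8, 9, 5, 1] = true := by
    decide +kernel
  refine exists_maxNontraceable_of_certificate (k := 9)
    (s := fun i => 4 * i)
    (t := fun i => 4 * i) hc
    ⟨by decide +kernel, by decide +kernel, by decide +kernel, rfl, rfl⟩ ?_ rfl (by omega)
    (by decide +kernel) rfl (by omega) (by omega) hn
  unfold HasFlower nextLeaf
  decide +kernel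

theorem exists_maxNontraceable_pendant_38 (hn : n = 40 ∨ n = 41) :
    ∃ G : SimpleGraph (Fin n), MaxNontraceable G ∧ Nat.card G.edgeSet = (3 * n - 1) / 2 := by
  have hc : certificate
      45149204144452671878954919725604128593283614640617095395782357789400224885076207257871157433178183872607302595743319751292095123532638567460376704275725800239645293653206694311652275448975022200606834186497
      38 12 14 1826
      6544964736313152267111973483751887267613910009034476554782066998871523328626997522833560159704291200392969207693157119113355162523980361092062253055510181362469494390020452271387439257208567298046598992057402000798299042995715490479027555926270611476004514957021617127413328520821057439144229615738570938580728728364043144111626584284712573478180916179659848447897746722125840748817376309367851571341816465276413515010233984540279363657110672064648632909013199167565762915635491448840782800720553042554191603061342509615893916405053985710204639762054763620835208171209692741767163165091669045354093122562080635132104647589559238829886434263000585041631559893174390800664451965788083919502546344890890456437545641778445305217807571388531829528235483172675492903614536372308029232537901192498469752486409792972123202883208376419074833694913544223456241177822381349822741597637429997772276743387240438849185338463970356107847032954708686429612677845159277242409774741272086549009793132551809409439936645555372493811664345198660452960916871684154274863181761712795821263579727579793910348827969816329705105888562664177486049442706185366452576706772861907330393697655858217398425242177852211676583985381301508446591133610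0440167023652957231004689290671936514983968427020621699089053634659171107786721759135764939279123599816956928301562725824056675829458411620009371339244234294620655486698182594684020284638086362107688641327930703236024814872982054255724300440589548423989636180014038685468834170706973847027600983197035821827169234542737569730382411166856810873591305922806144480815837927422484802185938358413482269739990581075024531744010306514666112
      [2, 35, 31, 28, 30, 34, 32, 33, 29, 25, 21, 20, 22, 18, 16, 17, 13, 12]
      [26, 24, 27, 23, 19, 15, 11, 8, 9, 5, 1, 0, 36, 37, 3, 7, 4, 6, 10, 14] = true := by
    decide +kernel
  refine exists_maxNontraceable_of_certificate (k := 9)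
    (s := fun i => if i = 0 then 36 else 4 * i)
    (t := fun i => if i = 0 then 37 else 4 * i) hc
    ⟨by decide +kernel, by decide +kernel, by decide +kernel, rfl, rfl⟩ ?_ rfl (by omega)
    (by decide +kernel) rfl (by omega) (by omega) hn
  unfold HasFlower nextLeaf
  decide +kernel

theorem exists_maxNontraceable_pendant_40 (hn : n = 42 ∨ n = 43) :
    ∃ G : SimpleGraph (Fin n), MaxNontraceable G ∧ Nat.card G.edgeSet = (3 * n - 1) / 2 := by
  have hc : certificate
      3296876723458836937803182578150906780554390321996136575590151443406362585092182071173864513824216826796621423792818971257091202064081825317473714844871292728766343704925644983737704714276500514633727841556102639671553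
      40 24 25 1983
      2405345165714285570164658975795240354978903661577901599416319578811464327368146178489427915485407798958074088128326584764161438989612181569384168153914869823775542408095136361820074596710740034783547014360779605542451163660119470325419474901929719916074620686714587321507844243658753973173560635091848197009502189673122751768501594400260647437472452703468203422616011763382750168396202756426322435097699448527969963975322938900201680993122831429390354362030088546259101065294789840824809932156446914110845507236548466598856595800083644437444927004850864332600675994200559516287565719342325638175659676722336497685208145020402688451481134366618897362888829278392876432997261316992347036302866366857087853626737242304235252009384979311420787277387049207940705439448382603064146117433258284307298999243850212501585252515285294989044863684061598648183616571018740767064959502216036483156888271216198556171622794058618780123475349875245437764815936430618141637064481539962038228788651996590023226631793231287913152527902385468216968314797152096103257049009315654091212293311031958658498392848182174246361678790513038622188067425467675429373388990883528926909898334197848932400321134672744379561151106053576074731286691097730094335994508118410204782699281774000930774379758308052978089087290439720636295995891288500991932822919166405049675917888914342808302226814499792270602200772134322004562726440522041143123143278497721954016271314085450205873667970465839402116230316234314507865904799952976999688120614560536810810392140571939424174205476966561768048414018172512390775793010029672428284939404912690827588593756593237436170842452846356612162982855085775932097266371693462103166060036023227429109466901674531063625009032865009165267064752141266590448060914767618229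0487120956375194612866785280
      [10, 8, 11, 15, 19, 23, 27, 31, 35, 32, 33, 1, 5, 9, 13, 12, 14, 18, 38, 39, 16, 17, 21, 20,
       22, 26, 24]
      [0, 37, 36, 2, 6, 4, 7, 3, 34, 30, 28, 29, 25] = true := by
    decide +kernel
  refine exists_maxNontraceable_of_certificate (k := 9)
    (s := fun i => if i = 0 then 36 else if i = 4 then 38 else 4 * i)
    (t := fun i => if i = 0 then 37 else if i = 4 then 39 else 4 * i) hc
    ⟨by decide +kernel, by decide +kernel, by decide +kernel, rfl, rfl⟩ ?_ rfl (by omega)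
    (by decide +kernel) rfl (by omega) (by omega) hn
  unfold HasFlower nextLeaf
  decide +kernel

theorem exists_maxNontraceable_pendant_44 (hn : n = 46 ∨ n = 47) :
    ∃ G : SimpleGraph (Fin n), MaxNontraceable G ∧ Nat.card G.edgeSet = (3 * n - 1) / 2 := by
  have hc : certificate
      1072211897268091780800820422737611678955133307328191840945323606299377337471328164416015655073364426972215368994689115212248021228962647007616292013007009807122681868088170454947824662136071425732117372040001032051487605433893534199459969
      44 0 1 2351
      7927622718046623015976676870938055046889573896157544672911846167855976868724604282842555614909291552148959256719625838147956065364075840396320478862065393895007069421995910996266863740833450604850453406933869514345212359695490580593840948705871257576690581126033175576422285123393814878362502809268428392387031683012034498295625525228568090203951929074992730944044747215446004081692286715104798732981304224660516054491307944293128339503425581756442907675046313251254053518019867186340606494110478580851120714255810437530294306372886757794701734765564842364444503121857055148607655673054222275108488178866291571162848279242380913629563991611503353126485788777867647922659911456294640252982025343315049015885839049284512022046982220939489869761240022622268607795999459949062611806892426819163703937256140452646268011190022988088655783264606778980382571564807087980097652725000825522167075433749368717845459097320160591817653223193028236608266941350807035918628001116253875118060768151293863885668631606967741334461883868218627667440341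2099956530037770258230814289233961664893280827382141896164610705733618119415678802686241909500617505877065654248052752786184302960123825770383510009156880535106488715725417728437203745595031184437164806366397684804850077470264818150632961490405020708850489506301781038045402426032556785161385490267902830434714437297476151906538202555956785093967078902455366581777443898473372425603717376632368148290343386121220422638228965640987757203387843570988709596117517034142706373739406406426107572575590518189458139904397892064444574194349918983834975602521688274870467917066582828458928464340471593086899091479756004867994988681668276671354518140474177741251754230558121963085616765711909258391576795364461842789139392640715626381067176868340846055414323923199809194265118533730864974549627090226678004214848442706466112077849283187674960833182553314399379363980389751443134546786338241552288792302475176844103945389082333237611604153713263447961500226682232504079907576396668233484188027492133496221404769105134330225377475825393240621667682979981155472475914210217736589792993677939899296388097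
      [9, 5, 4, 7, 3, 42, 38, 36, 37, 33, 29, 28, 31, 27, 24, 25, 21, 20, 23, 19, 15, 11, 8, 10,
       6, 2, 0]
      [16, 17, 13, 12, 14, 18, 22, 26, 30, 34, 32, 35, 39, 43, 40, 41, 1] = true := by
    decide +kernel
  refine exists_maxNontraceable_of_certificate (k := 11)
    (s := fun i => 4 * i)
    (t := fun i => 4 * i) hc
    ⟨by decide +kernel, by decide +kernel, by decide +kernel, rfl, rfl⟩ ?_ rfl (by omega)
    (by decide +kernel) rfl (by omega) (by omega) hn
  unfold HasFlower nextLeaf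
  decide +kernel

theorem exists_maxNontraceable_pendant_46 (hn : n = 48 ∨ n = 49) :
    ∃ G : SimpleGraph (Fin n), MaxNontraceable G ∧ Nat.card G.edgeSet = (3 * n - 1) / 2 := by
  have hc : certificate
      1230603187910866544313918886245130793945513941196914505498602738849841828469919323315604471291234910164983170925376219816300397227187123359881402137267583480248288980300764387620523717889975670661382953582976147445077720656639510232000993321524845313
      46 12 14 2964
      3832459633358842107481696999336882917737994850342895691571263697094354698650918110585881442939383649697109915705000839592837018838476213347897199585693344504088261193358427457214402563803525764471570355282133394277006257556145146621831973453911395654796438300019320881563383879836327635949644992087299207793061521746284668338704153746228416828454716375858016047992437929053770342900324078670745264950402811340343478355641431020417203671511393557508007811694374330166664640371456822307206181230088419201461173865325177113766264778473709124231041212753897127262162435929092753262979701102850542529957253848642536727077384121442169162427427818219031307795687076754193031985659350119442694230307511528317743297496080056431679581974999148992121852244756387256965353758910724382203475293961930873460426709476338801388626375748770830492321677378828943532272720256590052340721829291353805072482795749590106453236425843788204262219042646934937088350497846241757784676242912043277485084712099266126186907378389601225923773683065586334664501063975229360359236103949949134792763199287076948500415593628814792159288697253873360789871859950410976493403660681547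225277026418955666172037109139945096346987554992054246685979195603784010462118220586069612613470089447910122433949936023536331267403311486793156183193680038726015024736855785324584037714224215623896622064154608079041288050601937694920875719766622225667300108639806937478564253618342890155721248537339206525296864317689171488166148029047254250039201775395800307391941122962516391490316410350956091630213587717721169490148350891426497925585203655361673122572518951385285923558603041012057819293465337372612054157324498017321139363688711626118186856256972023052661627852287132056799925075940582016597659425218343395561588470201032188675441039873384254184606974120749353527995662869796608032384542876037006075371064548625385728516822358051786802211213554678212002076605944623330188350009553071664013499067289756197360997139664751370007226823185671823452715854099814435410645388979479736242222628520464000916539381618104888673061375730012206257429126436653506514547992892572207436562321090063087971900023532366887710814968810433079981977984712631690974407438565630131594264415835615447243723112543544872408233249201427439738203202415928041511552507514100082434400251273948444229916509818416793014273542245153576077984151054408067016387499545739850269745128526061275885930441512650280345833040009438020935009173133839190193607356863243101643061692000084657518358968878364634867590947206678985647773434745082614354276078623036936016288099682924698422364876413343629589733117598830299218022362939401194471040246875880346513354972473622657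
      [5, 1, 41, 40, 42, 3, 45, 0, 44, 2, 43, 39, 35, 32, 34, 38, 36, 37, 33, 29, 25, 24, 27, 31,
       28, 30, 26, 22, 20, 23, 19, 15, 11, 7, 4, 6, 10, 8, 9, 13, 12]
      [21, 17, 16, 18, 14] = true := by
    decide +kernel
  refine exists_maxNontraceable_of_certificate (k := 11)
    (s := fun i => if i = 0 then 44 else 4 * i)
    (t := fun i => if i = 0 then 45 else 4 * i) hc
    ⟨by decide +kernel, by decide +kernel, by decide +kernel, rfl, rfl⟩ ?_ rfl (by omega)
    (by decide +kernel) rfl (by omega) (by omega) hn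
  unfold HasFlower nextLeaf
  decide +kernel

theorem exists_maxNontraceable_pendant_48 (hn : n = 50 ∨ n = 51) :
    ∃ G : SimpleGraph (Fin n), MaxNontraceable G ∧ Nat.card G.edgeSet = (3 * n - 1) / 2 := by
  have hc : certificate
      88898260878913024273707524413488531022929749168307958995818028517051921134972311342971172243939466377810408271100330646965348261738609377271588279600360184956110630661105398657973359536817287767430197510623768608921185930250210969998711896885588288484789115649
      48 24 25 3072
      1470619086405665064329756676219272168007989597776830628162330455425311768511807952422746463228887480079676010499008610995597333139216417185520562346490665864422375558503485573089701031304200251476279454215636516233057341506739071476972544170565970327546657810909229719542164743550682982861351266499431558553311950884726950934170403649063719969324312011036513714862692060765544245015712371338543407139848217247736957613610780302313949613885770705026608383098196959435843389733189673447894075359741839098372474289562084368911900540306844752968689599086945667544256978362028821134272316757410348656591344751686859081456196369063829332879455992826077461715250877265094797670682031880066721158016029604746164316505294602761210477743201951456159156225145900510163686087785831786790838974930822240690640064791556307667007897229019819772284570743241762281594452535319382481116468511372769231250078975746618616338041380532453887103643011214031624485886461919168975982839710148274602635790842735475641075064914125278318137511014556395887348629920337488906924726401439388336110275310421870891057998037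07781543375721058206415664091731104181645490426075554872464090498150444495818432202205377423210062504994364132202808753871770473270169410227583401332146059904493994127620120335907514223861222426958989559366711588872776618145775054265544195323555437476504196455556595598848375889658384661753639883632252879960438207167815579560583894361693083761749048078375509923743425256518541624327004598708580168537561375363028844635790224696827391596255763467640895044396325039558591810839431557246738027935208086413509624388802556174552323273902487097692554896143638502030349625840245086792109172345481200119949184480914482723837116292972004446364435563911188452815686661811411157139337058828571304535207724160237086664063179965496621334525535533095422637069137185180114127730141869243724689289709719977300335241368379650713808784843754768377503434693910313043247993863431861521039226590329222034214638375521041396810873147091423283963617856039805781537601611558890360507432886704293813569807214431467944185803618372111638113813911704035784701052031366712859250406544494104001164863823735893225908115699333945682353339760140136082855562863074684133077701618303454915189930142822474665276624037681008149781674019604755299532136108609382915506185867434092971214629185620401571032751941063130170061930295208904173871773270313790341642947612034431149400959090705300069130169905451445042280326223378448562963131892452320590196397319374534371898983820886372661853748628389175441876909044639359539474147637497102024723300380930111213447181697830576142135955225480032489757858364346474264231531005434042941258675009786782503321538469191027088091280418370372261347696521291206064164176209208125873917432008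
      [0, 45, 44, 2, 43, 39, 35, 32, 34, 38, 36, 37, 33, 29, 28, 31, 27, 24]
      [30, 26, 22, 20, 23, 19, 15, 11, 7, 3, 42, 40, 41, 1, 5, 4, 6, 10, 8, 9, 13, 12, 14, 18, 46,
       47, 16, 17, 21, 25] = true := by
    decide +kernel
  refine exists_maxNontraceable_of_certificate (k := 11)
    (s := fun i => if i = 0 then 44 else if i = 4 then 46 else 4 * i)
    (t := fun i => if i = 0 then 45 else if i = 4 then 47 else 4 * i) hc
    ⟨by decide +kernel, by decide +kernel, by decide +kernel, rfl, rfl⟩ ?_ rfl (by omega)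
    (by decide +kernel) rfl (by omega) (by omega) hn
  unfold HasFlower nextLeaf
  decide +kernel

end

theorem ceil_three_mul_sub_two_div_two {n : ℕ} (hn : 1 ≤ n) :
    ⌈(3 * (n : ℚ) - 2) / 2⌉ = (((3 * n - 1) / 2 : ℕ) : ℤ) := by
  rw [Int.ceil_eq_iff]
  obtain h | h : 2 * ((3 * n - 1) / 2) + 1 = 3 * n ∨ 2 * ((3 * n - 1) / 2) + 2 = 3 * n := by omega
  all_goals
    generalize (3 * n - 1) / 2 = k at h
    have h' : (_ : ℚ) = _ := congrArg Nat.cast h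
    push_cast at h' ⊢
    constructor <;> linarith

/-- For every n in I = {22,23,30,31,38,39,40,41,42,43,46,47,48,49,50,51} the
minimum size of a MNT graph of order n is ⌈(3n − 2)/2⌉. -/
theorem stmt_14 (n : ℕ)
    (hn : n ∈ ({22, 23, 30, 31, 38, 39, 40, 41, 42, 43, 46, 47, 48, 49, 50, 51} :
      Finset ℕ)) :
    (∀ G : SimpleGraph (Fin n), MaxNontraceable G →
      ⌈(3 * (n : ℚ) - 2) / 2⌉ ≤ (Nat.card G.edgeSet : ℤ)) ∧
    (∃ G : SimpleGraph (Fin n), MaxNontraceable G ∧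
      (Nat.card G.edgeSet : ℤ) = ⌈(3 * (n : ℚ) - 2) / 2⌉) := by
  refine ⟨fun G hG => ?_, ?_⟩
  · classical
    have h22 : 22 ≤ n := by
      simp only [Finset.mem_insert, Finset.mem_singleton] at hn
      omega
    have h := hG.three_mul_le (by simpa using h22)
    rw [Fintype.card_fin] at h
    have h' : 3 * (n : ℚ) - 2 ≤ 2 * (Nat.card G.edgeSet : ℚ) := by exact_mod_cast h
    rw [Int.ceil_le]
    push_cast
    linarith
  · suffices h : ∃ G : SimpleGraph (Fin n),
        MaxNontraceable G ∧ Nat.card G.edgeSet = (3 * n - 1) / 2 by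
      obtain ⟨G, hG, hc⟩ := h
      refine ⟨G, hG, ?_⟩
      rw [ceil_three_mul_sub_two_div_two (Nat.one_le_iff_ne_zero.2 (by rintro rfl; simp at hn)), hc]
    simp only [Finset.mem_insert, Finset.mem_singleton] at hn
    obtain h | h | h | h | h | h | h | h :
        (n = 22 ∨ n = 23) ∨ (n = 30 ∨ n = 31) ∨ (n = 38 ∨ n = 39) ∨ (n = 40 ∨ n = 41) ∨
          (n = 42 ∨ n = 43) ∨ (n = 46 ∨ n = 47) ∨ (n = 48 ∨ n = 49) ∨ (n = 50 ∨ n = 51) := by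
      omega
    · exact exists_maxNontraceable_pendant_20 h
    · exact exists_maxNontraceable_pendant_28 h
    · exact exists_maxNontraceable_pendant_36 h
    · exact exists_maxNontraceable_pendant_38 h
    · exact exists_maxNontraceable_pendant_40 h
    · exact exists_maxNontraceable_pendant_44 h
    · exact exists_maxNontraceable_pendant_46 h
    · exact exists_maxNontraceable_pendant_48 h
end

section
/- For n = 2, 3, 4, 5, 6, 7, the minimum number of edges of a maximal nontraceable graph of order n equals 0, 1, 2, 4, 6, 8 respectively; that is, for each such n every maximal nontraceable graph of order n has at least that many edges, and there exists a maximal nontraceable graph of order n with exactly that many edges. -/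
open SimpleGraph

/-- A Hamiltonian path, described by the sequence of its vertices. -/
def IsHamiltonianSeq {V : Type*} (G : SimpleGraph V) (k : ℕ) (f : ℕ → V) : Prop :=
  (∀ i ≤ k, ∀ j ≤ k, f i = f j → i = j) ∧ (∀ i < k, G.Adj (f i) (f (i + 1))) ∧
    ∀ w, ∃ i ≤ k, f i = w

theorem traceable_iff_exists_isHamiltonianSeq {V : Type*} {G : SimpleGraph V} :
    Traceable G ↔ ∃ k f, IsHamiltonianSeq G k f := by
  constructor
  · rintro ⟨u, v, p, hp, hsupp⟩
    refine ⟨p.length, p.getVert, fun i hi j hj h => hp.getVert_injOn hi hj h,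
      fun i hi => p.adj_getVert_succ hi, fun w => ?_⟩
    obtain ⟨i, hi, hle⟩ := Walk.mem_support_iff_exists_getVert.1 (hsupp w)
    exact ⟨i, hle, hi⟩
  · rintro ⟨k, f, hinj, hadj, hsurj⟩
    have key : ∀ m ≤ k, ∃ p : G.Walk (f m) (f 0),
        p.support.Nodup ∧ ∀ w, w ∈ p.support ↔ ∃ i ≤ m, f i = w := by
      intro m
      induction m with
      | zero => intro _; exact ⟨.nil, by simp, by simp [eq_comm]⟩
      | succ m ih =>
        intro hm
        obtain ⟨p, hp, hs⟩ := ih (by omega)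
        refine ⟨.cons (hadj m (by omega)).symm p, ?_, fun w => ?_⟩
        · rw [Walk.support_cons, List.nodup_cons]
          refine ⟨fun h => ?_, hp⟩
          obtain ⟨i, hi, h⟩ := (hs _).1 h
          have := hinj i (by omega) (m + 1) hm h
          omega
        · rw [Walk.support_cons, List.mem_cons, hs]
          constructor
          · rintro (rfl | ⟨i, hi, rfl⟩)
            exacts [⟨m + 1, le_rfl, rfl⟩, ⟨i, by omega, rfl⟩]
          · rintro ⟨i, hi, rfl⟩
            rcases Nat.lt_or_ge i (m + 1) with h | h
            · exact .inr ⟨i, by omega, rfl⟩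
            · obtain rfl : i = m + 1 := by omega
              exact .inl rfl
    obtain ⟨p, hp, hs⟩ := key k le_rfl
    exact ⟨_, _, p, (Walk.isPath_def p).2 hp, fun w => (hs w).2 (hsurj w)⟩

theorem IsHamiltonianSeq.reverse {V : Type*} {G : SimpleGraph V} {k : ℕ} {f : ℕ → V}
    (h : IsHamiltonianSeq G k f) : IsHamiltonianSeq G k (fun i => f (k - i)) := by
  obtain ⟨hinj, hadj, hsurj⟩ := h
  refine ⟨fun i hi j hj h => ?_, fun i hi => ?_, fun w => ?_⟩
  · have := hinj _ (by omega) _ (by omega) h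
    omega
  · have := hadj (k - (i + 1)) (by omega)
    rw [show k - (i + 1) + 1 = k - i by omega] at this
    exact this.symm
  · obtain ⟨i, hi, rfl⟩ := hsurj w
    exact ⟨k - i, by omega, by simp only [Nat.sub_sub_self hi]⟩

theorem traceable_of_isChain {V : Type*} [Inhabited V] {G : SimpleGraph V} {l : List V}
    (hchain : l.IsChain G.Adj) (hnodup : l.Nodup) (hmem : ∀ w, w ∈ l) : Traceable G := by
  have hne : 0 < l.length := List.length_pos_of_mem (hmem default)
  refine traceable_iff_exists_isHamiltonianSeq.2
    ⟨l.length - 1, fun i => l.getD i default, fun i hi j hj h => ?_, fun i hi => ?_, fun w => ?_⟩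
  · simp only at h
    rw [List.getD_eq_getElem _ _ (by omega), List.getD_eq_getElem _ _ (by omega)] at h
    exact (hnodup.getElem_inj_iff).1 h
  · simp only
    rw [List.getD_eq_getElem _ _ (by omega), List.getD_eq_getElem _ _ (by omega)]
    exact List.isChain_iff_getElem.1 hchain i (by omega)
  · obtain ⟨i, hi, rfl⟩ := List.mem_iff_getElem.1 (hmem w)
    exact ⟨i, by omega, List.getD_eq_getElem _ _ hi⟩

/-- A traceable graph has no proper nonempty set of vertices without leaving edges. -/
theorem Traceable.mem_of_closed {V : Type*} {G : SimpleGraph V} (h : Traceable G) {s : Set V}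
    (hs : ∀ x y, G.Adj x y → (x ∈ s ↔ y ∈ s)) {x : V} (hx : x ∈ s) (y : V) : y ∈ s := by
  obtain ⟨k, f, -, hadj, hsurj⟩ := traceable_iff_exists_isHamiltonianSeq.1 h
  have key : ∀ m ≤ k, (f m ∈ s ↔ f 0 ∈ s) := by
    intro m
    induction m with
    | zero => simp
    | succ m ih => intro hm; rw [← hs _ _ (hadj m (by omega)), ih (by omega)]
  obtain ⟨i, hi, rfl⟩ := hsurj x
  obtain ⟨j, hj, rfl⟩ := hsurj y
  rwa [key j hj, ← key i hi]

theorem SimpleGraph.Connected.mem_of_closed {V : Type*} {G : SimpleGraph V} (h : G.Connected)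
    {s : Set V} (hs : ∀ x y, G.Adj x y → x ∈ s → y ∈ s) {x : V} (hx : x ∈ s) (y : V) : y ∈ s := by
  obtain ⟨p⟩ := h x y
  induction p with
  | nil => exact hx
  | cons hadj p ih => exact ih (hs _ _ hadj hx)

theorem sup_edge_adj_iff_s18 {V : Type*} {G : SimpleGraph V} {u v : V} (huv : u ≠ v) (x y : V) :
    (G ⊔ SimpleGraph.edge u v).Adj x y ↔ G.Adj x y ∨ (x = u ∧ y = v) ∨ (x = v ∧ y = u) := by
  rw [sup_adj, edge_adj]
  grind

theorem MaxNontraceable.adj_of_closed {V : Type*} {G : SimpleGraph V} (h : MaxNontraceable G)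
    {s : Set V} (hs : ∀ x y, G.Adj x y → (x ∈ s ↔ y ∈ s)) {z : V} (hz : z ∉ s)
    {u v : V} (hu : u ∈ s) (hv : v ∈ s) (huv : u ≠ v) : G.Adj u v := by
  by_contra hadj
  refine hz ((h.2 u v huv hadj).mem_of_closed (fun x y hxy => ?_) hu z)
  rcases (sup_edge_adj_iff_s18 huv x y).1 hxy with h | ⟨rfl, rfl⟩ | ⟨rfl, rfl⟩
  · exact hs x y h
  · simp [hu, hv]
  · simp [hu, hv]

/-- In a maximal nontraceable graph the two neighbours of a vertex of degree two are adjacent. -/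
theorem MaxNontraceable.adj_of_neighbors {V : Type*} {G : SimpleGraph V} (h : MaxNontraceable G)
    {v a b : V} (hv : ∀ x, G.Adj v x ↔ x = a ∨ x = b) (hab : a ≠ b) : G.Adj a b := by
  by_contra hnadj
  have hva : G.Adj v a := (hv a).2 (.inl rfl)
  have hvb : G.Adj v b := (hv b).2 (.inr rfl)
  have hva' := hva.ne
  have hvb' := hvb.ne
  obtain ⟨k, f, hf⟩ := traceable_iff_exists_isHamiltonianSeq.1 (h.2 a b hab hnadj)
  have first : ∀ f, IsHamiltonianSeq (G ⊔ SimpleGraph.edge a b) k f → f 0 ≠ v := by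
    rintro f ⟨hinj, hadj, hsurj⟩ h0
    simp only [sup_edge_adj_iff_s18 hab] at hadj
    have hk : 2 ≤ k := by
      obtain ⟨i, hi, hia⟩ := hsurj a
      obtain ⟨j, hj, hjb⟩ := hsurj b
      grind
    have h1 : f 1 = a ∨ f 1 = b := by
      have := hadj 0 (by omega)
      rw [h0, hv] at this
      grind
    have h2 : (f 1 = a ∧ f 2 = b) ∨ (f 1 = b ∧ f 2 = a) := by
      by_contra hcon
      refine h.1 (traceable_iff_exists_isHamiltonianSeq.2 ⟨k, f, hinj, fun i hi => ?_, hsurj⟩)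
      rcases hadj i hi with h | h
      · exact h
      · exfalso
        have e1 : f i = f 1 → i = 1 := hinj i (by omega) 1 (by omega)
        have e2 : f (i + 1) = f 1 → i + 1 = 1 := hinj (i + 1) (by omega) 1 (by omega)
        rcases h with ⟨h3, h4⟩ | ⟨h3, h4⟩ <;> rcases h1 with h1 | h1 <;>
          grind
    refine h.1 (traceable_iff_exists_isHamiltonianSeq.2
      ⟨k, fun i => if i = 0 then f 1 else if i = 1 then f 0 else f i, ?_, fun i hi => ?_,
        fun w => ?_⟩)
    · intro i hi j hj hij
      have := hinj (if i = 0 then 1 else if i = 1 then 0 else i) (by grind)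
        (if j = 0 then 1 else if j = 1 then 0 else j) (by grind) (by grind)
      grind
    · rcases i with _ | _ | i
      · rcases h2 with h2 | h2 <;> simp [h0, h2, hva.symm, hvb.symm]
      · rcases h2 with h2 | h2 <;> simp [h0, h2, hva, hvb]
      · have e := hadj (i + 2) hi
        have e1 : f (i + 2) = f 1 → i + 2 = 1 := hinj (i + 2) (by omega) 1 (by omega)
        have e2 : f (i + 2 + 1) = f 1 → i + 2 + 1 = 1 := hinj (i + 2 + 1) (by omega) 1 (by omega)
        simp only [Nat.add_eq_zero_iff, show ¬ i + 2 = 1 by omega, show ¬ i + 2 + 1 = 1 by omega]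
        grind
    · obtain ⟨i, hi, rfl⟩ := hsurj w
      refine ⟨if i = 0 then 1 else if i = 1 then 0 else i, by grind, by grind⟩
  obtain ⟨j, hj, hfj⟩ := hf.2.2 v
  have hj0 : j ≠ 0 := by
    rintro rfl
    exact first f hf hfj
  have hjk : j ≠ k := by
    rintro rfl
    exact first _ hf.reverse (by simpa using hfj)
  obtain ⟨hinj, hadj, hsurj⟩ := hf
  simp only [sup_edge_adj_iff_s18 hab] at hadj
  refine h.1 (traceable_iff_exists_isHamiltonianSeq.2 ⟨k, f, hinj, fun i hi => ?_, hsurj⟩)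
  rcases hadj i hi with h | h
  · exact h
  · exfalso
    have p1 := hadj (j - 1) (by omega)
    have p2 := hadj j (by omega)
    rw [show j - 1 + 1 = j by omega, hfj, G.adj_comm, hv] at p1
    rw [hfj, hv] at p2
    have e1 : f i = f (j - 1) → i = j - 1 := hinj i (by omega) _ (by omega)
    have e2 : f i = f (j + 1) → i = j + 1 := hinj i (by omega) _ (by omega)
    have e3 : f (i + 1) = f (j - 1) → i + 1 = j - 1 := hinj _ (by omega) _ (by omega)
    have e4 : f (i + 1) = f (j + 1) → i + 1 = j + 1 := hinj _ (by omega) _ (by omega)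
    have e5 : f (j - 1) = f (j + 1) → j - 1 = j + 1 := hinj _ (by omega) _ (by omega)
    grind

/-- All but two vertices of a traceable graph have two distinct neighbours. -/
theorem Traceable.card_le_two {V : Type*} {G : SimpleGraph V} (h : Traceable G) {s : Finset V}
    (hs : ∀ x ∈ s, ∀ y z, G.Adj x y → G.Adj x z → y = z) : s.card ≤ 2 := by
  classical
  obtain ⟨k, f, hinj, hadj, hsurj⟩ := traceable_iff_exists_isHamiltonianSeq.1 h
  have hsub : s ⊆ {f 0, f k} := by
    intro x hx
    obtain ⟨i, hi, rfl⟩ := hsurj x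
    by_contra hne
    have hi0 : i ≠ 0 := by rintro rfl; simp at hne
    have hik : i ≠ k := by rintro rfl; simp at hne
    have p1 := hadj (i - 1) (by omega)
    rw [show i - 1 + 1 = i by omega] at p1
    have := hinj _ (by omega) _ (by omega) (hs _ hx _ _ p1.symm (hadj i (by omega)))
    omega
  exact (Finset.card_le_card hsub).trans Finset.card_le_two

theorem two_mul_card_edgeSet_s18 {V : Type*} [Fintype V] (G : SimpleGraph V) [DecidableRel G.Adj] :
    2 * Nat.card G.edgeSet = ∑ v, G.degree v := by
  classical
  rw [G.sum_degrees_eq_twice_card_edges, Nat.card_eq_fintype_card, edgeFinset_card]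

theorem sum_degree_eq_sum_card_filter {V : Type*} [Fintype V] (G : SimpleGraph V)
    [DecidableRel G.Adj] (s : Finset V) :
    ∑ w ∈ s, G.degree w = ∑ v, (s.filter (G.Adj v)).card := by
  simp only [Finset.card_filter, ← card_neighborFinset_eq_degree, neighborFinset_eq_filter]
  rw [Finset.sum_comm]
  simp only [G.adj_comm]

/-- A disconnected maximal nontraceable graph is the disjoint union of two complete graphs. -/
theorem MaxNontraceable.exists_card_of_not_connected {V : Type*} [Fintype V] [Nonempty V]
    {G : SimpleGraph V} (h : MaxNontraceable G) (hG : ¬ G.Connected) :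
    ∃ a b, 1 ≤ a ∧ 1 ≤ b ∧ a + b = Fintype.card V ∧
      2 * Nat.card G.edgeSet = a * (a - 1) + b * (b - 1) := by
  classical
  obtain ⟨u, v, huv⟩ : ∃ u v, ¬ G.Reachable u v := by
    by_contra! hcon
    exact hG ⟨hcon⟩
  have hcl : ∀ x y, G.Adj x y → (G.Reachable u x ↔ G.Reachable u y) := fun x y hxy =>
    ⟨fun h => h.trans hxy.reachable, fun h => h.trans hxy.symm.reachable⟩
  let s : Finset V := {x | G.Reachable u x}
  have hs : ∀ x, x ∈ s ↔ G.Reachable u x := by simp [s]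
  have deg : ∀ t : Finset V, (∀ x y, G.Adj x y → (x ∈ t ↔ y ∈ t)) → (∃ z, z ∉ t) →
      ∀ x ∈ t, G.degree x = t.card - 1 := by
    rintro t ht ⟨z, hz⟩ x hx
    rw [← card_neighborFinset_eq_degree, ← Finset.card_erase_of_mem hx]
    congr 1
    ext y
    simp only [mem_neighborFinset, Finset.mem_erase]
    refine ⟨fun hxy => ⟨hxy.ne', (ht x y hxy).1 hx⟩, fun ⟨hne, hy⟩ => ?_⟩
    exact h.adj_of_closed (s := (t : Set V)) (by simpa using ht) (by simpa using hz)
      (by simpa using hx) (by simpa using hy) hne.symm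
  have hus : u ∈ s := by simp [hs]
  have hvs : v ∉ s := by simpa [hs] using huv
  refine ⟨s.card, sᶜ.card, Finset.card_pos.2 ⟨u, hus⟩,
    Finset.card_pos.2 ⟨v, by simpa using hvs⟩, Finset.card_add_card_compl s, ?_⟩
  rw [two_mul_card_edgeSet_s18, ← Finset.sum_add_sum_compl s,
    Finset.sum_congr rfl (deg s (by simpa only [hs] using hcl) ⟨v, hvs⟩),
    Finset.sum_congr rfl (deg sᶜ (by simpa only [hs, Finset.mem_compl, not_iff_not] using hcl)
      ⟨u, by simpa using hus⟩)]
  simp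

section Connected

variable {V : Type*} [Fintype V] {G : SimpleGraph V} [DecidableRel G.Adj]

theorem exists_mem_of_card_lt (s : Finset V) (h : s.card < Fintype.card V) : ∃ x, x ∉ s := by
  by_contra! hcon
  rw [Finset.eq_univ_iff_forall.2 hcon, Finset.card_univ] at h
  exact h.false

theorem exists_adj_iff_of_degree_eq_two {v : V} (h : G.degree v = 2) :
    ∃ a b, a ≠ b ∧ ∀ x, G.Adj v x ↔ x = a ∨ x = b := by
  classical
  rw [← card_neighborFinset_eq_degree, Finset.card_eq_two] at h
  obtain ⟨a, b, hab, he⟩ := h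
  exact ⟨a, b, hab, fun x => by rw [← mem_neighborFinset, he]; simp⟩

theorem exists_adj_iff_of_degree_eq_one {v : V} (h : G.degree v = 1) :
    ∃ a, ∀ x, G.Adj v x ↔ x = a := by
  rw [← card_neighborFinset_eq_degree, Finset.card_eq_one] at h
  obtain ⟨a, he⟩ := h
  exact ⟨a, fun x => by rw [← mem_neighborFinset, he]; simp⟩

/-- If `a` and `b` are adjacent and both adjacent to `v`, and `a` has degree at most two, then
`b` and `v` are the only neighbours of `a`. -/
theorem eq_or_eq_of_degree_le_two {a b v x : V} (ha : G.degree a ≤ 2) (hab : G.Adj a b)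
    (hav : G.Adj a v) (hbv : b ≠ v) (hx : G.Adj a x) : x = b ∨ x = v := by
  classical
  by_contra! hne
  have : ({b, v, x} : Finset V) ⊆ G.neighborFinset a := by
    intro y
    simp only [Finset.mem_insert, Finset.mem_singleton, mem_neighborFinset]
    rintro (rfl | rfl | rfl) <;> assumption
  have h3 := Finset.card_le_card this
  rw [Finset.card_eq_three.2 ⟨b, v, x, hbv, hne.1.symm, hne.2.symm, rfl⟩,
    card_neighborFinset_eq_degree] at h3
  omega

theorem SimpleGraph.Connected.one_le_degree (hc : G.Connected) (hV : 2 ≤ Fintype.card V) (v : V) :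
    1 ≤ G.degree v := by
  have : Nontrivial V := Fintype.one_lt_card_iff_nontrivial.1 hV
  exact hc.preconnected.degree_pos_of_nontrivial v

theorem MaxNontraceable.exists_adj_three_le_degree (h : MaxNontraceable G) (hc : G.Connected)
    (hV : 4 ≤ Fintype.card V) {v : V} (hv : G.degree v ≤ 2) :
    ∃ w, G.Adj v w ∧ 3 ≤ G.degree w := by
  classical
  by_contra! hcon
  have hpos := hc.one_le_degree (by omega)
  have small : ∀ s : Finset V, s.card ≤ 3 → v ∈ s →
      (∀ x y, G.Adj x y → x ∈ s → y ∈ s) → False := by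
    intro s hs hvs hcl
    obtain ⟨z, hz⟩ := exists_mem_of_card_lt s (by omega)
    exact hz (hc.mem_of_closed (s := (s : Set V)) (by simpa using hcl) (by simpa using hvs) z)
  rcases (by have := hpos v; omega : G.degree v = 1 ∨ G.degree v = 2) with h1 | h2
  · obtain ⟨a, ha⟩ := exists_adj_iff_of_degree_eq_one h1
    have hva := (ha a).2 rfl
    have := hcon a hva
    rcases (by have := hpos a; omega : G.degree a = 1 ∨ G.degree a = 2) with h1 | h2
    · obtain ⟨b, hb⟩ := exists_adj_iff_of_degree_eq_one h1
      obtain rfl := (hb v).1 hva.symm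
      refine small {v, a} (Finset.card_le_two.trans (by norm_num)) (by simp) fun x y hxy hx => ?_
      grind
    · obtain ⟨b, c, hbc, hb⟩ := exists_adj_iff_of_degree_eq_two h2
      have := h.adj_of_neighbors hb hbc
      have hab := (hb b).2 (.inl rfl)
      have hac := (hb c).2 (.inr rfl)
      rcases (hb v).1 hva.symm with rfl | rfl
      · exact hac.ne' ((ha c).1 this)
      · exact hab.ne' ((ha b).1 this.symm)
  · obtain ⟨a, b, hab, hb⟩ := exists_adj_iff_of_degree_eq_two h2
    have hva := (hb a).2 (.inl rfl)
    have hvb := (hb b).2 (.inr rfl)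
    have hadj := h.adj_of_neighbors hb hab
    refine small {v, a, b} Finset.card_le_three (by simp) fun x y hxy hx => ?_
    have ea := hcon a hva
    have eb := hcon b hvb
    simp only [Finset.mem_insert, Finset.mem_singleton] at hx ⊢
    rcases hx with rfl | rfl | rfl
    · exact .inr ((hb y).1 hxy)
    · have := eq_or_eq_of_degree_le_two (by omega) hadj hva.symm hvb.ne' hxy
      tauto
    · have := eq_or_eq_of_degree_le_two (by omega) hadj.symm hvb.symm hva.ne' hxy
      tauto

theorem MaxNontraceable.exists_adj_three_le_degree_of_ne (h : MaxNontraceable G)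
    (hc : G.Connected) (hV : 2 ≤ Fintype.card V) {v v' : V} (hne : v' ≠ v)
    (hv' : 3 ≤ G.degree v') : ∃ w, G.Adj v w ∧ 3 ≤ G.degree w := by
  classical
  by_contra! hcon
  have hpos := hc.one_le_degree hV
  have := hc.mem_of_closed (s := {x | x = v ∨ G.Adj v x}) (fun x y hxy hx => ?_) (.inl rfl) v'
  · rcases this with h1 | h1
    · exact hne h1
    · have := hcon v' h1
      omega
  · rcases hx with rfl | hx
    · exact .inr hxy
    · by_contra hy
      have hyv : y ≠ v ∧ ¬ G.Adj v y := not_or.1 hy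
      have hd := hcon x hx
      rcases (by have := hpos x; omega : G.degree x = 1 ∨ G.degree x = 2) with h1 | h2
      · obtain ⟨a, ha⟩ := exists_adj_iff_of_degree_eq_one h1
        exact hyv.1 (((ha y).1 hxy).trans ((ha v).1 hx.symm).symm)
      · obtain ⟨a, b, hab, hb⟩ := exists_adj_iff_of_degree_eq_two h2
        have := h.adj_of_neighbors hb hab
        rcases (hb y).1 hxy with rfl | rfl <;> rcases (hb v).1 hx.symm with rfl | rfl
        · exact hyv.1 rfl
        · exact hyv.2 this.symm
        · exact hyv.2 this
        · exact hyv.1 rfl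

variable [DecidableEq V]

theorem MaxNontraceable.card_sdiff_le_two (h : MaxNontraceable G) {u v : V} (huv : u ≠ v)
    (hadj : ¬ G.Adj u v) {s : Finset V} (hs : ∀ x ∈ s, G.degree x = 1) :
    (s \ {u, v}).card ≤ 2 := by
  refine (h.2 u v huv hadj).card_le_two fun x hx y z hy hz => ?_
  simp only [Finset.mem_sdiff, Finset.mem_insert, Finset.mem_singleton, not_or] at hx
  rw [sup_edge_adj_iff_s18 huv] at hy hz
  obtain ⟨a, ha⟩ := exists_adj_iff_of_degree_eq_one (hs x hx.1)
  rw [ha] at hy hz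
  grind

theorem MaxNontraceable.card_le_three (h : MaxNontraceable G)
    (hV : 6 ≤ Fintype.card V) {s : Finset V} (hs : ∀ x, x ∈ s ↔ G.degree x = 1) :
    s.card ≤ 3 := by
  by_contra! hcard
  obtain ⟨x, hx⟩ := Finset.card_pos.1 (show 0 < s.card by omega)
  obtain ⟨y, hy⟩ := exists_adj_iff_of_degree_eq_one ((hs x).1 hx)
  have key : ∀ z, z ≠ x → z ≠ y → (s \ {x, z}).card ≤ 2 := fun z hzx hzy =>
    h.card_sdiff_le_two hzx.symm (by rw [hy]; exact hzy) fun x hx => (hs x).1 hx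
  rcases Nat.lt_or_ge 4 s.card with h5 | h4
  · obtain ⟨z, hz⟩ := exists_mem_of_card_lt {x, y} (Finset.card_le_two.trans_lt (by omega))
    simp only [Finset.mem_insert, Finset.mem_singleton, not_or] at hz
    have h1 := key z hz.1 hz.2
    have h2 := Finset.le_card_sdiff {x, z} s
    have h3 : ({x, z} : Finset V).card ≤ 2 := Finset.card_le_two
    omega
  · obtain ⟨z, hz⟩ := exists_mem_of_card_lt (insert y s)
      ((Finset.card_insert_le y s).trans_lt (by omega))
    simp only [Finset.mem_insert, not_or] at hz
    have h1 := key z (by rintro rfl; exact hz.2 hx) hz.1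
    have h2 : s \ {x, z} = s.erase x := by
      ext w
      simp only [Finset.mem_sdiff, Finset.mem_insert, Finset.mem_singleton, Finset.mem_erase]
      grind
    rw [h2, Finset.card_erase_of_mem hx] at h1
    omega

theorem MaxNontraceable.le_card_edgeSet_of_card_eq_three (h : MaxNontraceable G)
    (hc : G.Connected) (hV : 4 ≤ Fintype.card V) {s : Finset V}
    (hs : ∀ x, x ∈ s ↔ G.degree x = 1) (hcard : s.card = 3) :
    6 + (Fintype.card V - 3) * (Fintype.card V - 4) ≤ 2 * Nat.card G.edgeSet := by
  have hclique : ∀ u ∉ s, ∀ v ∉ s, u ≠ v → G.Adj u v := by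
    intro u hu v hv huv
    by_contra hadj
    have h1 := h.card_sdiff_le_two huv hadj fun x hx => (hs x).1 hx
    have h2 : s \ {u, v} = s := by
      ext w
      simp only [Finset.mem_sdiff, Finset.mem_insert, Finset.mem_singleton]
      grind
    rw [h2] at h1
    omega
  rw [two_mul_card_edgeSet_s18, ← Finset.sum_add_sum_compl s, sum_degree_eq_sum_card_filter G sᶜ,
    ← Finset.sum_add_sum_compl s]
  have h1 : 3 ≤ ∑ v ∈ s, G.degree v := by
    have := Finset.card_nsmul_le_sum s (fun v => G.degree v) 1 fun x hx => ((hs x).1 hx).ge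
    simpa [hcard] using this
  have h2 : 3 ≤ ∑ v ∈ s, (sᶜ.filter (G.Adj v)).card := by
    have := Finset.card_nsmul_le_sum s (fun v => (sᶜ.filter (G.Adj v)).card) 1 fun x hx => by
      obtain ⟨w, hw, hd⟩ := h.exists_adj_three_le_degree hc hV
        (show G.degree x ≤ 2 by rw [(hs x).1 hx]; norm_num)
      refine Finset.card_pos.2 ⟨w, ?_⟩
      simp only [Finset.mem_filter, Finset.mem_compl, hs, hw, and_true]
      omega
    simpa [hcard] using this
  have hcompl : sᶜ.card = Fintype.card V - 3 := by rw [Finset.card_compl, hcard]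
  have h3 : (Fintype.card V - 3) * (Fintype.card V - 4) ≤
      ∑ v ∈ sᶜ, (sᶜ.filter (G.Adj v)).card := by
    have := Finset.card_nsmul_le_sum sᶜ (fun v => (sᶜ.filter (G.Adj v)).card)
      (Fintype.card V - 4) fun x hx => by
        have hsub : sᶜ.erase x ⊆ sᶜ.filter (G.Adj x) := fun y hy => by
          simp only [Finset.mem_erase, Finset.mem_compl, Finset.mem_filter] at hx hy ⊢
          exact ⟨hy.2, hclique x hx y hy.2 hy.1.symm⟩
        have := Finset.card_le_card hsub
        rw [Finset.card_erase_of_mem hx, hcompl] at this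
        omega
    simpa [hcompl] using this
  omega

theorem MaxNontraceable.le_card_edgeSet_of_card_le_two (h : MaxNontraceable G)
    (hc : G.Connected) (hV : 5 ≤ Fintype.card V) {s : Finset V}
    (hs : ∀ x, x ∈ s ↔ G.degree x = 1) (hcard : s.card ≤ 2) :
    7 * Fintype.card V ≤ 6 * Nat.card G.edgeSet + 6 := by
  set B : Finset V := {v | 3 ≤ G.degree v} with hB
  have hpos := hc.one_le_degree (by omega)
  have hsum := two_mul_card_edgeSet_s18 G
  rw [← Finset.sum_add_sum_compl B] at hsum
  have hBc : B.card + Bᶜ.card = Fintype.card V := Finset.card_add_card_compl B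
  have h1 : 2 * Bᶜ.card ≤ ∑ v ∈ Bᶜ, G.degree v + s.card := by
    have hle : ∑ v ∈ Bᶜ, 2 ≤ ∑ v ∈ Bᶜ, (G.degree v + if v ∈ s then 1 else 0) := by
      refine Finset.sum_le_sum fun v _ => ?_
      have := hpos v
      have := hs v
      split_ifs <;> grind
    rw [Finset.sum_add_distrib, ← Finset.card_filter, Finset.sum_const, smul_eq_mul] at hle
    have : (Bᶜ.filter (· ∈ s)).card ≤ s.card :=
      Finset.card_le_card fun v hv => (Finset.mem_filter.1 hv).2
    omega
  have h2 : 3 * B.card ≤ ∑ v ∈ B, G.degree v := by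
    have := Finset.card_nsmul_le_sum B (fun v => G.degree v) 3 fun x hx => by simpa [hB] using hx
    rwa [smul_eq_mul, mul_comm] at this
  have hnbr : ∀ t : Finset V, (∀ v ∈ t, ∃ w, G.Adj v w ∧ 3 ≤ G.degree w) →
      t.card ≤ ∑ v ∈ B, G.degree v := by
    intro t ht
    rw [sum_degree_eq_sum_card_filter]
    refine le_trans ?_ (Finset.sum_le_sum_of_subset (Finset.subset_univ t))
    rw [Finset.card_eq_sum_ones]
    refine Finset.sum_le_sum fun v hv => Finset.card_pos.2 ?_
    obtain ⟨w, hw, hd⟩ := ht v hv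
    exact ⟨w, by simp [hB, hw, hd]⟩
  have h3 : Bᶜ.card ≤ ∑ v ∈ B, G.degree v := hnbr _ fun v hv => by
    simp only [hB, Finset.mem_compl, Finset.mem_filter, Finset.mem_univ, true_and, not_le] at hv
    exact h.exists_adj_three_le_degree hc (by omega) (by omega)
  rcases Nat.lt_or_ge 1 B.card with hb | hb
  · have h4 : Fintype.card V ≤ ∑ v ∈ B, G.degree v := hnbr Finset.univ fun v _ => by
      obtain ⟨v', hv', hne⟩ := Finset.exists_mem_ne hb v
      exact h.exists_adj_three_le_degree_of_ne hc (by omega) hne (by simpa [hB] using hv')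
    omega
  · have h5 : B.card = 0 → ∑ v ∈ B, G.degree v = 0 := fun h0 => by
      rw [Finset.card_eq_zero.1 h0, Finset.sum_empty]
    omega

end Connected

theorem MaxNontraceable.le_card_edgeSet {V : Type*} [Fintype V] {G : SimpleGraph V}
    (h : MaxNontraceable G) (hV : 6 ≤ Fintype.card V) :
    7 * Fintype.card V ≤ 6 * Nat.card G.edgeSet + 6 := by
  classical
  have : Nonempty V := Fintype.card_pos_iff.1 (by omega)
  by_cases hc : G.Connected
  · let s : Finset V := {v | G.degree v = 1}
    have hs : ∀ x, x ∈ s ↔ G.degree x = 1 := by simp [s]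
    rcases (h.card_le_three hV hs).lt_or_eq with hlt | heq
    · exact h.le_card_edgeSet_of_card_le_two hc (by omega) hs (by omega)
    · have h3 := h.le_card_edgeSet_of_card_eq_three hc (by omega) hs heq
      obtain ⟨m, hm⟩ := Nat.exists_eq_add_of_le hV
      rw [hm] at h3 ⊢
      rw [show 6 + m - 3 = m + 3 by omega, show 6 + m - 4 = m + 2 by omega] at h3
      nlinarith
  · obtain ⟨a, b, ha, hb, hab, he⟩ := h.exists_card_of_not_connected hc
    obtain ⟨a, rfl⟩ := Nat.exists_eq_add_of_le' ha
    obtain ⟨b, rfl⟩ := Nat.exists_eq_add_of_le' hb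
    rw [← hab] at hV ⊢
    simp only [Nat.add_sub_cancel] at he
    zify at *
    nlinarith [sq_nonneg ((a : ℤ) - b), mul_self_nonneg ((a : ℤ) + b - 4)]

theorem MaxNontraceable.le_card_edgeSet_add_one {V : Type*} [Fintype V] [Nonempty V]
    {G : SimpleGraph V} (h : MaxNontraceable G) :
    Fintype.card V ≤ Nat.card G.edgeSet + 1 ∨ ∃ a b, 1 ≤ a ∧ 1 ≤ b ∧ a + b = Fintype.card V ∧
      2 * Nat.card G.edgeSet = a * (a - 1) + b * (b - 1) := by
  by_cases hc : G.Connected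
  · left
    simpa using hc.card_vert_le_card_edgeSet_add_one
  · exact .inr (h.exists_card_of_not_connected hc)

/-- The disjoint union of a complete graph on the first `a` vertices and one on the others. -/
def twoCliques (n a : ℕ) : SimpleGraph (Fin n) where
  Adj u v := u ≠ v ∧ (u.val < a ↔ v.val < a)
  symm.symm _ _ h := ⟨h.1.symm, h.2.symm⟩
  loopless := ⟨fun _ h => h.1 rfl⟩

instance (n a : ℕ) : DecidableRel (twoCliques n a).Adj := fun u v =>
  inferInstanceAs (Decidable (u ≠ v ∧ (u.val < a ↔ v.val < a)))

theorem maxNontraceable_twoCliques {n a : ℕ} (ha : 0 < a) (han : a < n) :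
    MaxNontraceable (twoCliques n a) := by
  have : NeZero n := ⟨by omega⟩
  have main : ∀ u v : Fin n, u.val < a → a ≤ v.val →
      Traceable (twoCliques n a ⊔ SimpleGraph.edge u v) := by
    intro u v hu hv
    have huv : u ≠ v := by rintro rfl; omega
    have hn : (List.finRange n).Nodup := List.nodup_finRange n
    have chain : ∀ l : List (Fin n), l.Nodup → (∀ x ∈ l, ∀ y ∈ l, (x.val < a ↔ y.val < a)) →
        l.IsChain (twoCliques n a ⊔ SimpleGraph.edge u v).Adj := fun l hl h =>
      List.Pairwise.isChain (List.Pairwise.imp_of_mem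
        (fun {x y} hx hy hxy => .inl ⟨hxy, h x hx y hy⟩) hl)
    let l₁ := (List.finRange n).filter fun x => x.val < a ∧ x ≠ u
    let l₂ := (List.finRange n).filter fun x => a ≤ x.val ∧ x ≠ v
    have h₁ : ∀ x, x ∈ l₁ ↔ x.val < a ∧ x ≠ u := by simp [l₁]
    have h₂ : ∀ x, x ∈ l₂ ↔ a ≤ x.val ∧ x ≠ v := by simp [l₂]
    have n₁ : (l₁ ++ [u]).Nodup := by
      rw [List.nodup_append]
      refine ⟨hn.filter _, by simp, ?_⟩
      simp only [h₁, List.mem_singleton]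
      grind
    have n₂ : (v :: l₂).Nodup := List.nodup_cons.2 ⟨by simp [h₂], hn.filter _⟩
    refine traceable_of_isChain (l := (l₁ ++ [u]) ++ (v :: l₂)) ?_ ?_ fun w => ?_
    · refine List.IsChain.append (chain _ n₁ ?_) (chain _ n₂ ?_) ?_
      · simp only [List.mem_append, List.mem_singleton, h₁]
        grind
      · simp only [List.mem_cons, h₂]
        grind
      · simp [sup_edge_adj_iff_s18 huv]
    · rw [List.nodup_append]
      refine ⟨n₁, n₂, ?_⟩
      simp only [List.mem_append, List.mem_cons, h₁, h₂]
      rintro x hx _ hy rfl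
      rcases hx with hx | hx | hx <;> rcases hy with hy | hy <;> grind
    · simp only [List.mem_append, List.mem_cons, h₁, h₂]
      grind
  refine ⟨fun h => ?_, fun u v huv hadj => ?_⟩
  · have := h.mem_of_closed (s := {x | x.val < a}) (fun x y hxy => hxy.2)
      (x := ⟨0, by omega⟩) ha ⟨a, han⟩
    simp at this
  · have hadj : ¬ (u.val < a ↔ v.val < a) := fun h => hadj ⟨huv, h⟩
    rcases Nat.lt_or_ge u.val a with h | h
    · exact main u v h (by omega)
    · rw [edge_comm]
      exact main v u (by omega) h

/-- Two triangles `{0, 1, 2}` and `{2, 5, 6}` with pendant vertices `3` and `4` attached to the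
vertices `0` and `1` respectively. -/
def pendantTriangles : SimpleGraph (Fin 7) :=
  SimpleGraph.fromRel fun u v => (u, v) ∈
    [((0 : Fin 7), (1 : Fin 7)), (0, 2), (1, 2), (0, 3), (1, 4), (2, 5), (2, 6), (5, 6)]

instance : DecidableRel pendantTriangles.Adj := by
  unfold pendantTriangles
  infer_instance

theorem not_traceable_pendantTriangles : ¬ Traceable pendantTriangles := by
  intro h
  obtain ⟨k, f, hinj, hadj, hsurj⟩ := traceable_iff_exists_isHamiltonianSeq.1 h
  have h3 : ∀ x, pendantTriangles.Adj 3 x → x = 0 := by decide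
  have h4 : ∀ x, pendantTriangles.Adj 4 x → x = 1 := by decide
  have h5 : ∀ x, pendantTriangles.Adj 5 x → x = 2 ∨ x = 6 := by decide
  have h6 : ∀ x, pendantTriangles.Adj 6 x → x = 2 ∨ x = 5 := by decide
  have inner : ∀ i, 0 < i → i < k → pendantTriangles.Adj (f i) (f (i - 1)) ∧
      pendantTriangles.Adj (f i) (f (i + 1)) ∧ f (i - 1) ≠ f (i + 1) := by
    intro i h0 hk
    have := hadj (i - 1) (by omega)
    rw [show i - 1 + 1 = i by omega] at this
    refine ⟨this.symm, hadj i hk, fun he => ?_⟩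
    have := hinj _ (by omega) _ (by omega) he
    omega
  obtain ⟨p3, hp3, e3⟩ := hsurj 3
  obtain ⟨p4, hp4, e4⟩ := hsurj 4
  obtain ⟨p5, hp5, e5⟩ := hsurj 5
  obtain ⟨p6, hp6, e6⟩ := hsurj 6
  have end3 : p3 = 0 ∨ p3 = k := by
    by_contra! hne
    obtain ⟨a, b, c⟩ := inner p3 (by omega) (by omega)
    rw [e3] at a b
    exact c ((h3 _ a).trans (h3 _ b).symm)
  have end4 : p4 = 0 ∨ p4 = k := by
    by_contra! hne
    obtain ⟨a, b, c⟩ := inner p4 (by omega) (by omega)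
    rw [e4] at a b
    exact c ((h4 _ a).trans (h4 _ b).symm)
  have n34 : p3 ≠ p4 := by rintro rfl; simp [e3] at e4
  have n35 : p3 ≠ p5 := by rintro rfl; simp [e3] at e5
  have n36 : p3 ≠ p6 := by rintro rfl; simp [e3] at e6
  have n45 : p4 ≠ p5 := by rintro rfl; simp [e4] at e5
  have n46 : p4 ≠ p6 := by rintro rfl; simp [e4] at e6
  obtain ⟨a5, b5, c5⟩ := inner p5 (by omega) (by omega)
  obtain ⟨a6, b6, c6⟩ := inner p6 (by omega) (by omega)
  rw [e5] at a5 b5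
  rw [e6] at a6 b6
  have i1 := hinj (p5 - 1) (by omega) p6 hp6
  have i2 := hinj (p5 + 1) (by omega) p6 hp6
  have i3 := hinj (p5 - 1) (by omega) (p6 + 1) (by omega)
  have i4 := hinj (p5 + 1) (by omega) (p6 - 1) (by omega)
  have i5 := hinj (p5 - 1) (by omega) (p6 - 1) (by omega)
  have i6 := hinj (p5 + 1) (by omega) (p6 + 1) (by omega)
  have := h5 _ a5
  have := h5 _ b5
  have := h6 _ a6
  have := h6 _ b6
  grind

theorem maxNontraceable_pendantTriangles : MaxNontraceable pendantTriangles := by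
  refine ⟨not_traceable_pendantTriangles, fun u v huv hadj => ?_⟩
  have key : ∀ u v : Fin 7, u ≠ v → ¬ pendantTriangles.Adj u v →
      ∃ l ∈ ([[3, 0, 1, 4, 2, 5, 6], [3, 0, 1, 4, 5, 6, 2], [3, 0, 1, 4, 6, 5, 2],
        [4, 1, 0, 3, 2, 5, 6], [4, 1, 0, 3, 5, 6, 2], [4, 1, 0, 3, 6, 5, 2],
        [6, 5, 2, 1, 4, 3, 0], [3, 0, 4, 1, 2, 5, 6], [4, 1, 3, 0, 2, 5, 6],
        [3, 0, 2, 5, 6, 1, 4], [3, 0, 2, 6, 5, 1, 4], [4, 1, 2, 5, 6, 0, 3],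
        [4, 1, 2, 6, 5, 0, 3]] : List (List (Fin 7))),
        l.IsChain (fun x y => pendantTriangles.Adj x y ∨ (x = u ∧ y = v) ∨ (x = v ∧ y = u)) ∧
          l.Nodup ∧ ∀ w, w ∈ l := by
    decide
  obtain ⟨l, -, hchain, hnodup, hmem⟩ := key u v huv hadj
  exact traceable_of_isChain (hchain.imp fun x y h => (sup_edge_adj_iff_s18 huv x y).2 h) hnodup hmem

/-- For n = 2, 3, 4, 5, 6, 7 the minimum size of a MNT graph of order n is
0, 1, 2, 4, 6, 8 respectively. -/
theorem stmt_18 :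
    ((∀ G : SimpleGraph (Fin 2), MaxNontraceable G → 0 ≤ Nat.card G.edgeSet) ∧
     (∃ G : SimpleGraph (Fin 2), MaxNontraceable G ∧ Nat.card G.edgeSet = 0)) ∧
    ((∀ G : SimpleGraph (Fin 3), MaxNontraceable G → 1 ≤ Nat.card G.edgeSet) ∧
     (∃ G : SimpleGraph (Fin 3), MaxNontraceable G ∧ Nat.card G.edgeSet = 1)) ∧
    ((∀ G : SimpleGraph (Fin 4), MaxNontraceable G → 2 ≤ Nat.card G.edgeSet) ∧
     (∃ G : SimpleGraph (Fin 4), MaxNontraceable G ∧ Nat.card G.edgeSet = 2)) ∧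
    ((∀ G : SimpleGraph (Fin 5), MaxNontraceable G → 4 ≤ Nat.card G.edgeSet) ∧
     (∃ G : SimpleGraph (Fin 5), MaxNontraceable G ∧ Nat.card G.edgeSet = 4)) ∧
    ((∀ G : SimpleGraph (Fin 6), MaxNontraceable G → 6 ≤ Nat.card G.edgeSet) ∧
     (∃ G : SimpleGraph (Fin 6), MaxNontraceable G ∧ Nat.card G.edgeSet = 6)) ∧
    ((∀ G : SimpleGraph (Fin 7), MaxNontraceable G → 8 ≤ Nat.card G.edgeSet) ∧
     (∃ G : SimpleGraph (Fin 7), MaxNontraceable G ∧ Nat.card G.edgeSet = 8)) := by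
  have edges : ∀ (n a m : ℕ), ∑ v, (twoCliques n a).degree v = 2 * m →
      Nat.card (twoCliques n a).edgeSet = m := fun n a m h => by
    rw [← two_mul_card_edgeSet_s18] at h
    omega
  refine ⟨⟨fun G _ => Nat.zero_le _, twoCliques 2 1, maxNontraceable_twoCliques (by norm_num)
      (by norm_num), edges _ _ _ (by decide)⟩,
    ⟨fun G hG => ?_, twoCliques 3 1, maxNontraceable_twoCliques (by norm_num)
      (by norm_num), edges _ _ _ (by decide)⟩,
    ⟨fun G hG => ?_, twoCliques 4 2, maxNontraceable_twoCliques (by norm_num)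
      (by norm_num), edges _ _ _ (by decide)⟩,
    ⟨fun G hG => ?_, twoCliques 5 2, maxNontraceable_twoCliques (by norm_num)
      (by norm_num), edges _ _ _ (by decide)⟩,
    ⟨fun G hG => ?_, twoCliques 6 3, maxNontraceable_twoCliques (by norm_num)
      (by norm_num), edges _ _ _ (by decide)⟩,
    ⟨fun G hG => ?_, pendantTriangles, maxNontraceable_pendantTriangles, ?_⟩⟩
  iterate 3
    rcases hG.le_card_edgeSet_add_one with h | ⟨a, b, ha, hb, hab, h⟩
    · rw [Fintype.card_fin] at h
      omega
    · rw [Fintype.card_fin] at hab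
      obtain rfl := Nat.eq_sub_of_add_eq' hab
      have : a ≤ 4 := by omega
      interval_cases a <;> omega
  · have := hG.le_card_edgeSet (by simp)
    rw [Fintype.card_fin] at this
    omega
  · have := hG.le_card_edgeSet (by simp)
    rw [Fintype.card_fin] at this
    omega
  · have h : ∑ v, pendantTriangles.degree v = 2 * 8 := by decide
    rw [← two_mul_card_edgeSet_s18] at h
    omega
end
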